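/- (Smoothing effect.) Let d > 2s and let ρ be an admissible weight with exponents (γ₀,γ) and constants c, C. There exists K > 0, depending only on m, γ, s, d and the constant C in the weight bounds, such that for every p₀ ∈ [1,∞) and every nonnegative u₀ with ∫_{ℝ^d} u₀ ρ dx < ∞ and u₀ ∈ L^∞(ℝ^d), there exists a weak solution u of the Cauchy problem ρ u_t + (-Δ)^s(u^m) = 0 with initial datum u₀(x)ρ(x)dx satisfying ess sup_{x∈ℝ^d} u(x,t) ≤ K t^{-α₀} ∥u₀∥_{p₀,ρ}^{β₀} for a.e. t > 0, where α₀ = (d-γ)/((m-1)(d-γ) + (2s-γ)p₀) and β₀ = (2s-γ)p₀/((m-1)(d-γ) + (2s-γ)p₀). -/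

import Mathlib

open MeasureTheory Filter Topology Set
open scoped ENNReal NNReal

noncomputable section

/-- `d`-dimensional Euclidean space. -/
abbrev Ed (d : ℕ) : Type := EuclideanSpace ℝ (Fin d)

/-- An admissible weight with exponents `(γ₀, γ)` and constants `0 < c < C`:
a measurable, everywhere positive function comparable to `|x|^{-γ₀}` near the
origin and to `|x|^{-γ}` at infinity. -/
def AdmissibleWeight (d : ℕ) (ρ : Ed d → ℝ) (γ₀ γ c C : ℝ) : Prop :=
  0 < c ∧ c < C ∧ Measurable ρ ∧ (∀ x, 0 < ρ x) ∧
    (∀ᵐ x ∂(volume : Measure (Ed d)), ‖x‖ ≤ 1 →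
      c * ‖x‖ ^ (-γ₀) ≤ ρ x ∧ ρ x ≤ C * ‖x‖ ^ (-γ₀)) ∧
    (∀ᵐ x ∂(volume : Measure (Ed d)), 1 < ‖x‖ →
      c * ‖x‖ ^ (-γ) ≤ ρ x ∧ ρ x ≤ C * ‖x‖ ^ (-γ))

/-- The Gagliardo bilinear form `E(v,w)` of order `s` with normalizing constant `κ`. -/
def gagliardoE (d : ℕ) (s κ : ℝ) (v w : Ed d → ℝ) : ℝ :=
  (κ / 2) * ∫ p : Ed d × Ed d,
    (v p.1 - v p.2) * (w p.1 - w p.2) / ‖p.1 - p.2‖ ^ ((d : ℝ) + 2 * s)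

/-- The squared homogeneous fractional Sobolev seminorm `‖v‖_{Ḣ^s}² = E(v,v)`,
with values in `[0,∞]`. -/
def gagliardoSq (d : ℕ) (s κ : ℝ) (v : Ed d → ℝ) : ℝ≥0∞ :=
  ENNReal.ofReal (κ / 2) * ∫⁻ p : Ed d × Ed d,
    ENNReal.ofReal ((v p.1 - v p.2) ^ 2 / ‖p.1 - p.2‖ ^ ((d : ℝ) + 2 * s))

/-- The weighted `L^p` norm `‖v‖_{p,ρ}`, valued in `[0,∞]`. -/
def wnorm (d : ℕ) (p : ℝ) (ρ v : Ed d → ℝ) : ℝ≥0∞ :=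
  (∫⁻ x : Ed d, ENNReal.ofReal (|v x| ^ p * ρ x)) ^ (1 / p)

/-- Smooth compactly supported test functions on `ℝ^d × (0,∞)`. -/
def IsTestFn (d : ℕ) (φ : Ed d × ℝ → ℝ) : Prop :=
  ContDiff ℝ (⊤ : ℕ∞) φ ∧ HasCompactSupport φ ∧ tsupport φ ⊆ univ ×ˢ Ioi (0 : ℝ)

/-- Conditions (i)–(iii) of the definition of weak solution of
`ρ u_t + (-Δ)^s(u^m) = 0` on `ℝ^d × (0,∞)` (no initial datum prescribed). -/
structure WeakSolCore (d : ℕ) (s m κ : ℝ) (ρ : Ed d → ℝ) (u : Ed d → ℝ → ℝ) : Prop where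
  measurable : Measurable (Function.uncurry u)
  nonneg : ∀ x t, 0 ≤ u x t
  /-- (i), first part: `ess sup_{t>0} ∫ u(·,t) ρ < ∞`. -/
  massBound : ∃ M : ℝ, ∀ᵐ t ∂(volume.restrict (Ioi (0 : ℝ))),
    Integrable (fun x : Ed d => u x t * ρ x) ∧ (∫ x : Ed d, u x t * ρ x) ≤ M
  /-- (i), second part: `u` essentially bounded on `ℝ^d × (τ,∞)` for every `τ > 0`. -/
  essBdd : ∀ τ : ℝ, 0 < τ → ∃ B : ℝ,
    ∀ᵐ p ∂(volume : Measure (Ed d × ℝ)), τ < p.2 → u p.1 p.2 ≤ B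
  /-- (ii), first part: `‖u^m(·,t)‖_{Ḣ^s} < ∞` for a.e. `t > 0`. -/
  energyFinite : ∀ᵐ t ∂(volume.restrict (Ioi (0 : ℝ))),
    gagliardoSq d s κ (fun x => u x t ^ m) < ⊤
  /-- (ii), second part: `t ↦ ‖u^m(·,t)‖_{Ḣ^s}²` locally integrable on `(0,∞)`. -/
  energyLocInt : ∀ t₁ t₂ : ℝ, 0 < t₁ → t₁ < t₂ →
    (∫⁻ t in Ioc t₁ t₂, gagliardoSq d s κ (fun x => u x t ^ m)) ≠ ⊤
  /-- (iii): the weak formulation against all test functions. -/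
  weakForm : ∀ φ : Ed d × ℝ → ℝ, IsTestFn d φ →
    -(∫ t in Ioi (0 : ℝ), ∫ x : Ed d, u x t * deriv (fun τ => φ (x, τ)) t * ρ x)
      + ∫ t in Ioi (0 : ℝ),
          gagliardoE d s κ (fun x => u x t ^ m) (fun x => φ (x, t)) = 0

/-- Condition (iv): `ρ(·)u(·,t) → μ` as `t → 0` essentially, tested against all
bounded continuous functions. -/
def HasInitialTrace (d : ℕ) (ρ : Ed d → ℝ) (u : Ed d → ℝ → ℝ)
    (μ : Measure (Ed d)) : Prop :=
  ∃ N : Set ℝ, volume N = 0 ∧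
    ∀ φ : Ed d → ℝ, Continuous φ → (∃ B : ℝ, ∀ x, |φ x| ≤ B) →
      Tendsto (fun t => ∫ x : Ed d, φ x * (u x t * ρ x))
        (𝓝[(Ioi (0 : ℝ)) \ N] 0) (𝓝 (∫ x, φ x ∂μ))

/-- Weak solution of the Cauchy problem with initial datum `μ`. -/
def IsWeakSolution (d : ℕ) (s m κ : ℝ) (ρ : Ed d → ℝ) (μ : Measure (Ed d))
    (u : Ed d → ℝ → ℝ) : Prop :=
  WeakSolCore d s m κ ρ u ∧ HasInitialTrace d ρ u μ

namespace FracPME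

/-! ### Nonlocal evolution with a bounded kernel -/

section Evolution

variable {X : Type*} [MeasurableSpace X] (μ : Measure X)

/-- The nonlinear nonlocal operator `∫ k(x,y) (v(y)^m - v(x)^m) dy`. -/
def nlOp (k : X → X → ℝ) (m : ℝ) (v : X → ℝ) (x : X) : ℝ :=
  ∫ y, k x y * (v y ^ m - v x ^ m) ∂μ

/-- The operator `nlOp` shifted by `L` times the identity. -/
def shiftOp (k : X → X → ℝ) (m L : ℝ) (v : X → ℝ) (x : X) : ℝ :=
  nlOp μ k m v x + L * v x

/-- One Picard step for `v' = nlOp v`, written with the integrating factor `exp (L t)`. -/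
def picardStep (k : X → X → ℝ) (m L : ℝ) (u₀ : X → ℝ) (v : X → ℝ → ℝ) (x : X) (t : ℝ) : ℝ :=
  Real.exp (-(L * max t 0)) *
    (u₀ x + ∫ s in Ioc 0 (max t 0), Real.exp (L * s) * shiftOp μ k m L (fun y => v y s) x)

/-- The Picard iterates started from zero. -/
def picardIter (k : X → X → ℝ) (m L : ℝ) (u₀ : X → ℝ) : ℕ → X → ℝ → ℝ
  | 0 => fun _ _ => 0
  | n + 1 => picardStep μ k m L u₀ (picardIter k m L u₀ n)

/-- Data of a bounded kernel evolution. -/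
structure KerData (k : X → X → ℝ) (m L A B : ℝ) : Prop where
  meas : Measurable (Function.uncurry k)
  nonneg : ∀ x y, 0 ≤ k x y
  int : ∀ x, Integrable (k x) μ
  bound : ∀ x, ∫ y, k x y ∂μ ≤ A
  hA : 0 ≤ A
  hB : 0 ≤ B
  hm : 1 < m
  hL : A * (m * (2 * B) ^ (m - 1)) ≤ L

variable {μ} {k : X → X → ℝ} {m L A B : ℝ} {u₀ : X → ℝ}

lemma rpow_sub_le {m a b M : ℝ} (hm : 1 < m) (ha : 0 ≤ a) (hab : a ≤ b) (hb : b ≤ M) :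
    b ^ m - a ^ m ≤ m * M ^ (m - 1) * (b - a) := by
  have hM : 0 ≤ M := ha.trans (hab.trans hb)
  have := Convex.norm_image_sub_le_of_norm_hasDerivWithin_le (f := fun r : ℝ => r ^ m)
    (f' := fun r => m * r ^ (m - 1)) (s := Icc 0 M) (x := a) (y := b) (C := m * M ^ (m - 1))
    (fun r hr => (Real.hasDerivAt_rpow_const (Or.inr hm.le)).hasDerivWithinAt)
    (fun r hr => by
      rw [Real.norm_of_nonneg (by have := hr.1; positivity)]
      gcongr
      · exact hr.1
      · exact hr.2)
    (convex_Icc 0 M) ⟨ha, hab.trans hb⟩ ⟨ha.trans hab, hb⟩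
  rw [Real.norm_eq_abs, Real.norm_eq_abs, abs_of_nonneg (sub_nonneg.2 hab)] at this
  exact (le_abs_self _).trans this

lemma KerData.integrable_mul (h : KerData μ k m L A B) {v : X → ℝ} (hv : Measurable v)
    (h0 : ∀ x, 0 ≤ v x) (h2 : ∀ x, v x ≤ 2 * B) (x : X) :
    Integrable (fun y => k x y * v y ^ m) μ := by
  refine (h.int x).mul_bdd (c := (2 * B) ^ m) (hv.pow_const m).aestronglyMeasurable ?_
  refine Eventually.of_forall fun y => ?_
  rw [Real.norm_of_nonneg (Real.rpow_nonneg (h0 y) _)]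
  exact Real.rpow_le_rpow (h0 y) (h2 y) (by linarith [h.hm])

lemma KerData.shiftOp_eq (h : KerData μ k m L A B) {v : X → ℝ} (hv : Measurable v)
    (h0 : ∀ x, 0 ≤ v x) (h2 : ∀ x, v x ≤ 2 * B) (x : X) :
    shiftOp μ k m L v x =
      ∫ y, k x y * v y ^ m ∂μ + (L * v x - (∫ y, k x y ∂μ) * v x ^ m) := by
  unfold shiftOp nlOp
  simp_rw [mul_sub]
  rw [integral_sub (h.integrable_mul hv h0 h2 x) ((h.int x).mul_const _), integral_mul_const]
  ring

lemma KerData.shiftOp_mono (h : KerData μ k m L A B) {v w : X → ℝ} (hv : Measurable v)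
    (hw : Measurable w) (h0 : ∀ x, 0 ≤ v x) (hvw : ∀ x, v x ≤ w x) (h2 : ∀ x, w x ≤ 2 * B)
    (x : X) : shiftOp μ k m L v x ≤ shiftOp μ k m L w x := by
  have hm := h.hm
  rw [h.shiftOp_eq hv h0 (fun x => (hvw x).trans (h2 x)),
    h.shiftOp_eq hw (fun x => (h0 x).trans (hvw x)) h2]
  have h1 : ∫ y, k x y * v y ^ m ∂μ ≤ ∫ y, k x y * w y ^ m ∂μ := by
    refine integral_mono (h.integrable_mul hv h0 (fun x => (hvw x).trans (h2 x)) x)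
      (h.integrable_mul hw (fun x => (h0 x).trans (hvw x)) h2 x) fun y => ?_
    exact mul_le_mul_of_nonneg_left (Real.rpow_le_rpow (h0 y) (hvw y) (by linarith))
      (h.nonneg x y)
  have h3 := rpow_sub_le hm (h0 x) (hvw x) (h2 x)
  have ha : 0 ≤ ∫ y, k x y ∂μ := integral_nonneg (h.nonneg x)
  have h4 : (∫ y, k x y ∂μ) * (w x ^ m - v x ^ m) ≤ L * (w x - v x) := by
    calc (∫ y, k x y ∂μ) * (w x ^ m - v x ^ m)
        ≤ (∫ y, k x y ∂μ) * (m * (2 * B) ^ (m - 1) * (w x - v x)) := by gcongr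
      _ ≤ A * (m * (2 * B) ^ (m - 1) * (w x - v x)) := by
          have := hvw x
          have : 0 ≤ w x - v x := by linarith
          have := h.hB
          gcongr
          exact h.bound x
      _ = A * (m * (2 * B) ^ (m - 1)) * (w x - v x) := by ring
      _ ≤ L * (w x - v x) := by
          have := hvw x
          exact mul_le_mul_of_nonneg_right h.hL (by linarith)
  linarith

lemma shiftOp_const (b : ℝ) (x : X) :
    shiftOp μ k m L (fun _ => b) x = L * b := by
  simp [shiftOp, nlOp]

lemma KerData.shiftOp_nonneg (h : KerData μ k m L A B) {v : X → ℝ} (hv : Measurable v)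
    (h0 : ∀ x, 0 ≤ v x) (h2 : ∀ x, v x ≤ 2 * B) (x : X) : 0 ≤ shiftOp μ k m L v x := by
  have := h.shiftOp_mono (v := fun _ => 0) measurable_const hv (fun _ => le_rfl) h0 h2 x
  rwa [shiftOp_const, mul_zero] at this

lemma KerData.shiftOp_le (h : KerData μ k m L A B) {v : X → ℝ} (hv : Measurable v)
    (h0 : ∀ x, 0 ≤ v x) (h2 : ∀ x, v x ≤ 2 * B) (x : X) :
    shiftOp μ k m L v x ≤ L * (2 * B) := by
  have := h.shiftOp_mono (w := fun _ => 2 * B) hv measurable_const h0 h2 (fun _ => le_rfl) x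
  rwa [shiftOp_const] at this

lemma KerData.measurable_shiftOp [SFinite μ] (h : KerData μ k m L A B) {v : X → ℝ → ℝ}
    (hv : Measurable (Function.uncurry v)) :
    Measurable fun p : X × ℝ => shiftOp μ k m L (fun y => v y p.2) p.1 := by
  unfold shiftOp nlOp
  refine Measurable.add ?_ (measurable_const.mul hv)
  have hk := h.meas
  refine (StronglyMeasurable.integral_prod_right (f := fun (p : X × ℝ) (y : X) =>
    k p.1 y * (v y p.2 ^ m - v p.1 p.2 ^ m)) ?_).measurable
  refine Measurable.stronglyMeasurable ?_
  have h1 : Measurable fun q : (X × ℝ) × X => k q.1.1 q.2 :=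
    hk.comp (measurable_fst.fst.prodMk measurable_snd)
  have h2 : Measurable fun q : (X × ℝ) × X => v q.2 q.1.2 :=
    hv.comp (measurable_snd.prodMk measurable_fst.snd)
  have h3 : Measurable fun q : (X × ℝ) × X => v q.1.1 q.1.2 := hv.comp measurable_fst
  exact h1.mul ((h2.pow_const m).sub (h3.pow_const m))

lemma KerData.measurable_picardStep [SFinite μ] (h : KerData μ k m L A B) {v : X → ℝ → ℝ}
    (hu : Measurable u₀) (hv : Measurable (Function.uncurry v)) :
    Measurable (Function.uncurry (picardStep μ k m L u₀ v)) := by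
  unfold picardStep Function.uncurry
  refine Measurable.mul (by fun_prop) (Measurable.add (hu.comp measurable_fst) ?_)
  have : ∀ p : X × ℝ, ∫ s in Ioc 0 (max p.2 0),
        Real.exp (L * s) * shiftOp μ k m L (fun y => v y s) p.1 =
      ∫ s, ({q : (X × ℝ) × ℝ | 0 < q.2 ∧ q.2 ≤ max q.1.2 0}.indicator
        (fun q => Real.exp (L * q.2) * shiftOp μ k m L (fun y => v y q.2) q.1.1) (p, s)) := by
    intro p
    rw [← integral_indicator measurableSet_Ioc]
    rfl
  simp_rw [this]
  refine (StronglyMeasurable.integral_prod_right (f := fun (p : X × ℝ) (s : ℝ) =>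
    ({q : (X × ℝ) × ℝ | 0 < q.2 ∧ q.2 ≤ max q.1.2 0}.indicator
        (fun q => Real.exp (L * q.2) * shiftOp μ k m L (fun y => v y q.2) q.1.1) (p, s)))
    ?_).measurable
  refine Measurable.stronglyMeasurable ?_
  refine Measurable.indicator ?_ ?_
  · refine Measurable.mul (by fun_prop) ?_
    exact (h.measurable_shiftOp hv).comp (measurable_fst.fst.prodMk measurable_snd)
  · exact (measurableSet_lt measurable_const measurable_snd).inter
      (measurableSet_le measurable_snd (measurable_fst.snd.max measurable_const))

/-- The integrand in a Picard step. -/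
lemma KerData.integrableOn_step [SFinite μ] (h : KerData μ k m L A B) {v : X → ℝ → ℝ}
    (hv : Measurable (Function.uncurry v)) (h0 : ∀ x t, 0 ≤ v x t) (h2 : ∀ x t, v x t ≤ 2 * B)
    (x : X) (a b : ℝ) :
    IntegrableOn (fun s => Real.exp (L * s) * shiftOp μ k m L (fun y => v y s) x) (Ioc a b) := by
  have hvs : ∀ s, Measurable fun y => v y s := fun s => hv.comp (measurable_id.prodMk measurable_const)
  have hc : IntegrableOn (fun s => Real.exp (L * s)) (Ioc a b) :=
    (Continuous.integrableOn_Icc (by fun_prop)).mono_set Ioc_subset_Icc_self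
  refine hc.mul_bdd (c := L * (2 * B)) ?_ ?_
  · exact ((h.measurable_shiftOp hv).comp
      (measurable_const.prodMk measurable_id)).aestronglyMeasurable
  · refine Eventually.of_forall fun s => ?_
    rw [Real.norm_of_nonneg (h.shiftOp_nonneg (hvs s) (fun y => h0 y s) (fun y => h2 y s) x)]
    exact h.shiftOp_le (hvs s) (fun y => h0 y s) (fun y => h2 y s) x

lemma KerData.picardStep_mono [SFinite μ] (h : KerData μ k m L A B) {v w : X → ℝ → ℝ}
    (hv : Measurable (Function.uncurry v)) (hw : Measurable (Function.uncurry w))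
    (h0 : ∀ x t, 0 ≤ v x t) (hvw : ∀ x t, v x t ≤ w x t) (h2 : ∀ x t, w x t ≤ 2 * B)
    (x : X) (t : ℝ) : picardStep μ k m L u₀ v x t ≤ picardStep μ k m L u₀ w x t := by
  unfold picardStep
  gcongr ?_ * (_ + ?_)
  refine setIntegral_mono
    (h.integrableOn_step hv h0 (fun x t => (hvw x t).trans (h2 x t)) x _ _)
    (h.integrableOn_step hw (fun x t => (h0 x t).trans (hvw x t)) h2 x _ _) fun s => ?_
  have hvs : Measurable fun y => v y s := hv.comp (measurable_id.prodMk measurable_const)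
  have hws : Measurable fun y => w y s := hw.comp (measurable_id.prodMk measurable_const)
  exact mul_le_mul_of_nonneg_left (h.shiftOp_mono hvs hws (fun y => h0 y s) (fun y => hvw y s)
    (fun y => h2 y s) x) (Real.exp_pos _).le

lemma integral_exp_mul (L t : ℝ) (ht : 0 ≤ t) :
    ∫ s in Ioc 0 t, Real.exp (L * s) * L = Real.exp (L * t) - 1 := by
  rw [← intervalIntegral.integral_of_le ht]
  have : ∀ s ∈ uIcc 0 t, HasDerivAt (fun s => Real.exp (L * s)) (Real.exp (L * s) * L) s := by
    intro s _
    simpa using ((hasDerivAt_id s).const_mul L).exp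
  rw [intervalIntegral.integral_eq_sub_of_hasDerivAt this
    (Continuous.intervalIntegrable (by fun_prop) _ _)]
  simp

lemma picardStep_const_le (hu : ∀ x, u₀ x ≤ B)
    (x : X) (t : ℝ) : picardStep μ k m L u₀ (fun _ _ => B) x t ≤ B := by
  unfold picardStep
  simp only [shiftOp_const]
  simp_rw [← mul_assoc]
  rw [integral_mul_const, integral_exp_mul L _ (le_max_right _ _)]
  calc _ ≤ Real.exp (-(L * max t 0)) * (B + (Real.exp (L * max t 0) - 1) * B) := by
        gcongr; exact hu x
    _ = Real.exp (-(L * max t 0)) * Real.exp (L * max t 0) * B := by ring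
    _ = B := by rw [← Real.exp_add]; simp

lemma KerData.picardStep_nonneg [SFinite μ] (h : KerData μ k m L A B) (hu0 : ∀ x, 0 ≤ u₀ x)
    {v : X → ℝ → ℝ}
    (hv : Measurable (Function.uncurry v)) (h0 : ∀ x t, 0 ≤ v x t) (h2 : ∀ x t, v x t ≤ 2 * B)
    (x : X) (t : ℝ) : 0 ≤ picardStep μ k m L u₀ v x t := by
  unfold picardStep
  refine mul_nonneg (Real.exp_pos _).le (add_nonneg (hu0 x) (integral_nonneg fun s => ?_))
  have hvs : Measurable fun y => v y s := hv.comp (measurable_id.prodMk measurable_const)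
  exact mul_nonneg (Real.exp_pos _).le (h.shiftOp_nonneg hvs (fun y => h0 y s) (fun y => h2 y s) x)

/-- Picard iterates lie below every supersolution. -/
lemma KerData.picardIter_spec [SFinite μ] (h : KerData μ k m L A B) (hu : Measurable u₀)
    (hu0 : ∀ x, 0 ≤ u₀ x) {v : X → ℝ → ℝ} (hv : Measurable (Function.uncurry v))
    (h0 : ∀ x t, 0 ≤ v x t) (h2 : ∀ x t, v x t ≤ 2 * B)
    (hsup : ∀ x t, picardStep μ k m L u₀ v x t ≤ v x t) (n : ℕ) :
    Measurable (Function.uncurry (picardIter μ k m L u₀ n)) ∧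
      ∀ x t, 0 ≤ picardIter μ k m L u₀ n x t ∧ picardIter μ k m L u₀ n x t ≤ v x t := by
  induction n with
  | zero => exact ⟨measurable_const, fun x t => ⟨le_rfl, h0 x t⟩⟩
  | succ n ih =>
    obtain ⟨hm, hb⟩ := ih
    refine ⟨h.measurable_picardStep hu hm, fun x t => ⟨?_, ?_⟩⟩
    · exact h.picardStep_nonneg hu0 hm (fun x t => (hb x t).1)
        (fun x t => (hb x t).2.trans (h2 x t)) x t
    · exact (h.picardStep_mono hm hv (fun x t => (hb x t).1) (fun x t => (hb x t).2) h2 x t).trans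
        (hsup x t)

lemma KerData.picardIter_bound [SFinite μ] (h : KerData μ k m L A B) (hu : Measurable u₀)
    (hu0 : ∀ x, 0 ≤ u₀ x) (huB : ∀ x, u₀ x ≤ B) (n : ℕ) :
    Measurable (Function.uncurry (picardIter μ k m L u₀ n)) ∧
      ∀ x t, 0 ≤ picardIter μ k m L u₀ n x t ∧ picardIter μ k m L u₀ n x t ≤ B :=
  h.picardIter_spec hu hu0 (v := fun _ _ => B) measurable_const (fun _ _ => h.hB)
    (fun _ _ => by linarith [h.hB]) (picardStep_const_le huB) n

lemma KerData.picardIter_mono [SFinite μ] (h : KerData μ k m L A B) (hu : Measurable u₀)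
    (hu0 : ∀ x, 0 ≤ u₀ x) (huB : ∀ x, u₀ x ≤ B) (x : X) (t : ℝ) :
    Monotone fun n => picardIter μ k m L u₀ n x t := by
  refine monotone_nat_of_le_succ fun n => ?_
  induction n generalizing x t with
  | zero => exact ((h.picardIter_bound hu hu0 huB 1).2 x t).1
  | succ n ih =>
    have h1 := h.picardIter_bound hu hu0 huB n
    have h2 := h.picardIter_bound hu hu0 huB (n + 1)
    exact h.picardStep_mono h1.1 h2.1 (fun x t => (h1.2 x t).1) ih
      (fun x t => by linarith [(h2.2 x t).2, h.hB]) x t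

/-- The limit of the Picard iterates. -/
def picardLim (μ : Measure X) (k : X → X → ℝ) (m L : ℝ) (u₀ : X → ℝ) (x : X) (t : ℝ) : ℝ :=
  ⨆ n, picardIter μ k m L u₀ n x t

lemma KerData.tendsto_picardIter [SFinite μ] (h : KerData μ k m L A B) (hu : Measurable u₀)
    (hu0 : ∀ x, 0 ≤ u₀ x) (huB : ∀ x, u₀ x ≤ B) (x : X) (t : ℝ) :
    Tendsto (fun n => picardIter μ k m L u₀ n x t) atTop (𝓝 (picardLim μ k m L u₀ x t)) :=
  tendsto_atTop_ciSup (h.picardIter_mono hu hu0 huB x t)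
    ⟨B, by rintro _ ⟨n, rfl⟩; exact ((h.picardIter_bound hu hu0 huB n).2 x t).2⟩

lemma KerData.picardLim_bound [SFinite μ] (h : KerData μ k m L A B) (hu : Measurable u₀)
    (hu0 : ∀ x, 0 ≤ u₀ x) (huB : ∀ x, u₀ x ≤ B) :
    Measurable (Function.uncurry (picardLim μ k m L u₀)) ∧
      ∀ x t, 0 ≤ picardLim μ k m L u₀ x t ∧ picardLim μ k m L u₀ x t ≤ B := by
  refine ⟨?_, fun x t => ⟨?_, ?_⟩⟩
  · refine measurable_of_tendsto_metrizable
      (fun n => (h.picardIter_bound hu hu0 huB n).1) ?_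
    rw [tendsto_pi_nhds]
    rintro ⟨x, t⟩
    exact h.tendsto_picardIter hu hu0 huB x t
  · exact ge_of_tendsto' (h.tendsto_picardIter hu hu0 huB x t)
      fun n => ((h.picardIter_bound hu hu0 huB n).2 x t).1
  · exact le_of_tendsto' (h.tendsto_picardIter hu hu0 huB x t)
      fun n => ((h.picardIter_bound hu hu0 huB n).2 x t).2

lemma KerData.picardLim_le [SFinite μ] (h : KerData μ k m L A B) (hu : Measurable u₀)
    (hu0 : ∀ x, 0 ≤ u₀ x) (huB : ∀ x, u₀ x ≤ B) {v : X → ℝ → ℝ}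
    (hv : Measurable (Function.uncurry v))
    (h0 : ∀ x t, 0 ≤ v x t) (h2 : ∀ x t, v x t ≤ 2 * B)
    (hsup : ∀ x t, picardStep μ k m L u₀ v x t ≤ v x t) (x : X) (t : ℝ) :
    picardLim μ k m L u₀ x t ≤ v x t :=
  le_of_tendsto' (h.tendsto_picardIter hu hu0 huB x t)
      fun n => ((h.picardIter_spec hu hu0 hv h0 h2 hsup n).2 x t).2

lemma KerData.tendsto_shiftOp (h : KerData μ k m L A B) {V : ℕ → X → ℝ} {v : X → ℝ}
    (hV : ∀ n, Measurable (V n)) (h0 : ∀ n x, 0 ≤ V n x) (h2 : ∀ n x, V n x ≤ 2 * B)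
    (hlim : ∀ x, Tendsto (fun n => V n x) atTop (𝓝 (v x))) (x : X) :
    Tendsto (fun n => shiftOp μ k m L (V n) x) atTop (𝓝 (shiftOp μ k m L v x)) := by
  have hm := h.hm
  have hpow : ∀ y, Tendsto (fun n => V n y ^ m) atTop (𝓝 (v y ^ m)) := fun y =>
    (hlim y).rpow_const (Or.inr (by linarith))
  unfold shiftOp nlOp
  refine Tendsto.add ?_ ((hlim x).const_mul L)
  refine tendsto_integral_of_dominated_convergence (fun y => k x y * (2 * B) ^ m)
    (fun n => ?_) ((h.int x).mul_const _) (fun n => ?_) ?_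
  · exact (h.int x).aestronglyMeasurable.mul
      (((hV n).pow_const m).sub measurable_const).aestronglyMeasurable
  · refine Eventually.of_forall fun y => ?_
    rw [norm_mul, Real.norm_of_nonneg (h.nonneg x y), Real.norm_eq_abs]
    refine mul_le_mul_of_nonneg_left ?_ (h.nonneg x y)
    have h3 := Real.rpow_le_rpow (h0 n y) (h2 n y) (by linarith : 0 ≤ m)
    have h4 := Real.rpow_le_rpow (h0 n x) (h2 n x) (by linarith : 0 ≤ m)
    have h5 := Real.rpow_nonneg (h0 n y) m
    have h6 := Real.rpow_nonneg (h0 n x) m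
    exact abs_sub_le_of_nonneg_of_le h5 h3 h6 h4
  · exact Eventually.of_forall fun y => ((hpow y).sub (hpow x)).const_mul _

lemma KerData.picardLim_eq [SFinite μ] (h : KerData μ k m L A B) (hu : Measurable u₀)
    (hu0 : ∀ x, 0 ≤ u₀ x) (huB : ∀ x, u₀ x ≤ B) (x : X) (t : ℝ) :
    picardLim μ k m L u₀ x t = picardStep μ k m L u₀ (picardLim μ k m L u₀) x t := by
  have hB := h.hB
  refine tendsto_nhds_unique
    ((tendsto_add_atTop_iff_nat 1).2 (h.tendsto_picardIter hu hu0 huB x t)) ?_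
  change Tendsto (fun n => picardStep μ k m L u₀ (picardIter μ k m L u₀ n) x t) _ _
  unfold picardStep
  refine Tendsto.const_mul _ (Tendsto.const_add _ ?_)
  have hb := h.picardIter_bound hu hu0 huB
  have hms : ∀ n s, Measurable fun y => picardIter μ k m L u₀ n y s := fun n s =>
    (hb n).1.comp (measurable_id.prodMk measurable_const)
  refine tendsto_integral_of_dominated_convergence (fun s => Real.exp (L * s) * (L * (2 * B)))
    (fun n => ?_) ?_ (fun n => ?_) ?_
  · exact (h.integrableOn_step (hb n).1 (fun x t => ((hb n).2 x t).1)
      (fun x t => by linarith [((hb n).2 x t).2]) x _ _).aestronglyMeasurable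
  · exact (Continuous.integrableOn_Icc (by fun_prop)).mono_set Ioc_subset_Icc_self
  · refine Eventually.of_forall fun s => ?_
    have h2 : ∀ y, picardIter μ k m L u₀ n y s ≤ 2 * B := fun y => by
      linarith [((hb n).2 y s).2]
    rw [norm_mul, Real.norm_of_nonneg (Real.exp_pos _).le, Real.norm_of_nonneg
      (h.shiftOp_nonneg (hms n s) (fun y => ((hb n).2 y s).1) h2 x)]
    exact mul_le_mul_of_nonneg_left (h.shiftOp_le (hms n s) (fun y => ((hb n).2 y s).1) h2 x)
      (Real.exp_pos _).le
  · refine Eventually.of_forall fun s => Tendsto.const_mul _ ?_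
    exact h.tendsto_shiftOp (fun n => hms n s) (fun n y => ((hb n).2 y s).1)
      (fun n y => by linarith [((hb n).2 y s).2])
      (fun y => h.tendsto_picardIter hu hu0 huB y s) x

lemma KerData.continuous_picardLim [SFinite μ] (h : KerData μ k m L A B) (hu : Measurable u₀)
    (hu0 : ∀ x, 0 ≤ u₀ x) (huB : ∀ x, u₀ x ≤ B) (x : X) :
    Continuous (picardLim μ k m L u₀ x) := by
  have hB := h.hB
  have hb := h.picardLim_bound hu hu0 huB
  have h1 : picardLim μ k m L u₀ x = fun t => Real.exp (-(L * max t 0)) *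
    (u₀ x + ∫ s in (0:ℝ)..(max t 0),
      Real.exp (L * s) * shiftOp μ k m L (fun y => picardLim μ k m L u₀ y s) x) := by
    ext t
    rw [h.picardLim_eq hu hu0 huB, picardStep,
      intervalIntegral.integral_of_le (le_max_right _ _)]
  have h2 := intervalIntegral.continuous_primitive (μ := volume) (fun a b =>
    (⟨h.integrableOn_step hb.1 (fun x t => (hb.2 x t).1)
      (fun x t => by linarith [(hb.2 x t).2]) x a b,
     h.integrableOn_step hb.1 (fun x t => (hb.2 x t).1)
      (fun x t => by linarith [(hb.2 x t).2]) x b a⟩ : IntervalIntegrable _ volume a b)) 0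
  rw [h1]
  refine Continuous.mul (by fun_prop) (continuous_const.add ?_)
  exact h2.comp (continuous_id.max continuous_const)

lemma KerData.continuous_shiftOp (h : KerData μ k m L A B) {v : X → ℝ → ℝ}
    (hv : Measurable (Function.uncurry v)) (h0 : ∀ x t, 0 ≤ v x t) (h2 : ∀ x t, v x t ≤ 2 * B)
    (hc : ∀ x, Continuous (v x)) (x : X) :
    Continuous fun s => shiftOp μ k m L (fun y => v y s) x := by
  rw [continuous_iff_seqContinuous]
  intro s a hs
  refine h.tendsto_shiftOp (V := fun n y => v y (s n))
    (fun n => hv.comp (measurable_id.prodMk measurable_const)) (fun n y => h0 y _)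
    (fun n y => h2 y _) (fun y => ((hc y).tendsto a).comp hs) x

lemma KerData.hasDerivAt_picardLim [SFinite μ] (h : KerData μ k m L A B) (hu : Measurable u₀)
    (hu0 : ∀ x, 0 ≤ u₀ x) (huB : ∀ x, u₀ x ≤ B) (x : X) {t : ℝ} (ht : 0 < t) :
    HasDerivAt (picardLim μ k m L u₀ x)
      (nlOp μ k m (fun y => picardLim μ k m L u₀ y t) x) t := by
  have hB := h.hB
  have hb := h.picardLim_bound hu hu0 huB
  have hc := h.continuous_picardLim hu hu0 huB
  have hs := h.continuous_shiftOp hb.1 (fun x t => (hb.2 x t).1)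
      (fun x t => by linarith [(hb.2 x t).2]) hc x
  set g : ℝ → ℝ := fun s =>
    Real.exp (L * s) * shiftOp μ k m L (fun y => picardLim μ k m L u₀ y s) x with hg
  have hgc : Continuous g := by
    rw [hg]; exact Continuous.mul (by fun_prop) hs
  have h1 : HasDerivAt (fun t => ∫ s in (0:ℝ)..t, g s) (g t) t :=
    intervalIntegral.integral_hasDerivAt_right (hgc.intervalIntegrable _ _)
      (hgc.stronglyMeasurableAtFilter _ _) hgc.continuousAt
  have h2 : HasDerivAt (fun t => Real.exp (-(L * t))) (Real.exp (-(L * t)) * (-L)) t := by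
    simpa using (((hasDerivAt_id t).const_mul L).neg).exp
  have h3 := h2.mul (h1.const_add (u₀ x))
  have h4 : picardLim μ k m L u₀ x =ᶠ[𝓝 t]
      ((fun t => Real.exp (-(L * t))) * fun t => u₀ x + ∫ s in (0:ℝ)..t, g s) := by
    filter_upwards [lt_mem_nhds ht] with r hr
    rw [h.picardLim_eq hu hu0 huB, picardStep, max_eq_left hr.le, Pi.mul_apply,
      intervalIntegral.integral_of_le hr.le]
  refine (h3.congr_of_eventuallyEq h4).congr_deriv ?_
  have h5 : u₀ x + ∫ s in (0:ℝ)..t, g s = Real.exp (L * t) * picardLim μ k m L u₀ x t := by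
    rw [h4.self_of_nhds, Pi.mul_apply, ← mul_assoc, ← Real.exp_add]
    simp
  have h6 : Real.exp (-(L * t)) * Real.exp (L * t) = 1 := by rw [← Real.exp_add]; simp
  rw [h5, hg]
  simp only [shiftOp]
  linear_combination (nlOp μ k m (fun y => picardLim μ k m L u₀ y t) x) * h6

/-- Time scaling: for `1 ≤ ℓ ≤ 2` the solution lies below its rescaling. -/
lemma KerData.picardLim_scaling [SFinite μ] (h : KerData μ k m L A B) (hu : Measurable u₀)
    (hu0 : ∀ x, 0 ≤ u₀ x) (huB : ∀ x, u₀ x ≤ B) {l : ℝ} (h1 : 1 ≤ l) (hl2 : l ≤ 2)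
    (x : X) (t : ℝ) :
    picardLim μ k m L u₀ x t ≤ l * picardLim μ k m L u₀ x (l ^ (m - 1) * t) := by
  have hB := h.hB
  have hl0 : 0 < l := by linarith
  have hb := h.picardLim_bound hu hu0 huB
  have hc := h.continuous_picardLim hu hu0 huB
  set U := picardLim μ k m L u₀ with hU
  set v : X → ℝ → ℝ := fun x t => l * U x (l ^ (m - 1) * t) with hv
  have hvm : Measurable (Function.uncurry v) := by
    have : Measurable fun p : X × ℝ => (p.1, l ^ (m - 1) * p.2) := by fun_prop
    exact (hb.1.comp this).const_mul l
  have hv0 : ∀ x t, 0 ≤ v x t := fun x t => mul_nonneg hl0.le (hb.2 _ _).1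
  have hv2 : ∀ x t, v x t ≤ 2 * B := fun x t =>
    mul_le_mul hl2 (hb.2 _ _).2 (hb.2 _ _).1 (by norm_num)
  have hvc : ∀ x, Continuous (v x) := fun x =>
    continuous_const.mul ((hc x).comp (continuous_const.mul continuous_id))
  refine h.picardLim_le hu hu0 huB hvm hv0 hv2 ?_ x t
  clear x t
  intro x t
  have hU0 : ∀ t ≤ 0, U x t = u₀ x := by
    intro t ht
    rw [hU, h.picardLim_eq hu hu0 huB, picardStep, max_eq_right ht]; simp
  rcases le_or_gt t 0 with ht | ht
  · rw [picardStep, max_eq_right ht]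
    simp only [mul_zero, neg_zero, Real.exp_zero, Ioc_self, setIntegral_empty, add_zero, one_mul,
      hv]
    rw [hU0 _ (mul_nonpos_of_nonneg_of_nonpos (by positivity) ht)]
    nlinarith [hu0 x]
  · rw [picardStep, max_eq_left ht.le]
    have hder : ∀ s ∈ Ioo 0 t, HasDerivAt (fun s => Real.exp (L * s) * v x s)
        (Real.exp (L * s) * shiftOp μ k m L (fun y => v y s) x) s := by
      intro s hs
      have hls : 0 < l ^ (m - 1) * s := mul_pos (by positivity) hs.1
      have e1 := h.hasDerivAt_picardLim hu hu0 huB x hls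
      have e2 : HasDerivAt (fun s => l ^ (m - 1) * s) (l ^ (m - 1)) s := by
        simpa using (hasDerivAt_id s).const_mul (l ^ (m - 1))
      have e3 : HasDerivAt (v x) _ s := (e1.comp s e2).const_mul l
      have e4 : HasDerivAt (fun s => Real.exp (L * s)) (Real.exp (L * s) * L) s := by
        simpa using ((hasDerivAt_id s).const_mul L).exp
      refine (e4.mul e3).congr_deriv ?_
      have e5 : nlOp μ k m (fun y => v y s) x =
          l ^ m * nlOp μ k m (fun y => U y (l ^ (m - 1) * s)) x := by
        unfold nlOp
        rw [← integral_const_mul]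
        refine integral_congr_ae (Eventually.of_forall fun y => ?_)
        simp only [hv]
        rw [Real.mul_rpow hl0.le (hb.2 _ _).1, Real.mul_rpow hl0.le (hb.2 _ _).1]
        ring
      have e6 : l * l ^ (m - 1) = l ^ m := by
        rw [← Real.rpow_one_add' hl0.le (by linarith [h.hm])]; congr 1; ring
      rw [shiftOp, e5, ← e6]
      ring
    have hcont : Continuous fun s => Real.exp (L * s) * shiftOp μ k m L (fun y => v y s) x :=
      Continuous.mul (by fun_prop) (h.continuous_shiftOp hvm hv0 hv2 hvc x)
    have hFTC := intervalIntegral.integral_eq_sub_of_hasDeriv_right_of_le ht.le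
      (f := fun s => Real.exp (L * s) * v x s)
      (Continuous.continuousOn (Continuous.mul (by fun_prop) (hvc x)))
      (fun s hs => (hder s hs).hasDerivWithinAt) (hcont.intervalIntegrable _ _)
    rw [← intervalIntegral.integral_of_le ht.le, hFTC]
    have e7 : u₀ x ≤ v x 0 := by
      simp only [hv, mul_zero]
      rw [hU0 0 le_rfl]
      nlinarith [hu0 x]
    calc _ ≤ Real.exp (-(L * t)) * (v x 0 + (Real.exp (L * t) * v x t -
            Real.exp (L * 0) * v x 0)) := by gcongr
      _ = Real.exp (-(L * t)) * Real.exp (L * t) * v x t := by simp; ring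
      _ = v x t := by rw [← Real.exp_add]; simp

/-- Aronson–Bénilan type lower bound on the time derivative. -/
lemma KerData.neg_div_le_nlOp [SFinite μ] (h : KerData μ k m L A B) (hu : Measurable u₀)
    (hu0 : ∀ x, 0 ≤ u₀ x) (huB : ∀ x, u₀ x ≤ B) (x : X) {t : ℝ} (ht : 0 < t) :
    -(picardLim μ k m L u₀ x t / ((m - 1) * t)) ≤
      nlOp μ k m (fun y => picardLim μ k m L u₀ y t) x := by
  have hm := h.hm
  set D := nlOp μ k m (fun y => picardLim μ k m L u₀ y t) x
  have e1 : HasDerivAt (picardLim μ k m L u₀ x) D ((1 : ℝ) ^ (m - 1) * t) := by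
    rw [Real.one_rpow, one_mul]; exact h.hasDerivAt_picardLim hu hu0 huB x ht
  have e2 : HasDerivAt (fun l : ℝ => l ^ (m - 1) * t) ((m - 1) * t) 1 := by
    simpa using (Real.hasDerivAt_rpow_const (x := 1) (p := m - 1) (Or.inl one_ne_zero)).mul_const t
  have e3 := (hasDerivAt_id (1:ℝ)).mul (e1.comp 1 e2)
  have e4 : HasDerivAt (fun l : ℝ => l * picardLim μ k m L u₀ x (l ^ (m - 1) * t))
      (picardLim μ k m L u₀ x t + D * ((m - 1) * t)) 1 := by
    refine e3.congr_deriv ?_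
    simp
  have e5 := (hasDerivWithinAt_iff_tendsto_slope' (by simp)).1 (e4.hasDerivWithinAt (s := Ioi 1))
  have e6 : 0 ≤ picardLim μ k m L u₀ x t + D * ((m - 1) * t) := by
    refine ge_of_tendsto e5 ?_
    have : Ioc (1:ℝ) 2 ∈ 𝓝[>] 1 := Ioc_mem_nhdsGT (by norm_num)
    filter_upwards [this] with l hl
    rw [slope_def_field]
    refine div_nonneg ?_ (by linarith [hl.1])
    have := h.picardLim_scaling hu hu0 huB hl.1.le hl.2 x t
    simp only [Real.one_rpow, one_mul]
    linarith
  have e7 : 0 < (m - 1) * t := mul_pos (by linarith) ht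
  rw [← neg_div, div_le_iff₀ e7]
  linarith

end Evolution

/-! ### Symmetric kernels and energy identities -/

section Symmetric

variable {X : Type*} [MeasurableSpace X] {ν : Measure X}

/-- A bounded symmetric kernel supported in a product of sets of finite measure. -/
structure SymKer (ν : Measure X) (k : X → X → ℝ) (S : Set X) (c : ℝ) : Prop where
  meas : Measurable (Function.uncurry k)
  nonneg : ∀ x y, 0 ≤ k x y
  symm : ∀ x y, k x y = k y x
  le : ∀ x y, k x y ≤ c
  supp : ∀ x y, x ∉ S → k x y = 0
  measS : MeasurableSet S
  finS : ν S ≠ ⊤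

/-- The bilinear form of a symmetric kernel. -/
def dform (ν : Measure X) (k : X → X → ℝ) (v w : X → ℝ) : ℝ :=
  2⁻¹ * ∫ p, k p.1 p.2 * ((v p.1 - v p.2) * (w p.1 - w p.2)) ∂(ν.prod ν)

variable {k : X → X → ℝ} {S : Set X} {c : ℝ}

lemma SymKer.supp' (h : SymKer ν k S c) (x y : X) (hy : y ∉ S) : k x y = 0 := by
  rw [h.symm]; exact h.supp y x hy

lemma integrable_of_bounded_of_supp {Y : Type*} [MeasurableSpace Y] {μ : Measure Y}
    {f : Y → ℝ} {T : Set Y} {M : ℝ}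
    (hf : AEStronglyMeasurable f μ) (hT : MeasurableSet T) (hfin : μ T ≠ ⊤)
    (hb : ∀ x, |f x| ≤ M) (hs : ∀ x, x ∉ T → f x = 0) : Integrable f μ := by
  have h1 : IntegrableOn f T μ :=
    Measure.integrableOn_of_bounded (M := M) hfin hf (Eventually.of_forall fun x => hb x)
  have h2 : T.indicator f = f := by
    ext x; by_cases hx : x ∈ T
    · simp [hx]
    · simp [hx, hs x hx]
  rw [← h2]; exact h1.integrable_indicator hT

lemma SymKer.integrable_prod [SFinite ν] (h : SymKer ν k S c) :
    Integrable (fun p : X × X => k p.1 p.2) (ν.prod ν) := by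
  refine integrable_of_bounded_of_supp (T := S ×ˢ S) (M := c) h.meas.aestronglyMeasurable
    (h.measS.prod h.measS) ?_ ?_ ?_
  · rw [Measure.prod_prod]; exact ENNReal.mul_ne_top h.finS h.finS
  · intro p; rw [abs_of_nonneg (h.nonneg _ _)]; exact h.le _ _
  · intro p hp
    by_cases h1 : p.1 ∈ S
    · exact h.supp' _ _ fun h2 => hp ⟨h1, h2⟩
    · exact h.supp _ _ h1

lemma SymKer.integrable_prod_mul [SFinite ν] (h : SymKer ν k S c) {F : X × X → ℝ} {M : ℝ}
    (hF : Measurable F) (hM : ∀ p, |F p| ≤ M) :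
    Integrable (fun p : X × X => k p.1 p.2 * F p) (ν.prod ν) :=
  h.integrable_prod.mul_bdd (c := M) hF.aestronglyMeasurable (Eventually.of_forall hM)

lemma SymKer.integrable_right (h : SymKer ν k S c) (x : X) : Integrable (k x) ν :=
  integrable_of_bounded_of_supp (T := S) (M := c)
    (h.meas.comp (measurable_const.prodMk measurable_id)).aestronglyMeasurable h.measS h.finS
    (fun y => by rw [abs_of_nonneg (h.nonneg _ _)]; exact h.le _ _) (fun y hy => h.supp' _ _ hy)

/-- Total mass bound of a symmetric kernel. -/
lemma SymKer.integral_le (h : SymKer ν k S c) (x : X) : ∫ y, k x y ∂ν ≤ |c| * ν.real S := by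
  have h1 : ∫ y, k x y ∂ν = ∫ y in S, k x y ∂ν := by
    rw [setIntegral_eq_integral_of_forall_compl_eq_zero]
    intro y hy; exact h.supp' _ _ hy
  rw [h1]
  have := norm_setIntegral_le_of_norm_le_const (μ := ν) (s := S) (f := k x) (C := |c|)
    (lt_top_iff_ne_top.2 h.finS) (fun y _ => by
      rw [Real.norm_of_nonneg (h.nonneg _ _)]; exact (h.le _ _).trans (le_abs_self _))
  exact (le_abs_self _).trans this

/-- The Lipschitz constant used for the Picard iteration. -/
def lipConst (ν : Measure X) (S : Set X) (c m B : ℝ) : ℝ :=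
  |c| * ν.real S * (m * (2 * B) ^ (m - 1))

lemma SymKer.kerData (h : SymKer ν k S c) {m B : ℝ} (hm : 1 < m) (hB : 0 ≤ B) :
    KerData ν k m (lipConst ν S c m B) (|c| * ν.real S) B where
  meas := h.meas
  nonneg := h.nonneg
  int := h.integrable_right
  bound := h.integral_le
  hA := by positivity
  hB := hB
  hm := hm
  hL := le_rfl

/-- A bounded solution of the evolution generated by a symmetric kernel. -/
structure Evol (ν : Measure X) (k : X → X → ℝ) (m B : ℝ) (u₀ : X → ℝ) (u : X → ℝ → ℝ) :
    Prop where
  hm : 1 < m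
  meas : Measurable (Function.uncurry u)
  nonneg : ∀ x t, 0 ≤ u x t
  le : ∀ x t, u x t ≤ B
  init_of_le : ∀ x t, t ≤ 0 → u x t = u₀ x
  cont : ∀ x, Continuous (u x)
  deriv : ∀ x t, 0 < t → HasDerivAt (u x) (nlOp ν k m (fun y => u y t) x) t
  bc : ∀ x t, 0 < t → -(u x t / ((m - 1) * t)) ≤ nlOp ν k m (fun y => u y t) x

lemma SymKer.exists_evol [SFinite ν] (h : SymKer ν k S c) {m B : ℝ} (hm : 1 < m)
    {u₀ : X → ℝ} (hu : Measurable u₀) (hu0 : ∀ x, 0 ≤ u₀ x) (huB : ∀ x, u₀ x ≤ B) (hB : 0 ≤ B) :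
    ∃ u, Evol ν k m B u₀ u := by
  have hk := h.kerData hm hB
  refine ⟨picardLim ν k m (lipConst ν S c m B) u₀, hm, ?_, ?_, ?_, ?_, ?_, ?_, ?_⟩
  · exact (hk.picardLim_bound hu hu0 huB).1
  · exact fun x t => ((hk.picardLim_bound hu hu0 huB).2 x t).1
  · exact fun x t => ((hk.picardLim_bound hu hu0 huB).2 x t).2
  · intro x t ht; rw [hk.picardLim_eq hu hu0 huB, picardStep, max_eq_right ht]; simp
  · exact hk.continuous_picardLim hu hu0 huB
  · exact fun x t ht => hk.hasDerivAt_picardLim hu hu0 huB x ht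
  · exact fun x t ht => hk.neg_div_le_nlOp hu hu0 huB x ht

variable {m B : ℝ} {u₀ : X → ℝ} {u : X → ℝ → ℝ}

lemma Evol.init (e : Evol ν k m B u₀ u) (x : X) : u x 0 = u₀ x := e.init_of_le x 0 le_rfl

lemma Evol.meas_t (e : Evol ν k m B u₀ u) (t : ℝ) : Measurable fun x => u x t :=
  e.meas.comp (measurable_id.prodMk measurable_const)

lemma Evol.B_nonneg [Nonempty X] (e : Evol ν k m B u₀ u) : 0 ≤ B := by
  obtain ⟨x⟩ := ‹Nonempty X›
  exact (e.nonneg x 0).trans (e.le x 0)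

lemma Evol.meas_init (e : Evol ν k m B u₀ u) : Measurable u₀ := by
  have := e.meas_t 0
  simpa only [e.init] using this

lemma Evol.pow_le (e : Evol ν k m B u₀ u) (x : X) (t : ℝ) : u x t ^ m ≤ B ^ m :=
  Real.rpow_le_rpow (e.nonneg x t) (e.le x t) (by linarith [e.hm])

lemma Evol.pow_nonneg (e : Evol ν k m B u₀ u) (x : X) (t : ℝ) : 0 ≤ u x t ^ m :=
  Real.rpow_nonneg (e.nonneg x t) m

lemma Evol.abs_pow_sub_le (e : Evol ν k m B u₀ u) (x y : X) (t : ℝ) :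
    |u x t ^ m - u y t ^ m| ≤ B ^ m :=
  abs_sub_le_of_nonneg_of_le (e.pow_nonneg x t) (e.pow_le x t) (e.pow_nonneg y t) (e.pow_le y t)

lemma SymKer.nlOp_eq_zero (h : SymKer ν k S c) (v : X → ℝ) {x : X} (hx : x ∉ S) :
    nlOp ν k m v x = 0 := by
  simp [nlOp, h.supp x _ hx]

lemma Evol.abs_nlOp_le (e : Evol ν k m B u₀ u) (h : SymKer ν k S c) (x : X) (t : ℝ) :
    |nlOp ν k m (fun y => u y t) x| ≤ |c| * ν.real S * B ^ m := by
  have hB : 0 ≤ B := (e.nonneg x 0).trans (e.le x 0)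
  unfold nlOp
  rw [← Real.norm_eq_abs]
  refine (norm_integral_le_of_norm_le ((h.integrable_right x).mul_const (B ^ m))
    (Eventually.of_forall fun y => ?_)).trans ?_
  · rw [norm_mul, Real.norm_of_nonneg (h.nonneg _ _)]
    exact mul_le_mul_of_nonneg_left (e.abs_pow_sub_le y x t) (h.nonneg _ _)
  · rw [integral_mul_const]
    exact mul_le_mul_of_nonneg_right (h.integral_le x) (by positivity)

lemma Evol.measurable_nlOp [SFinite ν] (e : Evol ν k m B u₀ u) (h : SymKer ν k S c) :
    Measurable fun p : X × ℝ => nlOp ν k m (fun y => u y p.2) p.1 := by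
  rcases isEmpty_or_nonempty X with hX | hX
  · exact measurable_of_empty _
  have := ((h.kerData e.hm e.B_nonneg).measurable_shiftOp e.meas).sub
    (e.meas.const_mul (lipConst ν S c m B))
  convert this using 1
  ext p
  simp [shiftOp, Function.uncurry]

lemma SymKer.integral_nlOp_mul [SFinite ν] (h : SymKer ν k S c) {v φ : X → ℝ} {M M' : ℝ}
    (hv : Measurable v) (hφ : Measurable φ) (hM : ∀ x y, |v x ^ m - v y ^ m| ≤ M)
    (hM' : ∀ x, |φ x| ≤ M') :
    ∫ x, nlOp ν k m v x * φ x ∂ν = -dform ν k (fun x => v x ^ m) φ := by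
  set F : X × X → ℝ := fun p => k p.1 p.2 * ((v p.2 ^ m - v p.1 ^ m) * φ p.1) with hF
  have hintg : Integrable F (ν.prod ν) := by
    refine h.integrable_prod_mul (M := M * M') ?_ ?_
    · exact (((hv.comp measurable_snd).pow_const m).sub ((hv.comp measurable_fst).pow_const m)).mul
        (hφ.comp measurable_fst)
    · intro p
      rw [abs_mul]
      exact mul_le_mul (hM _ _) (hM' _) (abs_nonneg _) ((abs_nonneg _).trans (hM p.1 p.1))
  have e1 : ∫ x, nlOp ν k m v x * φ x ∂ν = ∫ p, F p ∂(ν.prod ν) := by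
    rw [integral_prod _ hintg]
    refine integral_congr_ae (Eventually.of_forall fun x => ?_)
    simp only [nlOp, hF]
    rw [← integral_mul_const]
    simp_rw [mul_assoc]
  have e2 : ∫ p, F p.swap ∂(ν.prod ν) = ∫ p, F p ∂(ν.prod ν) := integral_prod_swap F
  have e3 : ∫ p, F p ∂(ν.prod ν) + ∫ p, F p.swap ∂(ν.prod ν) =
      -∫ p, k p.1 p.2 * ((v p.1 ^ m - v p.2 ^ m) * (φ p.1 - φ p.2)) ∂(ν.prod ν) := by
    rw [← integral_neg]
    refine (integral_add hintg hintg.swap).symm.trans ?_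
    refine integral_congr_ae (Eventually.of_forall fun p => ?_)
    simp only [hF, Function.comp, Prod.fst_swap, Prod.snd_swap]
    rw [h.symm p.2 p.1]; ring
  rw [e1, dform]
  linarith

/-- Weighted energy identity. -/
lemma Evol.energy_identity [SFinite ν] (e : Evol ν k m B u₀ u) (h : SymKer ν k S c)
    {G g : ℝ → ℝ} (hG : ∀ r, 0 ≤ r → HasDerivAt G (g r) r) (hg : Continuous g)
    {ψ : X → ℝ} (hψ : Measurable ψ) {M : ℝ} (hM : ∀ x, |ψ x| ≤ M) {t : ℝ} (ht : 0 ≤ t) :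
    (∀ x, x ∉ S → u x t = u₀ x) ∧
    IntegrableOn (fun s => dform ν k (fun x => u x s ^ m) (fun x => g (u x s) * ψ x))
      (Ioc 0 t) ∧
    ∫ x, (G (u x t) - G (u₀ x)) * ψ x ∂ν =
      -∫ s in Ioc 0 t, dform ν k (fun x => u x s ^ m) (fun x => g (u x s) * ψ x) := by
  rcases isEmpty_or_nonempty X with hX | hX
  · have : ν = 0 := Measure.eq_zero_of_isEmpty ν
    subst this
    simp [dform]
  obtain ⟨Mg, hMg⟩ := (isCompact_Icc (a := (0:ℝ)) (b := B)).exists_bound_of_continuousOn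
    hg.continuousOn
  have hMgn : 0 ≤ Mg := (norm_nonneg _).trans (hMg 0 ⟨le_rfl, e.B_nonneg⟩)
  have hg' : ∀ x s, |g (u x s)| ≤ Mg := fun x s => hMg _ ⟨e.nonneg x s, e.le x s⟩
  have hnm := e.measurable_nlOp h
  have hbd : ∀ x s, |nlOp ν k m (fun y => u y s) x| ≤ |c| * ν.real S * B ^ m := e.abs_nlOp_le h
  -- pointwise identity
  have hpt : ∀ (G g : ℝ → ℝ), (∀ r, 0 ≤ r → HasDerivAt G (g r) r) → Continuous g → ∀ x,
      G (u x t) - G (u₀ x) =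
      ∫ s in Ioc 0 t, g (u x s) * nlOp ν k m (fun y => u y s) x := by
    intro G g hG hg x
    obtain ⟨Mg, hMg⟩ := (isCompact_Icc (a := (0:ℝ)) (b := B)).exists_bound_of_continuousOn
      hg.continuousOn
    have hGc : ContinuousOn G (Ici 0) := fun r hr => (hG r hr).continuousAt.continuousWithinAt
    rw [← intervalIntegral.integral_of_le ht, ← e.init x]
    symm
    refine intervalIntegral.integral_eq_sub_of_hasDerivAt_of_le ht
      (f := fun s => G (u x s)) ?_ ?_ ?_
    · exact hGc.comp (e.cont x).continuousOn (fun s _ => e.nonneg x s)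
    · intro s hs
      exact (hG _ (e.nonneg x s)).comp s (e.deriv x s hs.1)
    · rw [intervalIntegrable_iff_integrableOn_Ioc_of_le ht]
      refine Measure.integrableOn_of_bounded (M := Mg * (|c| * ν.real S * B ^ m)) (by simp) ?_ ?_
      · refine (Measurable.mul ?_ ?_).aestronglyMeasurable
        · exact hg.measurable.comp (e.cont x).measurable
        · exact hnm.comp (measurable_const.prodMk measurable_id)
      · refine Eventually.of_forall fun s => ?_
        rw [norm_mul]
        exact mul_le_mul (hMg _ ⟨e.nonneg x s, e.le x s⟩) (hbd x s) (norm_nonneg _)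
          ((norm_nonneg _).trans (hMg 0 ⟨le_rfl, e.B_nonneg⟩))
  have hψM : 0 ≤ M := (abs_nonneg _).trans (hM (Classical.arbitrary X))
  -- the integrand on space-time
  set H : X × ℝ → ℝ := fun p => g (u p.1 p.2) * nlOp ν k m (fun y => u y p.2) p.1 * ψ p.1 with hH
  have hHm : Measurable H :=
    ((hg.measurable.comp e.meas).mul hnm).mul (hψ.comp measurable_fst)
  have hHint : Integrable H (ν.prod (volume.restrict (Ioc 0 t))) := by
    refine integrable_of_bounded_of_supp (T := S ×ˢ univ)
      (M := Mg * (|c| * ν.real S * B ^ m) * M) hHm.aestronglyMeasurable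
      (h.measS.prod MeasurableSet.univ) ?_ ?_ ?_
    · rw [Measure.prod_prod]; exact ENNReal.mul_ne_top h.finS (by simp)
    · intro p
      have hB := e.B_nonneg
      simp only [hH, abs_mul]
      gcongr
      · exact hg' _ _
      · have := hbd p.1 p.2; simpa [abs_mul] using this
      · exact hM _
    · intro p hp
      have : p.1 ∉ S := fun h1 => hp ⟨h1, mem_univ _⟩
      simp [hH, h.nlOp_eq_zero _ this]
  have hds : ∀ s, ∫ x, H (x, s) ∂ν =
      -dform ν k (fun x => u x s ^ m) (fun x => g (u x s) * ψ x) := by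
    intro s
    rw [← h.integral_nlOp_mul (φ := fun x => g (u x s) * ψ x) (M := B ^ m) (M' := Mg * M)
      (e.meas_t s) ((hg.measurable.comp (e.meas_t s)).mul hψ) (fun x y => e.abs_pow_sub_le x y s)]
    · refine integral_congr_ae (Eventually.of_forall fun x => ?_)
      simp only [hH]; ring
    · intro x; rw [abs_mul]; exact mul_le_mul (hg' _ _) (hM _) (abs_nonneg _) hMgn
  refine ⟨?_, ?_, ?_⟩
  · intro x hx
    have := hpt id (fun _ => 1) (fun r _ => hasDerivAt_id r) continuous_const x
    simp only [h.nlOp_eq_zero _ hx] at this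
    simpa [sub_eq_zero] using this
  · have := hHint.integral_prod_right
    simp_rw [hds] at this
    simpa [IntegrableOn] using this.neg
  · simp_rw [hpt G g hG hg, ← integral_mul_const]
    rw [← integral_neg]
    simp_rw [← hds]
    rw [← integral_integral_swap (f := fun x s => H (x, s)) hHint]

end Symmetric

/-! ### A priori estimates for the bounded-kernel evolution -/

section Estimates

variable {X : Type*} [MeasurableSpace X] {ν : Measure X}
  {k : X → X → ℝ} {S : Set X} {c m B : ℝ} {u₀ : X → ℝ} {u : X → ℝ → ℝ}

lemma rpow_le_of_le {r B q : ℝ} (hr : 0 ≤ r) (hB : r ≤ B) (hq : 1 ≤ q) :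
    r ^ q ≤ B ^ (q - 1) * r := by
  have h1 : r ^ q = r ^ (q - 1) * r := by
    rw [← Real.rpow_add_one' hr (by linarith)]; congr 1; ring
  rw [h1]
  exact mul_le_mul_of_nonneg_right (Real.rpow_le_rpow hr hB (by linarith)) hr

lemma dform_nonneg_of {v w : X → ℝ} (hk : ∀ x y, 0 ≤ k x y)
    (h : ∀ x y, 0 ≤ (v x - v y) * (w x - w y)) : 0 ≤ dform ν k v w :=
  mul_nonneg (by norm_num) (integral_nonneg fun _ => mul_nonneg (hk _ _) (h _ _))

lemma rpow_sub_mul_nonneg {a b p q : ℝ} (ha : 0 ≤ a) (hb : 0 ≤ b) (hp : 0 ≤ p) (hq : 0 ≤ q) :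
    0 ≤ (a ^ p - b ^ p) * (a ^ q - b ^ q) := by
  rcases le_total a b with h | h
  · exact mul_nonneg_of_nonpos_of_nonpos
      (sub_nonpos.2 (Real.rpow_le_rpow ha h hp)) (sub_nonpos.2 (Real.rpow_le_rpow ha h hq))
  · exact mul_nonneg (sub_nonneg.2 (Real.rpow_le_rpow hb h hp))
      (sub_nonneg.2 (Real.rpow_le_rpow hb h hq))

lemma integrable_rpow_of {Y : Type*} [MeasurableSpace Y] {μ : Measure Y} {f : Y → ℝ} {q : ℝ}
    (hf : Integrable f μ) (hm : Measurable f)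
    (h0 : ∀ x, 0 ≤ f x) (hB : ∀ x, f x ≤ B) (hq : 1 ≤ q) :
    Integrable (fun x => f x ^ q) μ := by
  refine (hf.const_mul (B ^ (q - 1))).mono' (hm.pow_const q).aestronglyMeasurable
    (Eventually.of_forall fun x => ?_)
  rw [Real.norm_of_nonneg (Real.rpow_nonneg (h0 x) q)]
  exact rpow_le_of_le (h0 x) (hB x) hq

/-- Power form of the energy identity with the trivial weight. -/
lemma Evol.rpow_identity [SFinite ν] (e : Evol ν k m B u₀ u) (h : SymKer ν k S c) {q : ℝ}
    (hq : 0 ≤ q) {t : ℝ} (ht : 0 ≤ t) :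
    IntegrableOn (fun s => dform ν k (fun x => u x s ^ m) (fun x => u x s ^ q)) (Ioc 0 t) ∧
    ∫ x, (u x t ^ (q + 1) - u₀ x ^ (q + 1)) ∂ν =
      -((q + 1) * ∫ s in Ioc 0 t, dform ν k (fun x => u x s ^ m) (fun x => u x s ^ q)) := by
  have hq1 : q + 1 ≠ 0 := by linarith
  have := e.energy_identity h (G := fun r => r ^ (q + 1) / (q + 1)) (g := fun r => r ^ q)
    (fun r hr => by
      refine ((Real.hasDerivAt_rpow_const (p := q + 1) (Or.inr (by linarith))).div_const
        (q + 1)).congr_deriv ?_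
      rw [add_sub_cancel_right]; field_simp)
    (Real.continuous_rpow_const hq) (ψ := fun _ => 1) measurable_const (M := 1) (by simp) ht
  simp only [mul_one] at this
  refine ⟨this.2.1, ?_⟩
  have h3 := this.2.2
  have h4 : ∀ x, u x t ^ (q + 1) / (q + 1) - u₀ x ^ (q + 1) / (q + 1) =
      (u x t ^ (q + 1) - u₀ x ^ (q + 1)) * (q + 1)⁻¹ := fun x => by ring
  simp_rw [h4] at h3
  rw [integral_mul_const] at h3
  rw [← div_eq_mul_inv, div_eq_iff hq1] at h3
  rw [h3]; ring

lemma Evol.init_nonneg (e : Evol ν k m B u₀ u) (x : X) : 0 ≤ u₀ x := e.init x ▸ e.nonneg x 0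

lemma Evol.init_le (e : Evol ν k m B u₀ u) (x : X) : u₀ x ≤ B := e.init x ▸ e.le x 0

lemma Evol.eq_init [SFinite ν] (e : Evol ν k m B u₀ u) (h : SymKer ν k S c) (t : ℝ)
    {x : X} (hx : x ∉ S) : u x t = u₀ x := by
  rcases le_total t 0 with ht | ht
  · exact e.init_of_le x t ht
  exact (e.energy_identity h (G := id) (g := fun _ => 1) (fun r _ => hasDerivAt_id r) continuous_const
    (ψ := fun _ => 1) measurable_const (M := 1) (by simp) ht).1 x hx

lemma Evol.abs_sub_init_le (e : Evol ν k m B u₀ u) (x : X) (t : ℝ) : |u x t - u₀ x| ≤ B :=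
  abs_sub_le_of_nonneg_of_le (e.nonneg x t) (e.le x t) (e.init_nonneg x) (e.init_le x)

lemma Evol.integrable [SFinite ν] (e : Evol ν k m B u₀ u) (h : SymKer ν k S c)
    (hi : Integrable u₀ ν) (t : ℝ) : Integrable (fun x => u x t) ν := by
  have h1 : Integrable (fun x => u x t - u₀ x) ν :=
    integrable_of_bounded_of_supp (T := S) (M := B)
      ((e.meas_t t).sub e.meas_init).aestronglyMeasurable h.measS h.finS
      (fun x => e.abs_sub_init_le x t) (fun x hx => by rw [e.eq_init h t hx, sub_self])
  exact (h1.add hi).congr (Eventually.of_forall fun x => by simp)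

lemma Evol.integrable_rpow [SFinite ν] (e : Evol ν k m B u₀ u) (h : SymKer ν k S c)
    (hi : Integrable u₀ ν) (t : ℝ) {q : ℝ} (hq : 1 ≤ q) :
    Integrable (fun x => u x t ^ q) ν :=
  integrable_rpow_of (e.integrable h hi t) (e.meas_t t) (fun x => e.nonneg x t)
    (fun x => e.le x t) hq

lemma Evol.integral_rpow_add [SFinite ν] (e : Evol ν k m B u₀ u) (h : SymKer ν k S c)
    (hi : Integrable u₀ ν) {t : ℝ} (ht : 0 ≤ t) {q : ℝ} (hq : 0 ≤ q) :
    ∫ x, u x t ^ (q + 1) ∂ν +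
      (q + 1) * ∫ s in Ioc 0 t, dform ν k (fun x => u x s ^ m) (fun x => u x s ^ q) =
      ∫ x, u₀ x ^ (q + 1) ∂ν := by
  have h1 := (e.rpow_identity h hq ht).2
  rw [integral_sub (e.integrable_rpow h hi t (by linarith))
    (integrable_rpow_of hi e.meas_init e.init_nonneg e.init_le (by linarith))] at h1
  linarith

/-- Mass conservation. -/
lemma Evol.integral_eq [SFinite ν] (e : Evol ν k m B u₀ u) (h : SymKer ν k S c)
    (hi : Integrable u₀ ν) {t : ℝ} (ht : 0 ≤ t) : ∫ x, u x t ∂ν = ∫ x, u₀ x ∂ν := by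
  have := e.integral_rpow_add h hi ht le_rfl
  simpa [dform] using this

/-- The `L^p` norms do not increase. -/
lemma Evol.integral_rpow_le [SFinite ν] (e : Evol ν k m B u₀ u) (h : SymKer ν k S c)
    (hi : Integrable u₀ ν) {t : ℝ} (ht : 0 ≤ t) {p : ℝ} (hp : 1 ≤ p) :
    ∫ x, u x t ^ p ∂ν ≤ ∫ x, u₀ x ^ p ∂ν := by
  have := e.integral_rpow_add h hi ht (q := p - 1) (by linarith)
  rw [sub_add_cancel] at this
  have h2 : 0 ≤ ∫ s in Ioc 0 t, dform ν k (fun x => u x s ^ m) (fun x => u x s ^ (p - 1)) :=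
    integral_nonneg fun s => dform_nonneg_of h.nonneg fun x y =>
      rpow_sub_mul_nonneg (e.nonneg x s) (e.nonneg y s) (by linarith [e.hm]) (by linarith)
  have h3 : 0 ≤ p * ∫ s in Ioc 0 t,
      dform ν k (fun x => u x s ^ m) (fun x => u x s ^ (p - 1)) := mul_nonneg (by linarith) h2
  linarith

lemma Evol.dissipation_le [SFinite ν] (e : Evol ν k m B u₀ u) (h : SymKer ν k S c)
    (hi : Integrable u₀ ν) {t : ℝ} (ht : 0 ≤ t) {q : ℝ} (hq : 0 ≤ q) :
    ∫ s in Ioc 0 t, dform ν k (fun x => u x s ^ m) (fun x => u x s ^ q) ≤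
      B ^ q / (q + 1) * ∫ x, u₀ x ∂ν := by
  have h1 := e.integral_rpow_add h hi ht hq
  have h2 : 0 ≤ ∫ x, u x t ^ (q + 1) ∂ν :=
    integral_nonneg fun x => Real.rpow_nonneg (e.nonneg x t) _
  have h3 : ∫ x, u₀ x ^ (q + 1) ∂ν ≤ B ^ q * ∫ x, u₀ x ∂ν := by
    rw [← integral_const_mul]
    refine integral_mono
      (integrable_rpow_of hi e.meas_init e.init_nonneg e.init_le (by linarith))
      (hi.const_mul _) fun x => ?_
    have := rpow_le_of_le (e.init_nonneg x) (e.init_le x) (q := q + 1) (by linarith)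
    rwa [add_sub_cancel_right] at this
  rw [div_mul_eq_mul_div, le_div_iff₀ (by linarith)]
  linarith

/-- Energy bound for truncations, from the one-sided bound on the time derivative. -/
lemma Evol.truncated_energy_le [SFinite ν] (e : Evol ν k m B u₀ u) (h : SymKer ν k S c)
    (hi : Integrable u₀ ν) {t : ℝ} (ht : 0 < t) {l : ℝ} (hl : 0 ≤ l) :
    dform ν k (fun x => max (u x t ^ m - l) 0) (fun x => max (u x t ^ m - l) 0) ≤
      1 / ((m - 1) * t) * ∫ x, u x t * max (u x t ^ m - l) 0 ∂ν := by
  have hm := e.hm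
  set φ : X → ℝ := fun x => max (u x t ^ m - l) 0 with hφ
  have hφm : Measurable φ := (((e.meas_t t).pow_const m).sub_const l).max measurable_const
  have hφ0 : ∀ x, 0 ≤ φ x := fun x => le_max_right _ _
  have hφB : ∀ x, φ x ≤ B ^ m := fun x =>
    max_le (by linarith [e.pow_le x t]) ((e.pow_nonneg x t).trans (e.pow_le x t))
  have hφa : ∀ x, |φ x| ≤ B ^ m := fun x => by rw [abs_of_nonneg (hφ0 x)]; exact hφB x
  have h1 := h.integral_nlOp_mul (M := B ^ m) (M' := B ^ m) (e.meas_t t) hφm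
    (fun x y => e.abs_pow_sub_le x y t) hφa
  have h2 : dform ν k φ φ ≤ dform ν k (fun x => u x t ^ m) φ := by
    refine mul_le_mul_of_nonneg_left ?_ (by norm_num)
    refine integral_mono ?_ ?_ fun p => ?_
    · refine h.integrable_prod_mul (M := B ^ m * B ^ m) ?_ fun p => ?_
      · exact ((hφm.comp measurable_fst).sub (hφm.comp measurable_snd)).mul
          ((hφm.comp measurable_fst).sub (hφm.comp measurable_snd))
      · have := abs_sub_le_of_nonneg_of_le (hφ0 p.1) (hφB p.1) (hφ0 p.2) (hφB p.2)
        rw [abs_mul]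
        exact mul_le_mul this this (abs_nonneg _) ((abs_nonneg _).trans this)
    · refine h.integrable_prod_mul (M := B ^ m * B ^ m) ?_ fun p => ?_
      · exact ((((e.meas_t t).comp measurable_fst).pow_const m).sub
          (((e.meas_t t).comp measurable_snd).pow_const m)).mul
          ((hφm.comp measurable_fst).sub (hφm.comp measurable_snd))
      · have := abs_sub_le_of_nonneg_of_le (hφ0 p.1) (hφB p.1) (hφ0 p.2) (hφB p.2)
        have h3 := e.abs_pow_sub_le p.1 p.2 t
        rw [abs_mul]
        exact mul_le_mul h3 this (abs_nonneg _) ((abs_nonneg _).trans h3)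
    · refine mul_le_mul_of_nonneg_left ?_ (h.nonneg _ _)
      simp only [hφ]
      rcases max_cases (u p.1 t ^ m - l) 0 with ⟨h1, h1'⟩ | ⟨h1, h1'⟩ <;>
      rcases max_cases (u p.2 t ^ m - l) 0 with ⟨h2, h2'⟩ | ⟨h2, h2'⟩ <;>
      rw [h1, h2] <;> nlinarith
  refine h2.trans ?_
  have h4 : dform ν k (fun x => u x t ^ m) φ =
      ∫ x, -(nlOp ν k m (fun y => u y t) x * φ x) ∂ν := by
    rw [integral_neg, h1, neg_neg]
  rw [h4, ← integral_const_mul]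
  have hiu := e.integrable h hi t
  refine integral_mono ?_ ?_ fun x => ?_
  · refine (integrable_of_bounded_of_supp (T := S) (M := |c| * ν.real S * B ^ m * B ^ m) ?_
      h.measS h.finS ?_ ?_).neg
    · exact (((e.measurable_nlOp h).comp (measurable_id.prodMk measurable_const)).mul
        hφm).aestronglyMeasurable
    · intro x; rw [abs_mul]
      exact mul_le_mul (e.abs_nlOp_le h x t) (hφa x) (abs_nonneg _)
        ((abs_nonneg _).trans (e.abs_nlOp_le h x t))
    · intro x hx; rw [h.nlOp_eq_zero _ hx, zero_mul]
  · refine (hiu.mul_bdd (c := B ^ m) hφm.aestronglyMeasurable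
      (Eventually.of_forall hφa)).const_mul _
  · have := mul_le_mul_of_nonneg_right (e.bc x t ht) (hφ0 x)
    have h5 : -(u x t / ((m - 1) * t)) * φ x = -(1 / ((m - 1) * t) * (u x t * φ x)) := by ring
    simp only
    linarith

lemma rpow_sub_sq_le {m a b : ℝ} (hm : 1 < m) (ha : 0 ≤ a) (hb : 0 ≤ b) :
    (a ^ m - b ^ m) ^ 2 ≤
      m / (m - 1) * ((a ^ m - b ^ m) * (a ^ (m - 1) - b ^ (m - 1))) * (a + b) := by
  wlog hab : b ≤ a generalizing a b
  · have := this hb ha (le_of_not_ge hab)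
    calc (a ^ m - b ^ m) ^ 2 = (b ^ m - a ^ m) ^ 2 := by ring
      _ ≤ _ := this
      _ = _ := by ring
  have hm1 : 0 < m - 1 := by linarith
  have hy := Real.young_inequality_of_nonneg ha (Real.rpow_nonneg hb (m - 1))
    (Real.HolderConjugate.conjExponent hm)
  rw [Real.conjExponent, ← Real.rpow_mul hb, mul_div_cancel₀ _ hm1.ne'] at hy
  have ea : a * a ^ (m - 1) = a ^ m := by
    rw [← Real.rpow_one_add' ha (by linarith)]; congr 1; ring
  have h1 : a ^ m - b ^ m ≤ m / (m - 1) * (a ^ (m - 1) - b ^ (m - 1)) * a := by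
    rw [div_mul_eq_mul_div, div_mul_eq_mul_div, le_div_iff₀ hm1]
    have h2 : m * (a * b ^ (m - 1)) ≤ a ^ m + (m - 1) * b ^ m := by
      calc m * (a * b ^ (m - 1)) ≤ m * (a ^ m / m + b ^ m / (m / (m - 1))) := by gcongr
        _ = a ^ m + (m - 1) * b ^ m := by field_simp
    nlinarith [h2, ea]
  have h3 : 0 ≤ a ^ m - b ^ m := sub_nonneg.2 (Real.rpow_le_rpow hb hab (by linarith))
  have h4 : 0 ≤ a ^ (m - 1) - b ^ (m - 1) := sub_nonneg.2 (Real.rpow_le_rpow hb hab hm1.le)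
  calc (a ^ m - b ^ m) ^ 2 = (a ^ m - b ^ m) * (a ^ m - b ^ m) := sq _
    _ ≤ (a ^ m - b ^ m) * (m / (m - 1) * (a ^ (m - 1) - b ^ (m - 1)) * a) := by gcongr
    _ ≤ (a ^ m - b ^ m) * (m / (m - 1) * (a ^ (m - 1) - b ^ (m - 1)) * (a + b)) := by
        gcongr; linarith
    _ = _ := by ring

lemma abs_mul_le_of_sq_le {x y P Q ε : ℝ} (hP : 0 ≤ P) (hQ : 0 ≤ Q) (hε : 0 < ε)
    (h : x ^ 2 ≤ P * Q) : |x * y| ≤ (ε * P + Q * y ^ 2 / ε) / 2 := by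
  have h0 : 0 ≤ (ε * P + Q * y ^ 2 / ε) / 2 := by positivity
  refine abs_le_of_sq_le_sq ?_ h0
  have h1 : (ε * P) * (Q * y ^ 2 / ε) = P * Q * y ^ 2 := by field_simp
  have h2 : (x * y) ^ 2 ≤ P * Q * y ^ 2 := by
    rw [mul_pow]; exact mul_le_mul_of_nonneg_right h (sq_nonneg _)
  nlinarith [sq_nonneg (ε * P - Q * y ^ 2 / ε)]

/-- Short-time control of localized masses. -/
lemma Evol.abs_integral_sub_mul_le [SFinite ν] (e : Evol ν k m B u₀ u) (h : SymKer ν k S c)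
    (hi : Integrable u₀ ν) {φ : X → ℝ} (hφ : Measurable φ) {M G : ℝ} (hM : ∀ x, |φ x| ≤ M)
    (hG : ∀ᵐ x ∂ν, ∫ y, k x y * (φ x - φ y) ^ 2 ∂ν ≤ G) {t : ℝ} (ht : 0 ≤ t)
    {ε : ℝ} (hε : 0 < ε) :
    |∫ x, (u x t - u₀ x) * φ x ∂ν| ≤
      (ε * (B ^ (m - 1) / (m - 1)) + t * G / ε) / 2 * ∫ x, u₀ x ∂ν := by
  have hm := e.hm
  have hm1 : 0 < m - 1 := by linarith
  obtain ⟨-, h2, h3⟩ := e.energy_identity h (G := id) (g := fun _ => 1)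
    (fun r _ => hasDerivAt_id r) continuous_const hφ hM ht
  simp only [one_mul, id] at h2 h3
  have hI : 0 ≤ ∫ x, u₀ x ∂ν := integral_nonneg e.init_nonneg
  set D : ℝ → ℝ := fun s => dform ν k (fun x => u x s ^ m) (fun x => u x s ^ (m - 1)) with hD
  have hDint : IntegrableOn D (Ioc 0 t) := (e.rpow_identity h hm1.le ht).1
  have key : ∀ s, 0 ≤ s → |dform ν k (fun x => u x s ^ m) φ| ≤
      ε * (m / (m - 1)) / 2 * D s + G * (∫ x, u₀ x ∂ν) / (2 * ε) := by
    intro s hs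
    have us := e.meas_t s
    have hd : ∀ p : X × X, |φ p.1 - φ p.2| ≤ 2 * M := fun p => by
      have h1 := hM p.1; have h2 := hM p.2
      rw [abs_le] at h1 h2 ⊢; constructor <;> linarith [h1.1, h1.2, h2.1, h2.2]
    have hdm : Measurable fun p : X × X => φ p.1 - φ p.2 :=
      (hφ.comp measurable_fst).sub (hφ.comp measurable_snd)
    have i1 : Integrable (fun p : X × X => k p.1 p.2 *
        ((u p.1 s ^ m - u p.2 s ^ m) * (φ p.1 - φ p.2))) (ν.prod ν) := by
      refine h.integrable_prod_mul (M := B ^ m * (2 * M)) ?_ fun p => ?_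
      · exact (((us.comp measurable_fst).pow_const m).sub
          ((us.comp measurable_snd).pow_const m)).mul hdm
      · rw [abs_mul]
        exact mul_le_mul (e.abs_pow_sub_le _ _ _) (hd p) (abs_nonneg _)
          ((abs_nonneg _).trans (e.abs_pow_sub_le p.1 p.2 s))
    have i2 : Integrable (fun p : X × X => k p.1 p.2 *
        ((u p.1 s ^ m - u p.2 s ^ m) * (u p.1 s ^ (m-1) - u p.2 s ^ (m-1)))) (ν.prod ν) := by
      refine h.integrable_prod_mul (M := B ^ m * B ^ (m - 1)) ?_ fun p => ?_
      · exact (((us.comp measurable_fst).pow_const m).sub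
          ((us.comp measurable_snd).pow_const m)).mul (((us.comp measurable_fst).pow_const
            (m - 1)).sub ((us.comp measurable_snd).pow_const (m - 1)))
      · rw [abs_mul]
        refine mul_le_mul (e.abs_pow_sub_le _ _ _) ?_ (abs_nonneg _)
          ((abs_nonneg _).trans (e.abs_pow_sub_le p.1 p.2 s))
        exact abs_sub_le_of_nonneg_of_le (Real.rpow_nonneg (e.nonneg _ _) _)
          (Real.rpow_le_rpow (e.nonneg _ _) (e.le _ _) hm1.le) (Real.rpow_nonneg (e.nonneg _ _) _)
          (Real.rpow_le_rpow (e.nonneg _ _) (e.le _ _) hm1.le)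
    set F : X × X → ℝ := fun p => k p.1 p.2 * (u p.1 s * (φ p.1 - φ p.2) ^ 2) with hF
    have i3 : Integrable F (ν.prod ν) := by
      refine h.integrable_prod_mul (M := B * (2 * M) ^ 2) ?_ fun p => ?_
      · exact (us.comp measurable_fst).mul (hdm.pow_const 2)
      · rw [abs_mul, abs_of_nonneg (e.nonneg _ _), abs_pow]
        have := hd p
        have hB : 0 ≤ B := (e.nonneg p.1 s).trans (e.le p.1 s)
        gcongr
        exact e.le _ _
    have i34 : Integrable (fun p => F p + F p.swap) (ν.prod ν) := i3.add i3.swap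
    have e3 : ∫ p, F p ∂(ν.prod ν) ≤ G * ∫ x, u₀ x ∂ν := by
      rw [integral_prod _ i3, ← e.integral_eq h hi hs, ← integral_const_mul]
      refine integral_mono_ae i3.integral_prod_left ((e.integrable h hi s).const_mul _) ?_
      filter_upwards [hG] with x hx
      have : ∫ y, F (x, y) ∂ν = u x s * ∫ y, k x y * (φ x - φ y) ^ 2 ∂ν := by
        rw [← integral_const_mul]
        refine integral_congr_ae (Eventually.of_forall fun y => ?_)
        simp only [hF]; ring
      rw [this, mul_comm G]
      exact mul_le_mul_of_nonneg_left hx (e.nonneg _ _)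
    have e4 : ∫ p, F p.swap ∂(ν.prod ν) = ∫ p, F p ∂(ν.prod ν) := integral_prod_swap F
    have i4 : Integrable (fun p : X × X => F p.swap) (ν.prod ν) := i3.swap
    calc |dform ν k (fun x => u x s ^ m) φ|
        ≤ 2⁻¹ * ∫ p : X × X, |k p.1 p.2 *
            ((u p.1 s ^ m - u p.2 s ^ m) * (φ p.1 - φ p.2))| ∂(ν.prod ν) := by
          rw [dform, abs_mul, abs_of_pos (by norm_num : (0:ℝ) < 2⁻¹)]
          gcongr
          exact abs_integral_le_integral_abs
      _ ≤ 2⁻¹ * ∫ p : X × X, (ε * (m / (m - 1)) / 2 * (k p.1 p.2 *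
            ((u p.1 s ^ m - u p.2 s ^ m) * (u p.1 s ^ (m-1) - u p.2 s ^ (m-1))))
            + (1 / (2 * ε)) * (F p + F p.swap)) ∂(ν.prod ν) := by
          refine mul_le_mul_of_nonneg_left ?_ (by norm_num)
          refine integral_mono i1.abs ((i2.const_mul _).add ((i3.add i4).const_mul _))
            fun p => ?_
          simp only [hF, Prod.fst_swap, Prod.snd_swap]
          rw [abs_mul, abs_of_nonneg (h.nonneg _ _), h.symm p.2 p.1]
          have hP : 0 ≤ m / (m - 1) * ((u p.1 s ^ m - u p.2 s ^ m) *
              (u p.1 s ^ (m-1) - u p.2 s ^ (m-1))) :=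
            mul_nonneg (by positivity) (rpow_sub_mul_nonneg (e.nonneg _ _) (e.nonneg _ _)
              (by linarith) hm1.le)
          have := mul_le_mul_of_nonneg_left (abs_mul_le_of_sq_le (y := φ p.1 - φ p.2) hP
            (add_nonneg (e.nonneg p.1 s) (e.nonneg p.2 s)) hε
            (rpow_sub_sq_le hm (e.nonneg p.1 s) (e.nonneg p.2 s))) (h.nonneg p.1 p.2)
          refine this.trans (le_of_eq ?_)
          field_simp
          ring
      _ = ε * (m / (m - 1)) / 2 * D s + (∫ p, F p ∂(ν.prod ν)) / (2 * ε) := by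
          rw [integral_add (i2.const_mul _) (i34.const_mul _), integral_const_mul,
            integral_const_mul, integral_add i3 i4, e4]
          simp only [hD, dform]
          ring
      _ ≤ _ := by gcongr
  rw [h3, abs_neg]
  calc |∫ s in Ioc 0 t, dform ν k (fun x => u x s ^ m) φ|
      ≤ ∫ s in Ioc 0 t, |dform ν k (fun x => u x s ^ m) φ| := abs_integral_le_integral_abs
    _ ≤ ∫ s in Ioc 0 t, (ε * (m / (m - 1)) / 2 * D s + G * (∫ x, u₀ x ∂ν) / (2 * ε)) := by
        refine setIntegral_mono_on h2.abs ((hDint.const_mul _).add (by simp)) measurableSet_Ioc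
          fun s hs => key s hs.1.le
    _ = ε * (m / (m - 1)) / 2 * (∫ s in Ioc 0 t, D s) + t * (G * (∫ x, u₀ x ∂ν) / (2 * ε)) := by
        rw [integral_add (hDint.const_mul _) (by simp), integral_const_mul]
        simp [ht]
    _ ≤ ε * (m / (m - 1)) / 2 * (B ^ (m - 1) / (m - 1 + 1) * ∫ x, u₀ x ∂ν) +
          t * (G * (∫ x, u₀ x ∂ν) / (2 * ε)) := by
        have := e.dissipation_le h hi ht hm1.le
        gcongr
    _ = _ := by
        rw [sub_add_cancel]
        field_simp

end Estimates

/-! ### Iterated weak limits along an ultrafilter -/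

section Hilbert

variable {H H₁ H₂ : Type*} [NormedAddCommGroup H] [InnerProductSpace ℝ H] [CompleteSpace H]
  [NormedAddCommGroup H₁] [InnerProductSpace ℝ H₁] [CompleteSpace H₁]
  [NormedAddCommGroup H₂] [InnerProductSpace ℝ H₂] [CompleteSpace H₂]

lemma exists_weak_ultralimit {ι : Type*} (U : Ultrafilter ι) {a : ι → H} {C : ℝ}
    (ha : ∀ n, ‖a n‖ ≤ C) : ∃ l : H, ∀ b : H, Tendsto (fun n => inner ℝ (a n) b) U
      (𝓝 (inner ℝ l b)) := by
  set f : ι → WeakDual ℝ H := fun n => StrongDual.toWeakDual (InnerProductSpace.toDual ℝ H (a n))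
    with hf
  have hK := WeakDual.isCompact_closedBall (𝕜 := ℝ) (E := H) 0 C
  obtain ⟨x, -, hx⟩ := hK.ultrafilter_le_nhds (U.map f) (by
    rw [Ultrafilter.coe_map, le_principal_iff, mem_map]
    refine univ_mem' fun n => ?_
    simp [hf, ha n])
  refine ⟨(InnerProductSpace.toDual ℝ H).symm (WeakDual.toStrongDual x), fun b => ?_⟩
  have h1 := ((WeakDual.eval_continuous (𝕜 := ℝ) (E := H) b).tendsto x).comp
    (show Tendsto f U (𝓝 x) from hx)
  rw [InnerProductSpace.toDual_symm_apply]
  exact h1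

lemma exists_ultralimit_of_bounded {ι : Type*} (U : Ultrafilter ι) {a : ι → ℝ} {C : ℝ}
    (ha : ∀ n, |a n| ≤ C) : ∃ l : ℝ, Tendsto a U (𝓝 l) := by
  obtain ⟨x, -, hx⟩ := (isCompact_Icc (a := -C) (b := C)).ultrafilter_le_nhds (U.map a) (by
    rw [Ultrafilter.coe_map, le_principal_iff, mem_map]
    exact univ_mem' fun n => abs_le.1 (ha n))
  exact ⟨x, hx⟩

/-- A Minty-type double limit argument. -/
lemma eventually_eventually_neg_inner_lt (U : Ultrafilter ℕ) (hU : (U : Filter ℕ) ≤ atTop)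
    {p w : ℕ → H₁} {Ξ ξ : ℕ → H₂} {C : ℝ}
    (hp : ∀ n, ‖p n‖ ≤ C) (hw : ∀ n, ‖w n‖ ≤ C) (hΞ : ∀ n, ‖Ξ n‖ ≤ C) (hξ : ∀ n, ‖ξ n‖ ≤ C)
    (ha : ∀ n j, n ≤ j → inner ℝ (p n) (w j) = 2⁻¹ * inner ℝ (Ξ n) (ξ j))
    (hM : ∀ n j, 0 ≤ inner ℝ (Ξ n - Ξ j) (ξ n - ξ j)) {ε : ℝ} (hε : 0 < ε) :
    ∀ᶠ n in (U : Filter ℕ), ∀ᶠ j in (U : Filter ℕ),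
      -inner ℝ (p n - p j) (w n - w j) < ε := by
  obtain ⟨p', hp'⟩ := exists_weak_ultralimit U hp
  obtain ⟨w', hw'⟩ := exists_weak_ultralimit U hw
  obtain ⟨Ξ', hΞ'⟩ := exists_weak_ultralimit U hΞ
  obtain ⟨ξ', hξ'⟩ := exists_weak_ultralimit U hξ
  have hw'' : ∀ b, Tendsto (fun n => inner ℝ b (w n)) U (𝓝 (inner ℝ b w')) := fun b => by
    simpa only [real_inner_comm] using hw' b
  have hξ'' : ∀ b, Tendsto (fun n => inner ℝ b (ξ n)) U (𝓝 (inner ℝ b ξ')) := fun b => by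
    simpa only [real_inner_comm] using hξ' b
  have hC : 0 ≤ C := (norm_nonneg _).trans (hp 0)
  obtain ⟨A, hA⟩ := exists_ultralimit_of_bounded U (a := fun n => inner ℝ (p n) (w n))
    (C := C * C) fun n => (abs_real_inner_le_norm _ _).trans
      (mul_le_mul (hp n) (hw n) (norm_nonneg _) hC)
  have e1 : ∀ n, inner ℝ (p n) w' = 2⁻¹ * inner ℝ (Ξ n) ξ' := fun n => by
    refine tendsto_nhds_unique (hw'' (p n)) (((hξ'' (Ξ n)).const_mul 2⁻¹).congr' ?_)
    filter_upwards [hU (eventually_ge_atTop n)] with j hj using (ha n j hj).symm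
  have e2 : inner ℝ p' w' = 2⁻¹ * inner ℝ Ξ' ξ' :=
    tendsto_nhds_unique (hp' w') (((hΞ' ξ').const_mul 2⁻¹).congr fun n => (e1 n).symm)
  have hAΞ : Tendsto (fun n => inner ℝ (Ξ n) (ξ n)) U (𝓝 (2 * A)) := by
    refine (hA.const_mul 2).congr fun n => ?_
    rw [ha n n le_rfl]; ring
  have f1 : ∀ n, Tendsto (fun j => -inner ℝ (p n - p j) (w n - w j)) U
      (𝓝 (-(inner ℝ (p n) (w n) - inner ℝ (p n) w' - (inner ℝ p' (w n) - A)))) := fun n => by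
    have := (((tendsto_const_nhds (x := inner ℝ (p n) (w n))).sub (hw'' (p n))).sub
      ((hp' (w n)).sub hA)).neg
    refine this.congr fun j => ?_
    simp only [inner_sub_left, inner_sub_right]; ring
  have f2 : Tendsto (fun n => -(inner ℝ (p n) (w n) - inner ℝ (p n) w' -
      (inner ℝ p' (w n) - A))) U (𝓝 (-(A - inner ℝ p' w' - (inner ℝ p' w' - A)))) :=
    ((hA.sub (hp' w')).sub ((hw'' p').sub tendsto_const_nhds)).neg
  have g1 : ∀ n, Tendsto (fun j => inner ℝ (Ξ n - Ξ j) (ξ n - ξ j)) U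
      (𝓝 (inner ℝ (Ξ n) (ξ n) - inner ℝ (Ξ n) ξ' - (inner ℝ Ξ' (ξ n) - 2 * A))) := fun n => by
    have := (((tendsto_const_nhds (x := inner ℝ (Ξ n) (ξ n))).sub (hξ'' (Ξ n))).sub
      ((hΞ' (ξ n)).sub hAΞ))
    refine this.congr fun j => ?_
    simp only [inner_sub_left, inner_sub_right]; ring
  have g2 : Tendsto (fun n => inner ℝ (Ξ n) (ξ n) - inner ℝ (Ξ n) ξ' -
      (inner ℝ Ξ' (ξ n) - 2 * A)) U
      (𝓝 (2 * A - inner ℝ Ξ' ξ' - (inner ℝ Ξ' ξ' - 2 * A))) :=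
    ((hAΞ.sub (hΞ' ξ')).sub ((hξ'' Ξ').sub tendsto_const_nhds))
  have g3 := ge_of_tendsto' g2 fun n => ge_of_tendsto' (g1 n) fun j => hM n j
  have f3 : -(A - inner ℝ p' w' - (inner ℝ p' w' - A)) < ε := by rw [e2]; linarith
  filter_upwards [f2.eventually (gt_mem_nhds f3)] with n hn
  exact (f1 n).eventually (gt_mem_nhds hn)

end Hilbert

lemma inner_toLp {Y : Type*} [MeasurableSpace Y] {μ : Measure Y} {f g : Y → ℝ}
    (hf : MemLp f 2 μ) (hg : MemLp g 2 μ) :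
    inner ℝ (hf.toLp f) (hg.toLp g) = ∫ y, f y * g y ∂μ := by
  rw [L2.inner_def]
  refine integral_congr_ae ?_
  filter_upwards [hf.coeFn_toLp, hg.coeFn_toLp] with y h1 h2
  rw [h1, h2]; simp [mul_comm]

lemma norm_toLp_le {Y : Type*} [MeasurableSpace Y] {μ : Measure Y} {f : Y → ℝ}
    (hf : MemLp f 2 μ) {C : ℝ} (h : ∫ y, f y ^ 2 ∂μ ≤ C) :
    ‖hf.toLp f‖ ≤ √C := by
  refine Real.le_sqrt_of_sq_le ?_
  rw [← real_inner_self_eq_norm_sq, inner_toLp hf hf]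
  simpa only [sq] using h

/-- The double limit argument for functions. -/
lemma eventually_eventually_neg_integral_lt {Y Z : Type*} [MeasurableSpace Y] [MeasurableSpace Z]
    {μ : Measure Y} {η : Measure Z} (U : Ultrafilter ℕ) (hU : (U : Filter ℕ) ≤ atTop)
    {p w : ℕ → Y → ℝ} {Ξ ξ : ℕ → Z → ℝ} {C : ℝ}
    (hp : ∀ n, MemLp (p n) 2 μ ∧ ∫ y, p n y ^ 2 ∂μ ≤ C)
    (hw : ∀ n, MemLp (w n) 2 μ ∧ ∫ y, w n y ^ 2 ∂μ ≤ C)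
    (hΞ : ∀ n, MemLp (Ξ n) 2 η ∧ ∫ y, Ξ n y ^ 2 ∂η ≤ C)
    (hξ : ∀ n, MemLp (ξ n) 2 η ∧ ∫ y, ξ n y ^ 2 ∂η ≤ C)
    (ha : ∀ n j, n ≤ j → ∫ y, p n y * w j y ∂μ = 2⁻¹ * ∫ z, Ξ n z * ξ j z ∂η)
    (hM : ∀ n j, 0 ≤ ∫ z, (Ξ n z - Ξ j z) * (ξ n z - ξ j z) ∂η) {ε : ℝ} (hε : 0 < ε) :
    ∀ᶠ n in (U : Filter ℕ), ∀ᶠ j in (U : Filter ℕ),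
      -∫ y, (p n y - p j y) * (w n y - w j y) ∂μ < ε := by
  have := eventually_eventually_neg_inner_lt U hU
    (p := fun n => (hp n).1.toLp (p n)) (w := fun n => (hw n).1.toLp (w n))
    (Ξ := fun n => (hΞ n).1.toLp (Ξ n)) (ξ := fun n => (hξ n).1.toLp (ξ n)) (C := √C)
    (fun n => norm_toLp_le _ (hp n).2) (fun n => norm_toLp_le _ (hw n).2)
    (fun n => norm_toLp_le _ (hΞ n).2) (fun n => norm_toLp_le _ (hξ n).2)
    (fun n j h => by rw [inner_toLp, inner_toLp]; exact ha n j h)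
    (fun n j => by
      rw [← MemLp.toLp_sub, ← MemLp.toLp_sub, inner_toLp]; exact hM n j) hε
  filter_upwards [this] with n hn
  filter_upwards [hn] with j hj
  rw [← MemLp.toLp_sub, ← MemLp.toLp_sub, inner_toLp] at hj
  exact hj

/-- Diagonal extraction from an iterated eventual statement. -/
lemma exists_strictMono_of_eventually_eventually (U : Ultrafilter ℕ)
    (hU : (U : Filter ℕ) ≤ atTop) {P : ℕ → ℕ → ℕ → Prop}
    (hP : ∀ i, ∀ᶠ n in (U : Filter ℕ), ∀ᶠ j in (U : Filter ℕ), P i n j)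
    (hanti : ∀ i i' n j, i ≤ i' → P i' n j → P i n j) :
    ∃ φ : ℕ → ℕ, StrictMono φ ∧ ∀ i j, i < j → P i (φ i) (φ j) := by
  obtain ⟨f, hf1, hf2⟩ := exists_seq_of_forall_finset_exists
    (P := fun a : ℕ × ℕ => ∀ᶠ j in (U : Filter ℕ), P a.1 a.2 j)
    (r := fun a b : ℕ × ℕ => a.1 < b.1 ∧ a.2 < b.2 ∧ P a.1 a.2 b.2) (by
      intro s hs
      have h1 : ∀ᶠ n in (U : Filter ℕ), ∀ x ∈ s, P x.1 x.2 n :=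
        (Filter.eventually_all_finset s).2 hs
      have h2 : ∀ᶠ n in (U : Filter ℕ), ∀ x ∈ s, x.2 < n :=
        (Filter.eventually_all_finset s).2 fun x _ => hU (eventually_gt_atTop x.2)
      set I := s.sup Prod.fst + 1
      obtain ⟨n, hn1, hn2, hn3⟩ := (h1.and (h2.and (hP I))).exists
      exact ⟨(I, n), hn3, fun x hx =>
        ⟨Nat.lt_succ_of_le (Finset.le_sup (f := Prod.fst) hx), hn2 x hx, hn1 x hx⟩⟩)
  have h1 : StrictMono fun n => (f n).1 := fun a b h => (hf2 a b h).1
  exact ⟨fun n => (f n).2, fun a b h => (hf2 a b h).2.1,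
    fun i j h => hanti i (f i).1 _ _ h1.le_apply (hf2 i j h).2.2⟩

lemma abs_sub_rpow_le {m a b : ℝ} (hm : 1 ≤ m) (ha : 0 ≤ a) (hb : 0 ≤ b) :
    |a - b| ^ (m + 1) ≤ (a - b) * (a ^ m - b ^ m) := by
  wlog hab : b ≤ a generalizing a b
  · have := this hb ha (le_of_not_ge hab)
    rw [abs_sub_comm]
    linarith
  rw [abs_of_nonneg (by linarith), Real.rpow_add_one' (by linarith) (by linarith), mul_comm]
  refine mul_le_mul_of_nonneg_left ?_ (by linarith)
  have := Real.add_rpow_le_rpow_add (sub_nonneg.2 hab) hb hm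
  rw [sub_add_cancel] at this
  linarith

/-! ### Strong compactness of approximate evolutions -/

section Compactness

variable {X : Type*} [MeasurableSpace X] {ν : Measure X}
  {k : X → X → ℝ} {S : Set X} {c m B : ℝ} {u₀ : X → ℝ} {u : X → ℝ → ℝ}

lemma Evol.integrable_uncurry [SFinite ν] (e : Evol ν k m B u₀ u) (h : SymKer ν k S c)
    (hi : Integrable u₀ ν) (τ : Measure ℝ) [IsFiniteMeasure τ] :
    Integrable (Function.uncurry u) (ν.prod τ) := by
  have h1 : Integrable (fun z : X × ℝ => u z.1 z.2 - u₀ z.1) (ν.prod τ) := by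
    refine integrable_of_bounded_of_supp (T := S ×ˢ univ) (M := B)
      (e.meas.sub (e.meas_init.comp measurable_fst)).aestronglyMeasurable
      (h.measS.prod MeasurableSet.univ) ?_ (fun z => e.abs_sub_init_le z.1 z.2) ?_
    · rw [Measure.prod_prod]; exact ENNReal.mul_ne_top h.finS (by simp)
    · intro z hz
      rw [e.eq_init h z.2 fun h1 => hz ⟨h1, mem_univ _⟩, sub_self]
  refine (h1.add (hi.comp_fst τ)).congr (Eventually.of_forall fun z => ?_)
  simp [Function.uncurry]

lemma Evol.integral_uncurry [SFinite ν] (e : Evol ν k m B u₀ u) (h : SymKer ν k S c)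
    (hi : Integrable u₀ ν) {T : ℝ} (hT : 0 ≤ T) :
    ∫ z : X × ℝ, u z.1 z.2 ∂(ν.prod (volume.restrict (Ioc 0 T))) = T * ∫ x, u₀ x ∂ν := by
  refine (integral_prod_symm _ (e.integrable_uncurry h hi _)).trans ?_
  simp only [Function.uncurry]
  rw [setIntegral_congr_fun (g := fun _ => ∫ x, u₀ x ∂ν) measurableSet_Ioc
    fun t ht => e.integral_eq h hi ht.1.le]
  simp [hT]

lemma Evol.memLp_sub [SFinite ν] (e : Evol ν k m B u₀ u) (h : SymKer ν k S c)
    (hi : Integrable u₀ ν) {T : ℝ} (hT : 0 ≤ T) :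
    MemLp (fun z : X × ℝ => u₀ z.1 - u z.1 z.2) 2 (ν.prod (volume.restrict (Ioc 0 T))) ∧
    ∫ z : X × ℝ, (u₀ z.1 - u z.1 z.2) ^ 2 ∂(ν.prod (volume.restrict (Ioc 0 T))) ≤
      2 * B * T * ∫ x, u₀ x ∂ν := by
  have hm : Measurable fun z : X × ℝ => u₀ z.1 - u z.1 z.2 :=
    (e.meas_init.comp measurable_fst).sub e.meas
  have hu : Integrable (fun z : X × ℝ => u z.1 z.2) (ν.prod (volume.restrict (Ioc 0 T))) :=
    e.integrable_uncurry h hi (volume.restrict (Ioc 0 T))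
  have hu0 : Integrable (fun z : X × ℝ => u₀ z.1) (ν.prod (volume.restrict (Ioc 0 T))) :=
    hi.comp_fst _
  have hb : Integrable (fun z : X × ℝ => B * (u₀ z.1 + u z.1 z.2))
    (ν.prod (volume.restrict (Ioc 0 T))) := (hu0.add hu).const_mul B
  have hle : ∀ z : X × ℝ, (u₀ z.1 - u z.1 z.2) ^ 2 ≤ B * (u₀ z.1 + u z.1 z.2) := fun z => by
    have := e.init_nonneg z.1; have := e.nonneg z.1 z.2
    have := e.init_le z.1; have := e.le z.1 z.2
    nlinarith
  have hintg : Integrable (fun z : X × ℝ => (u₀ z.1 - u z.1 z.2) ^ 2)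
      (ν.prod (volume.restrict (Ioc 0 T))) :=
    hb.mono' (hm.pow_const 2).aestronglyMeasurable (Eventually.of_forall fun z => by
      rw [Real.norm_of_nonneg (sq_nonneg _)]; exact hle z)
  refine ⟨(memLp_two_iff_integrable_sq hm.aestronglyMeasurable).2 hintg, ?_⟩
  refine (integral_mono hintg hb hle).trans (le_of_eq ?_)
  rw [integral_const_mul, integral_add hu0 hu]
  rw [e.integral_uncurry h hi hT, integral_fun_fst (f := u₀)]
  simp [hT]; ring

lemma Evol.memLp_pow [SFinite ν] (e : Evol ν k m B u₀ u) (h : SymKer ν k S c)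
    (hi : Integrable u₀ ν) {T : ℝ} (hT : 0 ≤ T) :
    MemLp (fun z : X × ℝ => u z.1 z.2 ^ m) 2 (ν.prod (volume.restrict (Ioc 0 T))) ∧
    ∫ z : X × ℝ, (u z.1 z.2 ^ m) ^ 2 ∂(ν.prod (volume.restrict (Ioc 0 T))) ≤
      B ^ (m * 2 - 1) * (T * ∫ x, u₀ x ∂ν) := by
  have hm : Measurable fun z : X × ℝ => u z.1 z.2 ^ m := e.meas.pow_const m
  have hu : Integrable (fun z : X × ℝ => u z.1 z.2) (ν.prod (volume.restrict (Ioc 0 T))) :=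
    e.integrable_uncurry h hi (volume.restrict (Ioc 0 T))
  have hle : ∀ z : X × ℝ, (u z.1 z.2 ^ m) ^ 2 ≤ B ^ (m * 2 - 1) * u z.1 z.2 := fun z => by
    rw [← Real.rpow_mul_natCast (e.nonneg _ _)]
    exact rpow_le_of_le (e.nonneg _ _) (e.le _ _) (by push_cast; linarith [e.hm])
  have hintg : Integrable (fun z : X × ℝ => (u z.1 z.2 ^ m) ^ 2)
      (ν.prod (volume.restrict (Ioc 0 T))) :=
    (hu.const_mul _).mono' (hm.pow_const 2).aestronglyMeasurable (Eventually.of_forall fun z => by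
      rw [Real.norm_of_nonneg (sq_nonneg _)]; exact hle z)
  refine ⟨(memLp_two_iff_integrable_sq hm.aestronglyMeasurable).2 hintg, ?_⟩
  refine (integral_mono hintg (hu.const_mul _) hle).trans (le_of_eq ?_)
  rw [integral_const_mul]
  rw [e.integral_uncurry h hi hT]

/-- The increment `√k δ(u^m)` on space-space-time. -/
def rootIncr (k : X → X → ℝ) (m : ℝ) (u : X → ℝ → ℝ) (z : (X × X) × ℝ) : ℝ :=
  √(k z.1.1 z.1.2) * (u z.1.1 z.2 ^ m - u z.1.2 z.2 ^ m)

/-- The time primitive of `rootIncr`, stopped at time `T`. -/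
def rootPrim (k : X → X → ℝ) (m T : ℝ) (u : X → ℝ → ℝ) (z : (X × X) × ℝ) : ℝ :=
  ∫ s in Ioc 0 (min z.2 T), rootIncr k m u (z.1, s)

lemma Evol.measurable_rootIncr (e : Evol ν k m B u₀ u) (h : SymKer ν k S c) :
    Measurable (rootIncr k m u) := by
  have h1 : Measurable fun z : (X × X) × ℝ => u z.1.1 z.2 :=
    e.meas.comp (measurable_fst.fst.prodMk measurable_snd)
  have h2 : Measurable fun z : (X × X) × ℝ => u z.1.2 z.2 :=
    e.meas.comp (measurable_fst.snd.prodMk measurable_snd)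
  have h3 : Measurable fun z : (X × X) × ℝ => k z.1.1 z.1.2 := h.meas.comp measurable_fst
  exact h3.sqrt.mul ((h1.pow_const m).sub (h2.pow_const m))

lemma Evol.continuous_rootIncr (e : Evol ν k m B u₀ u) (p : X × X) :
    Continuous fun s => rootIncr k m u (p, s) := by
  have hm0 : 0 ≤ m := by linarith [e.hm]
  have h1 : ∀ x, Continuous fun s => u x s ^ m := fun x =>
    (e.cont x).rpow_const fun _ => Or.inr hm0
  exact ((h1 p.1).sub (h1 p.2)).const_mul (√(k p.1 p.2))

lemma Evol.measurable_rootPrim (e : Evol ν k m B u₀ u) (h : SymKer ν k S c) (T : ℝ) :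
    Measurable (rootPrim k m T u) := by
  have h1 := e.measurable_rootIncr h
  have : ∀ z : (X × X) × ℝ, rootPrim k m T u z =
      ∫ s, ({q : ((X × X) × ℝ) × ℝ | 0 < q.2 ∧ q.2 ≤ min q.1.2 T}.indicator
        (fun q => rootIncr k m u (q.1.1, q.2)) (z, s)) := by
    intro z
    rw [rootPrim, ← integral_indicator measurableSet_Ioc]
    rfl
  rw [show rootPrim k m T u = _ from funext this]
  refine (StronglyMeasurable.integral_prod_right (f := fun (z : (X × X) × ℝ) (s : ℝ) =>
    ({q : ((X × X) × ℝ) × ℝ | 0 < q.2 ∧ q.2 ≤ min q.1.2 T}.indicator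
        (fun q => rootIncr k m u (q.1.1, q.2)) (z, s))) ?_).measurable
  refine Measurable.stronglyMeasurable (Measurable.indicator ?_ ?_)
  · exact h1.comp (measurable_fst.fst.prodMk measurable_snd)
  · exact (measurableSet_lt measurable_const measurable_snd).inter
      (measurableSet_le measurable_snd (measurable_fst.snd.min measurable_const))

lemma SymKer.sqrt_le (h : SymKer ν k S c) (x y : X) : √(k x y) ≤ √|c| :=
  Real.sqrt_le_sqrt ((h.le x y).trans (le_abs_self _))

lemma Evol.abs_rootIncr_le (e : Evol ν k m B u₀ u) (h : SymKer ν k S c) (z : (X × X) × ℝ) :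
    |rootIncr k m u z| ≤ √|c| * B ^ m := by
  rw [rootIncr, abs_mul, abs_of_nonneg (Real.sqrt_nonneg _)]
  exact mul_le_mul (h.sqrt_le _ _) (e.abs_pow_sub_le _ _ _) (abs_nonneg _) (Real.sqrt_nonneg _)

lemma Evol.abs_rootPrim_le (e : Evol ν k m B u₀ u) (h : SymKer ν k S c) {T : ℝ} (hT : 0 ≤ T)
    (z : (X × X) × ℝ) : |rootPrim k m T u z| ≤ √|c| * B ^ m * T := by
  have h0 : 0 ≤ √|c| * B ^ m := (abs_nonneg _).trans (e.abs_rootIncr_le h z)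
  have := norm_setIntegral_le_of_norm_le_const (μ := volume) (s := Ioc 0 (min z.2 T))
    (f := fun s => rootIncr k m u (z.1, s)) (C := √|c| * B ^ m) (by simp)
    (fun s _ => e.abs_rootIncr_le h _)
  refine this.trans (mul_le_mul_of_nonneg_left ?_ h0)
  simp [hT]

lemma SymKer.not_mem (h : SymKer ν k S c) {p : X × X} (hp : p ∉ S ×ˢ S) : k p.1 p.2 = 0 := by
  by_cases h1 : p.1 ∈ S
  · exact h.supp' _ _ fun h2 => hp ⟨h1, h2⟩
  · exact h.supp _ _ h1

lemma integral_Ioc_sq_le {f : ℝ → ℝ} (hf : Continuous f) {t T : ℝ} (ht : 0 < t) (htT : t ≤ T) :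
    (∫ s in Ioc 0 t, f s) ^ 2 ≤ T * ∫ s in Ioc 0 T, f s ^ 2 := by
  set a := ∫ s in Ioc 0 t, f s
  have hi : ∀ {g : ℝ → ℝ}, Continuous g → ∀ r, IntegrableOn g (Ioc 0 r) := fun hg r =>
    hg.integrableOn_Icc.mono_set Ioc_subset_Icc_self
  have h1 : 0 ≤ ∫ s in Ioc 0 t, (t * f s - a) ^ 2 := integral_nonneg fun s => sq_nonneg _
  have h2 : ∫ s in Ioc 0 t, (t * f s - a) ^ 2 =
      ∫ s in Ioc 0 t, (t ^ 2 * f s ^ 2 - 2 * t * a * f s + a ^ 2) :=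
    integral_congr_ae (Eventually.of_forall fun s => by simp only; ring)
  rw [h2, integral_add ((hi (by fun_prop) t)) (by simp),
    integral_sub (hi (by fun_prop) t) (hi (by fun_prop) t), integral_const_mul,
    integral_const_mul] at h1
  simp only [integral_const, MeasurableSet.univ, measureReal_restrict_apply, univ_inter,
    Real.volume_real_Ioc, sub_zero, max_eq_left ht.le, smul_eq_mul] at h1
  have h3 : ∫ s in Ioc 0 t, f s ^ 2 ≤ ∫ s in Ioc 0 T, f s ^ 2 :=
    setIntegral_mono_set (hi (by fun_prop) T) (Eventually.of_forall fun s => sq_nonneg _)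
      (Ioc_subset_Ioc_right htT).eventuallyLE
  have h4 : 0 ≤ ∫ s in Ioc 0 t, f s ^ 2 := integral_nonneg fun s => sq_nonneg _
  have h5 : a ^ 2 * t ≤ t * ∫ s in Ioc 0 t, f s ^ 2 * t := by
    rw [integral_mul_const]; change 0 ≤ _ - 2 * t * a * a + _ at h1; nlinarith
  have h6 : a ^ 2 ≤ t * ∫ s in Ioc 0 t, f s ^ 2 := by
    rw [integral_mul_const] at h5
    have : a ^ 2 * t ≤ (t * ∫ s in Ioc 0 t, f s ^ 2) * t := by linarith
    exact le_of_mul_le_mul_right this ht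
  exact h6.trans (mul_le_mul htT h3 h4 (ht.le.trans htT))

lemma Evol.memLp_rootIncr [SFinite ν] (e : Evol ν k m B u₀ u) (h : SymKer ν k S c)
    (hi : Integrable u₀ ν) {T : ℝ} (hT : 0 ≤ T) :
    MemLp (rootIncr k m u) 2 ((ν.prod ν).prod (volume.restrict (Ioc 0 T))) ∧
    ∫ z, rootIncr k m u z ^ 2 ∂((ν.prod ν).prod (volume.restrict (Ioc 0 T))) ≤
      2 * (B ^ m / (m + 1) * ∫ x, u₀ x ∂ν) := by
  have hmm := e.measurable_rootIncr h
  have hintg : Integrable (fun z => rootIncr k m u z ^ 2)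
      ((ν.prod ν).prod (volume.restrict (Ioc 0 T))) := by
    refine integrable_of_bounded_of_supp (T := (S ×ˢ S) ×ˢ univ) (M := (√|c| * B ^ m) ^ 2)
      (hmm.pow_const 2).aestronglyMeasurable ((h.measS.prod h.measS).prod MeasurableSet.univ)
      ?_ (fun z => ?_) (fun z hz => ?_)
    · rw [Measure.prod_prod, Measure.prod_prod]
      exact ENNReal.mul_ne_top (ENNReal.mul_ne_top h.finS h.finS) (by simp)
    · rw [abs_pow]; gcongr; exact e.abs_rootIncr_le h z
    · simp [rootIncr, h.not_mem fun h1 => hz ⟨h1, mem_univ _⟩]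
  refine ⟨(memLp_two_iff_integrable_sq hmm.aestronglyMeasurable).2 hintg, ?_⟩
  rw [integral_prod_symm _ hintg]
  have h1 : ∀ t, ∫ p, rootIncr k m u (p, t) ^ 2 ∂(ν.prod ν) =
      2 * dform ν k (fun x => u x t ^ m) (fun x => u x t ^ m) := by
    intro t
    rw [dform, ← mul_assoc, mul_inv_cancel₀ two_ne_zero, one_mul]
    refine integral_congr_ae (Eventually.of_forall fun p => ?_)
    simp only [rootIncr]
    rw [mul_pow, Real.sq_sqrt (h.nonneg _ _), sq (_ - _)]
  simp_rw [h1]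
  rw [integral_const_mul]
  exact mul_le_mul_of_nonneg_left (e.dissipation_le h hi hT (by linarith [e.hm])) (by norm_num)

lemma Evol.memLp_rootPrim [SFinite ν] (e : Evol ν k m B u₀ u) (h : SymKer ν k S c)
    (hi : Integrable u₀ ν) {T : ℝ} (hT : 0 ≤ T) :
    MemLp (rootPrim k m T u) 2 ((ν.prod ν).prod (volume.restrict (Ioc 0 T))) ∧
    ∫ z, rootPrim k m T u z ^ 2 ∂((ν.prod ν).prod (volume.restrict (Ioc 0 T))) ≤
      T * T * (2 * (B ^ m / (m + 1) * ∫ x, u₀ x ∂ν)) := by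
  have hmm := e.measurable_rootPrim h T
  have hintg : Integrable (fun z => rootPrim k m T u z ^ 2)
      ((ν.prod ν).prod (volume.restrict (Ioc 0 T))) := by
    refine integrable_of_bounded_of_supp (T := (S ×ˢ S) ×ˢ univ) (M := (√|c| * B ^ m * T) ^ 2)
      (hmm.pow_const 2).aestronglyMeasurable ((h.measS.prod h.measS).prod MeasurableSet.univ)
      ?_ (fun z => ?_) (fun z hz => ?_)
    · rw [Measure.prod_prod, Measure.prod_prod]
      exact ENNReal.mul_ne_top (ENNReal.mul_ne_top h.finS h.finS) (by simp)
    · rw [abs_pow]; gcongr; exact e.abs_rootPrim_le h hT z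
    · simp [rootPrim, rootIncr, h.not_mem fun h1 => hz ⟨h1, mem_univ _⟩]
  refine ⟨(memLp_two_iff_integrable_sq hmm.aestronglyMeasurable).2 hintg, ?_⟩
  obtain ⟨h1, h2⟩ := e.memLp_rootIncr h hi hT
  have h3 := (memLp_two_iff_integrable_sq h1.1).1 h1
  refine le_trans ?_ (mul_le_mul_of_nonneg_left h2 (mul_nonneg hT hT))
  rw [integral_prod _ hintg, integral_prod _ h3, ← integral_const_mul]
  refine integral_mono hintg.integral_prod_left (h3.integral_prod_left.const_mul _) fun p => ?_
  calc ∫ t in Ioc 0 T, rootPrim k m T u (p, t) ^ 2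
      ≤ ∫ t in Ioc 0 T, T * ∫ s in Ioc 0 T, rootIncr k m u (p, s) ^ 2 := by
        refine integral_mono_of_nonneg (Eventually.of_forall fun t => sq_nonneg _)
          (integrable_const _) ?_
        filter_upwards [ae_restrict_mem measurableSet_Ioc] with t ht
        simp only [rootPrim, min_eq_left ht.2]
        exact integral_Ioc_sq_le (e.continuous_rootIncr p) ht.1 ht.2
    _ = T * T * ∫ s in Ioc 0 T, rootIncr k m u (p, s) ^ 2 := by
        simp [hT]; ring

end Compactness

section CompactnessInTime

variable {X : Type*} [MeasurableSpace X] {ν : Measure X}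
  {k k' : X → X → ℝ} {S S' : Set X} {c c' m B : ℝ} {u₀ : X → ℝ} {u u' : X → ℝ → ℝ}

/-- Testing one evolution with the power of another one. -/
lemma Evol.integral_sub_mul_pow [SFinite ν] (e : Evol ν k m B u₀ u) (h : SymKer ν k S c)
    (e' : Evol ν k' m B u₀ u') (h' : SymKer ν k' S' c')
    (hi : Integrable u₀ ν) (hk : ∀ x y, √(k x y) * √(k' x y) = k x y) {T : ℝ} (hT : 0 ≤ T) :
    ∫ z : X × ℝ, (u₀ z.1 - u z.1 z.2) * u' z.1 z.2 ^ m
        ∂(ν.prod (volume.restrict (Ioc 0 T))) =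
      2⁻¹ * ∫ z, rootPrim k m T u z * rootIncr k' m u' z
        ∂((ν.prod ν).prod (volume.restrict (Ioc 0 T))) := by
  have i1 := (e.memLp_sub h hi hT).1.integrable_mul (e'.memLp_pow h' hi hT).1
  have i2 := (e.memLp_rootPrim h hi hT).1.integrable_mul (e'.memLp_rootIncr h' hi hT).1
  refine (integral_prod_symm _ i1).trans ?_
  rw [show (∫ z, rootPrim k m T u z * rootIncr k' m u' z
        ∂((ν.prod ν).prod (volume.restrict (Ioc 0 T)))) = _ from integral_prod_symm _ i2,
    ← integral_const_mul]
  refine setIntegral_congr_fun measurableSet_Ioc fun t ht => ?_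
  have hψ : Measurable fun x => u' x t ^ m := (e'.meas_t t).pow_const m
  have h1 := (e.energy_identity h (G := id) (g := fun _ => 1) (fun r _ => hasDerivAt_id r)
    continuous_const hψ (fun x => by
      rw [abs_of_nonneg (e'.pow_nonneg x t)]; exact e'.pow_le x t) ht.1.le).2.2
  have h2 : ∫ x, (u₀ x - u x t) * u' x t ^ m ∂ν =
      ∫ s in Ioc 0 t, dform ν k (fun x => u x s ^ m) (fun x => u' x t ^ m) := by
    simp only [one_mul, id] at h1
    rw [← neg_eq_iff_eq_neg] at h1
    rw [← h1, ← integral_neg]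
    exact integral_congr_ae (Eventually.of_forall fun x => by simp only; ring)
  simp only [Pi.mul_apply]
  rw [h2]
  simp only [dform]
  rw [integral_const_mul]
  congr 1
  have h3 : ∀ p : X × X, rootPrim k m T u (p, t) * rootIncr k' m u' (p, t) =
      ∫ s in Ioc 0 t, rootIncr k m u (p, s) * rootIncr k' m u' (p, t) := fun p => by
    rw [integral_mul_const, rootPrim]
    simp only [min_eq_left ht.2]
  simp_rw [h3]
  symm
  rw [integral_integral_swap]
  · refine integral_congr_ae (Eventually.of_forall fun s => integral_congr_ae
      (Eventually.of_forall fun p => ?_))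
    simp only [rootIncr]
    linear_combination ((u p.1 s ^ m - u p.2 s ^ m) * (u' p.1 t ^ m - u' p.2 t ^ m)) *
      hk p.1 p.2
  · have hm1 := e.measurable_rootIncr h
    have hm2 := e'.measurable_rootIncr h'
    refine integrable_of_bounded_of_supp (T := (S ×ˢ S) ×ˢ univ)
      (M := (√|c| * B ^ m) * (√|c'| * B ^ m)) ?_
      ((h.measS.prod h.measS).prod MeasurableSet.univ) ?_ (fun z => ?_) (fun z hz => ?_)
    · exact (hm1.mul (hm2.comp (measurable_fst.prodMk measurable_const))).aestronglyMeasurable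
    · rw [Measure.prod_prod, Measure.prod_prod]
      exact ENNReal.mul_ne_top (ENNReal.mul_ne_top h.finS h.finS) (by simp)
    · simp only [Function.uncurry]
      rw [abs_mul]
      exact mul_le_mul (e.abs_rootIncr_le h _) (e'.abs_rootIncr_le h' _) (abs_nonneg _)
        ((abs_nonneg _).trans (e.abs_rootIncr_le h z))
    · simp [Function.uncurry, rootIncr, h.not_mem fun h1 => hz ⟨h1, mem_univ _⟩]

lemma integral_primitive_mul_nonneg {a : ℝ → ℝ} (ha : Continuous a) {T : ℝ} (hT : 0 ≤ T) :
    0 ≤ ∫ t in Ioc 0 T, (∫ s in Ioc 0 (min t T), a s) * a t := by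
  have h1 : ∀ t, HasDerivAt (fun t => ∫ s in (0:ℝ)..t, a s) (a t) t := fun t =>
    intervalIntegral.integral_hasDerivAt_right (ha.intervalIntegrable _ _)
      (ha.stronglyMeasurableAtFilter _ _) ha.continuousAt
  have hc : Continuous fun t => ∫ s in (0:ℝ)..t, a s :=
    continuous_iff_continuousAt.2 fun t => (h1 t).continuousAt
  have h2 : ∫ t in (0:ℝ)..T, (∫ s in (0:ℝ)..t, a s) * a t =
      (∫ s in (0:ℝ)..T, a s) ^ 2 / 2 - (∫ s in (0:ℝ)..0, a s) ^ 2 / 2 :=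
    intervalIntegral.integral_eq_sub_of_hasDerivAt
      (f := fun t => (∫ s in (0:ℝ)..t, a s) ^ 2 / 2)
      (fun t _ => (((h1 t).fun_pow 2).div_const 2).congr_deriv (by push_cast; ring))
      ((hc.mul ha).intervalIntegrable _ _)
  have h3 : ∫ t in Ioc 0 T, (∫ s in Ioc 0 (min t T), a s) * a t =
      ∫ t in (0:ℝ)..T, (∫ s in (0:ℝ)..t, a s) * a t := by
    rw [intervalIntegral.integral_of_le hT]
    refine setIntegral_congr_fun measurableSet_Ioc fun t ht => ?_
    rw [min_eq_left ht.2, intervalIntegral.integral_of_le ht.1.le]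
  rw [h3, h2]
  rw [intervalIntegral.integral_same]
  nlinarith [sq_nonneg (∫ s in (0:ℝ)..T, a s)]

lemma Evol.integral_rootPrim_sub_mul_nonneg [SFinite ν] (e : Evol ν k m B u₀ u)
    (h : SymKer ν k S c) (e' : Evol ν k' m B u₀ u') (h' : SymKer ν k' S' c')
    (hi : Integrable u₀ ν) {T : ℝ} (hT : 0 ≤ T) :
    0 ≤ ∫ z, (rootPrim k m T u z - rootPrim k' m T u' z) *
        (rootIncr k m u z - rootIncr k' m u' z)
        ∂((ν.prod ν).prod (volume.restrict (Ioc 0 T))) := by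
  have i2 := ((e.memLp_rootPrim h hi hT).1.sub (e'.memLp_rootPrim h' hi hT).1).integrable_mul
    ((e.memLp_rootIncr h hi hT).1.sub (e'.memLp_rootIncr h' hi hT).1)
  rw [show (∫ z, (rootPrim k m T u z - rootPrim k' m T u' z) *
        (rootIncr k m u z - rootIncr k' m u' z)
        ∂((ν.prod ν).prod (volume.restrict (Ioc 0 T)))) = _ from integral_prod _ i2]
  refine integral_nonneg fun p => ?_
  have c1 := e.continuous_rootIncr p
  have c2 := e'.continuous_rootIncr p
  refine (integral_primitive_mul_nonneg (c1.sub c2) hT).trans (le_of_eq ?_)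
  refine integral_congr_ae (Eventually.of_forall fun t => ?_)
  simp only [Pi.sub_apply, rootPrim]
  rw [integral_sub]
  · exact c1.integrableOn_Icc.mono_set Ioc_subset_Icc_self
  · exact c2.integrableOn_Icc.mono_set Ioc_subset_Icc_self

end CompactnessInTime

section KerSys

variable {X : Type*} [MeasurableSpace X] {ν : Measure X}

/-- An exhausting family of truncations of a kernel. -/
structure KerSys (ν : Measure X) (k : X → X → ℝ) (K : ℕ → X → X → ℝ) (S : ℕ → Set X)
    (c : ℕ → ℝ) : Prop where
  ker : ∀ n, SymKer ν (K n) (S n) (c n)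
  dich : ∀ n x y, K n x y = 0 ∨ K n x y = k x y
  mono : ∀ n j, n ≤ j → ∀ x y, K n x y ≤ K j x y
  lim : ∀ x y, ∃ n, K n x y = k x y

variable {k : X → X → ℝ} {K : ℕ → X → X → ℝ} {S : ℕ → Set X} {c : ℕ → ℝ} {m B : ℝ}
  {u₀ : X → ℝ} {u : ℕ → X → ℝ → ℝ}

lemma KerSys.sqrt_mul_sqrt (hs : KerSys ν k K S c) {n j : ℕ} (hnj : n ≤ j) (x y : X) :
    √(K n x y) * √(K j x y) = K n x y := by
  rcases hs.dich n x y with h | h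
  · simp [h]
  · rcases hs.dich j x y with h' | h'
    · have h1 := hs.mono n j hnj x y
      have h2 := (hs.ker n).nonneg x y
      have : K n x y = 0 := by linarith
      simp [this]
    · rw [h', ← h, Real.mul_self_sqrt ((hs.ker n).nonneg x y)]

lemma KerSys.eventually_eLpNorm_lt [SFinite ν] (hs : KerSys ν k K S c)
    (hi : Integrable u₀ ν) (he : ∀ n, Evol ν (K n) m B u₀ (u n)) (U : Ultrafilter ℕ)
    (hU : (U : Filter ℕ) ≤ atTop) {T : ℝ} (hT : 0 ≤ T) {δ : ℝ} (hδ : 0 < δ) :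
    ∀ᶠ n in (U : Filter ℕ), ∀ᶠ j in (U : Filter ℕ),
      eLpNorm (fun z : X × ℝ => u n z.1 z.2 - u j z.1 z.2) (ENNReal.ofReal (m + 1))
        (ν.prod (volume.restrict (Ioc 0 T))) < ENNReal.ofReal δ := by
  have hm := (he 0).hm
  set C₁ := 2 * B * T * ∫ x, u₀ x ∂ν
  set C₂ := B ^ (m * 2 - 1) * (T * ∫ x, u₀ x ∂ν)
  set C₃ := T * T * (2 * (B ^ m / (m + 1) * ∫ x, u₀ x ∂ν))
  set C₄ := 2 * (B ^ m / (m + 1) * ∫ x, u₀ x ∂ν)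
  have key := eventually_eventually_neg_integral_lt U hU
    (p := fun n (z : X × ℝ) => u₀ z.1 - u n z.1 z.2) (w := fun n z => u n z.1 z.2 ^ m)
    (Ξ := fun n => rootPrim (K n) m T (u n)) (ξ := fun n => rootIncr (K n) m (u n))
    (μ := ν.prod (volume.restrict (Ioc 0 T)))
    (η := (ν.prod ν).prod (volume.restrict (Ioc 0 T)))
    (C := max (max C₁ C₂) (max C₃ C₄))
    (fun n => ((he n).memLp_sub (hs.ker n) hi hT).imp_right fun h => h.trans (by simp [C₁]))
    (fun n => ((he n).memLp_pow (hs.ker n) hi hT).imp_right fun h => h.trans (by simp [C₂]))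
    (fun n => ((he n).memLp_rootPrim (hs.ker n) hi hT).imp_right fun h => h.trans (by simp [C₃]))
    (fun n => ((he n).memLp_rootIncr (hs.ker n) hi hT).imp_right fun h => h.trans (by simp [C₄]))
    (fun n j hnj => (he n).integral_sub_mul_pow (hs.ker n) (he j) (hs.ker j) hi
      (hs.sqrt_mul_sqrt hnj) hT)
    (fun n j => (he n).integral_rootPrim_sub_mul_nonneg (hs.ker n) (he j) (hs.ker j) hi hT)
    (ε := δ ^ (m + 1)) (by positivity)
  filter_upwards [key] with n hn
  filter_upwards [hn] with j hj
  have i2 := (((he j).memLp_sub (hs.ker j) hi hT).1.sub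
    ((he n).memLp_sub (hs.ker n) hi hT).1).integrable_mul
    (((he n).memLp_pow (hs.ker n) hi hT).1.sub ((he j).memLp_pow (hs.ker j) hi hT).1)
  have i3 : Integrable (fun z : X × ℝ => (u n z.1 z.2 - u j z.1 z.2) *
      (u n z.1 z.2 ^ m - u j z.1 z.2 ^ m)) (ν.prod (volume.restrict (Ioc 0 T))) :=
    i2.congr (Eventually.of_forall fun z => by simp)
  have hmeas : Measurable fun z : X × ℝ => u n z.1 z.2 - u j z.1 z.2 :=
    (he n).meas.sub (he j).meas
  have hle : ∀ z : X × ℝ, |u n z.1 z.2 - u j z.1 z.2| ^ (m + 1) ≤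
      (u n z.1 z.2 - u j z.1 z.2) * (u n z.1 z.2 ^ m - u j z.1 z.2 ^ m) := fun z =>
    abs_sub_rpow_le hm.le ((he n).nonneg _ _) ((he j).nonneg _ _)
  have i4 : Integrable (fun z : X × ℝ => |u n z.1 z.2 - u j z.1 z.2| ^ (m + 1))
      (ν.prod (volume.restrict (Ioc 0 T))) :=
    i3.mono' (hmeas.abs.pow_const _).aestronglyMeasurable (Eventually.of_forall fun z => by
      rw [Real.norm_of_nonneg (by positivity)]; exact hle z)
  have hp0 : ENNReal.ofReal (m + 1) ≠ 0 := by simp; linarith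
  have hpr : (ENNReal.ofReal (m + 1)).toReal = m + 1 := ENNReal.toReal_ofReal (by linarith)
  have hmem : MemLp (fun z : X × ℝ => u n z.1 z.2 - u j z.1 z.2) (ENNReal.ofReal (m + 1))
      (ν.prod (volume.restrict (Ioc 0 T))) := by
    rw [← integrable_norm_rpow_iff hmeas.aestronglyMeasurable hp0 ENNReal.ofReal_ne_top, hpr]
    exact i4
  rw [hmem.eLpNorm_eq_integral_rpow_norm hp0 ENNReal.ofReal_ne_top, hpr]
  refine (ENNReal.ofReal_lt_ofReal_iff hδ).2 ?_
  have h1 : ∫ z : X × ℝ, |u n z.1 z.2 - u j z.1 z.2| ^ (m + 1)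
      ∂(ν.prod (volume.restrict (Ioc 0 T))) < δ ^ (m + 1) := by
    refine (integral_mono i4 i3 hle).trans_lt (lt_of_eq_of_lt ?_ hj)
    rw [← integral_neg]
    exact integral_congr_ae (Eventually.of_forall fun z => by simp only; ring)
  have h0 : 0 ≤ ∫ z : X × ℝ, |u n z.1 z.2 - u j z.1 z.2| ^ (m + 1)
      ∂(ν.prod (volume.restrict (Ioc 0 T))) := integral_nonneg fun z => by positivity
  calc _ < (δ ^ (m + 1)) ^ (m + 1)⁻¹ := Real.rpow_lt_rpow h0 h1 (by positivity)
    _ = δ := Real.rpow_rpow_inv hδ.le (by linarith)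

theorem KerSys.exists_limit [SFinite ν] (hs : KerSys ν k K S c)
    (hi : Integrable u₀ ν) (he : ∀ n, Evol ν (K n) m B u₀ (u n)) (hB : 0 ≤ B) :
    ∃ (φ : ℕ → ℕ) (v : X → ℝ → ℝ), StrictMono φ ∧ Measurable (Function.uncurry v) ∧
      (∀ x t, 0 ≤ v x t ∧ v x t ≤ B) ∧
      ∀ᵐ t ∂(volume.restrict (Ioi (0:ℝ))), ∀ᵐ x ∂ν,
        Tendsto (fun j => u (φ j) x t) atTop (𝓝 (v x t)) := by
  have hm := (he 0).hm
  set μ : ℕ → Measure (X × ℝ) := fun i => ν.prod (volume.restrict (Ioc 0 (i:ℝ)))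
  have hμ : Monotone μ := fun i j hij =>
    Measure.prod_mono le_rfl (Measure.restrict_mono
      (Ioc_subset_Ioc_right (by exact_mod_cast hij)) le_rfl)
  obtain ⟨φ, hφ, hφP⟩ := exists_strictMono_of_eventually_eventually (hyperfilter ℕ)
    Nat.hyperfilter_le_atTop
    (P := fun i n j => eLpNorm (fun z : X × ℝ => u n z.1 z.2 - u j z.1 z.2)
      (ENNReal.ofReal (m + 1)) (μ i) < ENNReal.ofReal ((1 / 2) ^ i))
    (fun i => hs.eventually_eLpNorm_lt hi he _ Nat.hyperfilter_le_atTop (Nat.cast_nonneg i)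
      (by positivity))
    (fun i i' n j hii h => (eLpNorm_mono_measure _ (hμ hii)).trans_lt (h.trans_le
      (ENNReal.ofReal_le_ofReal (pow_le_pow_of_le_one (by norm_num) (by norm_num) hii))))
  have hconv : ∀ T : ℕ, ∀ᵐ z ∂(μ T), ∃ l : ℝ,
      Tendsto (fun j => u (φ j) z.1 z.2) atTop (𝓝 l) := by
    intro T
    have := Lp.ae_tendsto_of_cauchy_eLpNorm (μ := μ T) (p := ENNReal.ofReal (m + 1))
      (f := fun j z => u (φ (j + T)) z.1 z.2) (B := fun i => ENNReal.ofReal ((1 / 2) ^ i))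
      (fun j => (he _).meas.aestronglyMeasurable) (by simp; linarith) ?_ ?_
    · filter_upwards [this] with z ⟨l, hl⟩
      exact ⟨l, (tendsto_add_atTop_iff_nat T).1 hl⟩
    · rw [← ENNReal.ofReal_tsum_of_nonneg (fun i => by positivity) summable_geometric_two]
      exact ENNReal.ofReal_ne_top
    · have hlt : ∀ N n j, N ≤ n → n < j → eLpNorm ((fun z : X × ℝ => u (φ (n + T)) z.1 z.2) -
          fun z => u (φ (j + T)) z.1 z.2) (ENNReal.ofReal (m + 1)) (μ T) <
          ENNReal.ofReal ((1 / 2) ^ N) := fun N n j hNn hnj =>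
        (eLpNorm_mono_measure _ (hμ (Nat.le_add_left T n))).trans_lt
          ((hφP (n + T) (j + T) (by omega)).trans_le (ENNReal.ofReal_le_ofReal
            (pow_le_pow_of_le_one (by norm_num) (by norm_num) (by omega))))
      intro N n j hn hj
      rcases lt_trichotomy n j with h | h | h
      · exact hlt N n j hn h
      · subst h; simp
      · rw [eLpNorm_sub_comm]; exact hlt N j n hj h
  refine ⟨φ, fun x t => max 0 (min B (limsup (fun j => u (φ j) x t) atTop)), hφ, ?_, ?_, ?_⟩
  · exact measurable_const.max (measurable_const.min
      (Measurable.limsup fun j => (he (φ j)).meas))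
  · exact fun x t => ⟨le_max_left _ _, max_le hB (min_le_left _ _)⟩
  have hlim : ∀ x t, (∃ l : ℝ, Tendsto (fun j => u (φ j) x t) atTop (𝓝 l)) →
      Tendsto (fun j => u (φ j) x t) atTop
        (𝓝 (max 0 (min B (limsup (fun j => u (φ j) x t) atTop)))) := by
    rintro x t ⟨l, hl⟩
    have h1 : 0 ≤ l := ge_of_tendsto' hl fun j => (he _).nonneg x t
    have h2 : l ≤ B := le_of_tendsto' hl fun j => (he _).le x t
    rw [hl.limsup_eq, min_eq_right h2, max_eq_right h1]
    exact hl
  have h3 : ∀ T : ℕ, ∀ᵐ t ∂(volume.restrict (Ioc 0 (T:ℝ))), ∀ᵐ x ∂ν,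
      ∃ l : ℝ, Tendsto (fun j => u (φ j) x t) atTop (𝓝 l) := by
    intro T
    refine Measure.ae_ae_of_ae_prod (p := fun z : ℝ × X =>
      ∃ l : ℝ, Tendsto (fun j => u (φ j) z.2 z.1) atTop (𝓝 l)) ?_
    exact Measure.measurePreserving_swap.quasiMeasurePreserving.ae (hconv T)
  have h4 : Ioi (0:ℝ) = ⋃ T : ℕ, Ioc 0 (T:ℝ) := by
    ext t
    simp only [mem_Ioi, mem_iUnion, mem_Ioc, exists_and_left]
    exact ⟨fun h => ⟨h, exists_nat_ge t⟩, fun h => h.1⟩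
  rw [h4, ae_restrict_iUnion_iff]
  intro T
  filter_upwards [h3 T] with t ht
  filter_upwards [ht] with x hx
  exact hlim x t hx

end KerSys

/-! ### Convergence lemmas -/

section Convergence

variable {Y : Type*} [MeasurableSpace Y] {μ : Measure Y}

/-- Scheffé's lemma for nonnegative functions. -/
lemma tendsto_integral_abs_sub {h : ℕ → Y → ℝ} {H : Y → ℝ}
    (hh : ∀ n, Integrable (h n) μ) (hH : Integrable H μ) (h0 : ∀ n y, 0 ≤ h n y)
    (hl : ∀ᵐ y ∂μ, Tendsto (fun n => h n y) atTop (𝓝 (H y)))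
    (hi : Tendsto (fun n => ∫ y, h n y ∂μ) atTop (𝓝 (∫ y, H y ∂μ))) :
    Tendsto (fun n => ∫ y, |h n y - H y| ∂μ) atTop (𝓝 0) := by
  have h1 : Tendsto (fun n => ∫ y, max (H y - h n y) 0 ∂μ) atTop (𝓝 (∫ _, (0:ℝ) ∂μ)) := by
    refine tendsto_integral_of_dominated_convergence (fun y => |H y|)
      (fun n => ((hH.sub (hh n)).pos_part).aestronglyMeasurable) hH.abs
      (fun n => Eventually.of_forall fun y => ?_) ?_
    · rw [Real.norm_of_nonneg (le_max_right _ _)]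
      exact max_le ((sub_le_self _ (h0 n y)).trans (le_abs_self _)) (abs_nonneg _)
    · filter_upwards [hl] with y hy
      have : Tendsto (fun n => max (H y - h n y) 0) atTop (𝓝 (max (H y - H y) 0)) :=
        (tendsto_const_nhds.sub hy).max tendsto_const_nhds
      simpa using this
  have h2 : ∀ n, ∫ y, |h n y - H y| ∂μ =
      (∫ y, h n y ∂μ) - (∫ y, H y ∂μ) + 2 * ∫ y, max (H y - h n y) 0 ∂μ := by
    intro n
    have i1 : Integrable (fun y => h n y - H y) μ := (hh n).sub hH
    have i2 : Integrable (fun y => 2 * max (H y - h n y) 0) μ :=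
      ((hH.sub (hh n)).pos_part).const_mul 2
    rw [← integral_sub (hh n) hH, ← integral_const_mul, ← integral_add i1 i2]
    refine integral_congr_ae (Eventually.of_forall fun y => ?_)
    show |h n y - H y| = h n y - H y + 2 * max (H y - h n y) 0
    rcases le_total (h n y) (H y) with h | h
    · rw [abs_of_nonpos (by linarith), max_eq_left (by linarith)]; ring
    · rw [abs_of_nonneg (by linarith), max_eq_right (by linarith)]; ring
  simp_rw [h2]
  have := (hi.sub_const (∫ y, H y ∂μ)).add (h1.const_mul 2)
  simpa using this

/-- Dominated convergence with a convergent sequence of bounds. -/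
lemma tendsto_integral_of_le_of_tendsto {f h : ℕ → Y → ℝ} {F H : Y → ℝ}
    (hf : ∀ n, AEStronglyMeasurable (f n) μ)
    (hh : ∀ n, Integrable (h n) μ) (hH : Integrable H μ) (f0 : ∀ n y, 0 ≤ f n y)
    (hfh : ∀ n y, f n y ≤ h n y)
    (hlf : ∀ᵐ y ∂μ, Tendsto (fun n => f n y) atTop (𝓝 (F y)))
    (hl : ∀ᵐ y ∂μ, Tendsto (fun n => h n y) atTop (𝓝 (H y)))
    (hi : Tendsto (fun n => ∫ y, h n y ∂μ) atTop (𝓝 (∫ y, H y ∂μ))) :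
    Tendsto (fun n => ∫ y, f n y ∂μ) atTop (𝓝 (∫ y, F y ∂μ)) := by
  have hfi : ∀ n, Integrable (f n) μ := fun n => (hh n).mono' (hf n)
    (Eventually.of_forall fun y => by rw [Real.norm_of_nonneg (f0 n y)]; exact hfh n y)
  have h1 := tendsto_integral_abs_sub hh hH (fun n y => (f0 n y).trans (hfh n y)) hl hi
  have h2 : Tendsto (fun n => ∫ y, min (f n y) |H y| ∂μ) atTop (𝓝 (∫ y, F y ∂μ)) := by
    refine tendsto_integral_of_dominated_convergence (fun y => |H y|)
      (fun n => ((hfi n).inf hH.abs).aestronglyMeasurable) hH.abs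
      (fun n => Eventually.of_forall fun y => ?_) ?_
    · rw [Real.norm_of_nonneg (le_min (f0 n y) (abs_nonneg _))]
      exact min_le_right _ _
    · filter_upwards [hlf, hl] with y hy1 hy2
      have h3 : F y ≤ H y := le_of_tendsto_of_tendsto' hy1 hy2 fun n => hfh n y
      have := hy1.min (tendsto_const_nhds (x := |H y|))
      rwa [min_eq_left (h3.trans (le_abs_self _))] at this
  have h3 : Tendsto (fun n => ∫ y, (f n y - min (f n y) |H y|) ∂μ) atTop (𝓝 0) := by
    refine squeeze_zero (fun n => integral_nonneg fun y => ?_) (fun n => ?_) h1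
    · exact sub_nonneg.2 (min_le_left _ _)
    · refine integral_mono ((hfi n).sub ((hfi n).inf hH.abs)) ((hh n).sub hH).abs fun y => ?_
      rcases le_total (f n y) |H y| with h | h
      · rw [min_eq_left h, sub_self]; exact abs_nonneg _
      · rw [min_eq_right h]
        exact (sub_le_sub (hfh n y) (le_abs_self _)).trans (le_abs_self _)
  have h4 := h3.add h2
  rw [zero_add] at h4
  refine h4.congr fun n => ?_
  have i1 : Integrable (fun y => min (f n y) |H y|) μ := (hfi n).inf hH.abs
  have i2 : Integrable (fun y => f n y - min (f n y) |H y|) μ := (hfi n).sub i1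
  rw [← integral_add i2 i1]
  exact integral_congr_ae (Eventually.of_forall fun y => by simp)

lemma abs_sub_clamp_mul_le {a g N : ℝ} (hN : 0 < N) :
    |a * g - max (-(N * |g|)) (min (N * |g|) a) * g| ≤ a ^ 2 / N := by
  have hg := abs_nonneg g
  rw [← sub_mul, abs_mul, le_div_iff₀ hN]
  have hNg : 0 ≤ N * |g| := by positivity
  rcases le_total a (N * |g|) with h | h
  · rw [min_eq_right h]
    rcases le_total (-(N * |g|)) a with h' | h'
    · rw [max_eq_right h']; simp; positivity
    · rw [max_eq_left h', abs_of_nonpos (by linarith)]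
      nlinarith
  · rw [min_eq_left h, max_eq_right (by linarith), abs_of_nonneg (by linarith)]
    nlinarith

/-- Weak convergence of bounded sequences in `L²` converging almost everywhere. -/
lemma tendsto_integral_mul_of_sq_le {f : ℕ → Y → ℝ} {F g : Y → ℝ} {C : ℝ}
    (hf : ∀ n, MemLp (f n) 2 μ ∧ ∫ y, f n y ^ 2 ∂μ ≤ C)
    (hF : MemLp F 2 μ ∧ ∫ y, F y ^ 2 ∂μ ≤ C) (hg : MemLp g 2 μ)
    (hl : ∀ᵐ y ∂μ, Tendsto (fun n => f n y) atTop (𝓝 (F y))) :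
    Tendsto (fun n => ∫ y, f n y * g y ∂μ) atTop (𝓝 (∫ y, F y * g y ∂μ)) := by
  have hC : 0 ≤ C := (integral_nonneg fun y => sq_nonneg _).trans hF.2
  have hg2 : Integrable (fun y => g y ^ 2) μ := (memLp_two_iff_integrable_sq hg.1).1 hg
  have hg1 := hg.1
  set cl : ℝ → (Y → ℝ) → Y → ℝ := fun N f y => max (-(N * |g y|)) (min (N * |g y|) (f y)) * g y
    with hcl
  have hclm : ∀ N f, AEStronglyMeasurable f μ → AEStronglyMeasurable (cl N f) μ := fun N f hf =>
    ((hg1.norm.const_mul N).neg.sup ((hg1.norm.const_mul N).inf hf)).mul hg1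
  have hclb : ∀ N f y, 0 < N → ‖cl N f y‖ ≤ N * g y ^ 2 := by
    intro N f y hN
    have h1 : 0 ≤ N * |g y| := by positivity
    rw [hcl, Real.norm_eq_abs, abs_mul, ← sq_abs, sq, ← mul_assoc]
    refine mul_le_mul_of_nonneg_right (abs_le.2 ⟨le_max_left _ _, ?_⟩) (abs_nonneg _)
    exact max_le (by linarith) (min_le_left _ _)
  have hcli : ∀ N f, 0 < N → AEStronglyMeasurable f μ → Integrable (cl N f) μ :=
    fun N f hN hf => (hg2.const_mul N).mono' (hclm N f hf)
      (Eventually.of_forall fun y => hclb N f y hN)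
  have hfar : ∀ N (f : Y → ℝ), 0 < N → MemLp f 2 μ ∧ ∫ y, f y ^ 2 ∂μ ≤ C →
      |(∫ y, f y * g y ∂μ) - ∫ y, cl N f y ∂μ| ≤ C / N := by
    intro N f hN hf
    have i1 : Integrable (fun y => f y * g y) μ := hf.1.integrable_mul hg
    have i2 : Integrable (fun y => f y ^ 2) μ := (memLp_two_iff_integrable_sq hf.1.1).1 hf.1
    rw [← integral_sub i1 (hcli N f hN hf.1.1)]
    refine (abs_integral_le_integral_abs).trans ?_
    refine (integral_mono (i1.sub (hcli N f hN hf.1.1)).abs (i2.div_const N) fun y =>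
      abs_sub_clamp_mul_le hN).trans ?_
    rw [integral_div]
    exact div_le_div_of_nonneg_right hf.2 hN.le
  have hcll : ∀ N, 0 < N →
      Tendsto (fun n => ∫ y, cl N (f n) y ∂μ) atTop (𝓝 (∫ y, cl N F y ∂μ)) := by
    intro N hN
    refine tendsto_integral_of_dominated_convergence (fun y => N * g y ^ 2)
      (fun n => hclm N _ (hf n).1.1) (hg2.const_mul N)
      (fun n => Eventually.of_forall fun y => hclb N _ y hN) ?_
    filter_upwards [hl] with y hy
    exact ((tendsto_const_nhds.max (tendsto_const_nhds.min hy)).mul_const _)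
  rw [Metric.tendsto_atTop]
  intro ε hε
  obtain ⟨N, hN, hCN⟩ : ∃ N : ℝ, 0 < N ∧ C / N < ε / 3 := by
    refine ⟨3 * (C + 1) / ε, by positivity, ?_⟩
    rw [div_div_eq_mul_div, div_lt_div_iff₀ (by positivity) (by norm_num)]
    nlinarith
  obtain ⟨n₀, hn₀⟩ := (Metric.tendsto_atTop.1 (hcll N hN)) (ε / 3) (by positivity)
  refine ⟨n₀, fun n hn => ?_⟩
  have h1 := hfar N _ hN (hf n)
  have h2 := hfar N _ hN hF
  have h3 := hn₀ n hn
  rw [Real.dist_eq] at h3 ⊢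
  rw [abs_le] at h1 h2
  rw [abs_lt] at h3 ⊢
  constructor <;> linarith [h1.1, h1.2, h2.1, h2.2, h3.1, h3.2]

end Convergence

/-! ### Properties of the limit at a fixed time -/

section Limit

/-- Fatou's lemma for real-valued nonnegative functions. -/
lemma integrable_of_tendsto_of_integral_le {Y : Type*} [MeasurableSpace Y] {μ : Measure Y}
    {f : ℕ → Y → ℝ} {F : Y → ℝ} {C : ℝ}
    (hf : ∀ n, Integrable (f n) μ) (f0 : ∀ n y, 0 ≤ f n y) (hF : AEStronglyMeasurable F μ)
    (hl : ∀ᵐ y ∂μ, Tendsto (fun n => f n y) atTop (𝓝 (F y)))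
    (hC : ∀ n, ∫ y, f n y ∂μ ≤ C) : Integrable F μ ∧ ∫ y, F y ∂μ ≤ C := by
  have hF0 : ∀ᵐ y ∂μ, 0 ≤ F y := by
    filter_upwards [hl] with y hy
    exact ge_of_tendsto' hy fun n => f0 n y
  have hC0 : 0 ≤ C := (integral_nonneg (f0 0)).trans (hC 0)
  have h1 : ∫⁻ y, ENNReal.ofReal (F y) ∂μ ≤ ENNReal.ofReal C := by
    calc ∫⁻ y, ENNReal.ofReal (F y) ∂μ
        = ∫⁻ y, liminf (fun n => ENNReal.ofReal (f n y)) atTop ∂μ := by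
          refine lintegral_congr_ae ?_
          filter_upwards [hl] with y hy
          exact ((ENNReal.tendsto_ofReal hy).liminf_eq).symm
      _ ≤ liminf (fun n => ∫⁻ y, ENNReal.ofReal (f n y) ∂μ) atTop :=
          lintegral_liminf_le' fun n => (hf n).1.aemeasurable.ennreal_ofReal
      _ ≤ liminf (fun _ => ENNReal.ofReal C) (atTop : Filter ℕ) := by
          refine liminf_le_liminf (Eventually.of_forall fun n => ?_)
          rw [← ofReal_integral_eq_lintegral_ofReal (hf n) (Eventually.of_forall (f0 n))]
          exact ENNReal.ofReal_le_ofReal (hC n)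
      _ = _ := by simp
  refine ⟨⟨hF, ?_⟩, ?_⟩
  · rw [hasFiniteIntegral_iff_ofReal hF0]
    exact h1.trans_lt ENNReal.ofReal_lt_top
  · rw [integral_eq_lintegral_of_nonneg_ae hF0 hF]
    exact ENNReal.toReal_le_of_le_ofReal hC0 h1

variable {X : Type*} [MeasurableSpace X] {ν : Measure X}
  {k : X → X → ℝ} {K : ℕ → X → X → ℝ} {S : ℕ → Set X} {c : ℕ → ℝ} {m B : ℝ}
  {u₀ : X → ℝ} {u : ℕ → X → ℝ → ℝ} {v : X → ℝ} {t : ℝ}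

lemma KerSys.nonneg (hs : KerSys ν k K S c) (x y : X) : 0 ≤ k x y := by
  obtain ⟨n, hn⟩ := hs.lim x y
  rw [← hn]; exact (hs.ker n).nonneg x y

lemma KerSys.le (hs : KerSys ν k K S c) (n : ℕ) (x y : X) : K n x y ≤ k x y := by
  rcases hs.dich n x y with h | h
  · rw [h]; exact hs.nonneg x y
  · rw [h]

lemma KerSys.eventually_eq (hs : KerSys ν k K S c) (x y : X) :
    ∀ᶠ n in atTop, K n x y = k x y := by
  obtain ⟨n, hn⟩ := hs.lim x y
  filter_upwards [eventually_ge_atTop n] with j hj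
  exact le_antisymm (hs.le j x y) (hn ▸ hs.mono n j hj x y)

lemma KerSys.tendsto (hs : KerSys ν k K S c) (x y : X) :
    Tendsto (fun n => K n x y) atTop (𝓝 (k x y)) :=
  tendsto_const_nhds.congr' ((hs.eventually_eq x y).mono fun _ h => h.symm)

lemma KerSys.measurable (hs : KerSys ν k K S c) : Measurable (Function.uncurry k) :=
  measurable_of_tendsto_metrizable (fun n => (hs.ker n).meas)
    (tendsto_pi_nhds.2 fun p => hs.tendsto p.1 p.2)

lemma KerSys.sqrt_mul_sqrt_lim (hs : KerSys ν k K S c) (n : ℕ) (x y : X) :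
    √(K n x y) * √(k x y) = K n x y := by
  rcases hs.dich n x y with h | h
  · simp [h]
  · rw [h, Real.mul_self_sqrt (hs.nonneg x y)]

lemma KerSys.integral_le_of_lintegral_le (hs : KerSys ν k K S c) {φ : X → ℝ}
    (hφ : Measurable φ) {G : ℝ} (hG0 : 0 ≤ G)
    (hG : ∀ᵐ x ∂ν, ∫⁻ y, ENNReal.ofReal (k x y * (φ x - φ y) ^ 2) ∂ν ≤ ENNReal.ofReal G) (n : ℕ) :
    ∀ᵐ x ∂ν, ∫ y, K n x y * (φ x - φ y) ^ 2 ∂ν ≤ G := by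
  filter_upwards [hG] with x hx
  rw [integral_eq_lintegral_of_nonneg_ae
    (Eventually.of_forall fun y => mul_nonneg ((hs.ker n).nonneg x y) (sq_nonneg _))]
  · refine ENNReal.toReal_le_of_le_ofReal hG0 (le_trans (lintegral_mono fun y => ?_) hx)
    exact ENNReal.ofReal_le_ofReal (mul_le_mul_of_nonneg_right (hs.le n x y) (sq_nonneg _))
  · exact (((hs.ker n).meas.comp (measurable_const.prodMk measurable_id)).mul
      ((measurable_const.sub hφ).pow_const 2)).aestronglyMeasurable

lemma KerSys.integrable_limit [SFinite ν] (hs : KerSys ν k K S c) (hi : Integrable u₀ ν)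
    (he : ∀ n, Evol ν (K n) m B u₀ (u n)) (ht : 0 ≤ t) (hv : Measurable v)
    (hl : ∀ᵐ x ∂ν, Tendsto (fun n => u n x t) atTop (𝓝 (v x))) : Integrable v ν :=
  (integrable_of_tendsto_of_integral_le (fun n => (he n).integrable (hs.ker n) hi t)
    (fun n x => (he n).nonneg x t) hv.aestronglyMeasurable hl
    (fun n => ((he n).integral_eq (hs.ker n) hi ht).le)).1

lemma KerSys.integral_rpow_limit_le [SFinite ν] (hs : KerSys ν k K S c) (hi : Integrable u₀ ν)
    (he : ∀ n, Evol ν (K n) m B u₀ (u n)) (ht : 0 ≤ t) (hv : Measurable v)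
    (hl : ∀ᵐ x ∂ν, Tendsto (fun n => u n x t) atTop (𝓝 (v x))) {p : ℝ} (hp : 1 ≤ p) :
    ∫ x, v x ^ p ∂ν ≤ ∫ x, u₀ x ^ p ∂ν := by
  refine (integrable_of_tendsto_of_integral_le
    (fun n => (he n).integrable_rpow (hs.ker n) hi t hp)
    (fun n x => Real.rpow_nonneg ((he n).nonneg x t) _)
    (hv.pow_const p).aestronglyMeasurable ?_
    (fun n => (he n).integral_rpow_le (hs.ker n) hi ht hp)).2
  filter_upwards [hl] with x hx
  exact hx.rpow_const (Or.inr (by linarith))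

/-- A sequence of cutoff functions with vanishing carré du champ. -/
structure Cutoffs (ν : Measure X) (k : X → X → ℝ) (χ : ℕ → X → ℝ) (G : ℕ → ℝ) : Prop where
  meas : ∀ j, Measurable (χ j)
  nonneg : ∀ j x, 0 ≤ χ j x
  le_one : ∀ j x, χ j x ≤ 1
  lim : ∀ x, Tendsto (fun j => χ j x) atTop (𝓝 1)
  integrable : ∀ j, Integrable (χ j) ν
  pos : ∀ j, 0 < G j
  tendsto : Tendsto G atTop (𝓝 0)
  gamma : ∀ j, ∀ᵐ x ∂ν, ∫⁻ y, ENNReal.ofReal (k x y * (χ j x - χ j y) ^ 2) ∂ν ≤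
    ENNReal.ofReal (G j)

variable {χ : ℕ → X → ℝ} {G : ℕ → ℝ}

lemma Cutoffs.abs_le (hχ : Cutoffs ν k χ G) (j : ℕ) (x : X) : |χ j x| ≤ 1 := by
  rw [abs_of_nonneg (hχ.nonneg j x)]; exact hχ.le_one j x

lemma Cutoffs.tendsto_integral (hχ : Cutoffs ν k χ G) {f : X → ℝ} (hf : Integrable f ν) :
    Tendsto (fun j => ∫ x, f x * χ j x ∂ν) atTop (𝓝 (∫ x, f x ∂ν)) := by
  refine tendsto_integral_of_dominated_convergence (fun x => |f x|)
    (fun j => hf.1.mul (hχ.meas j).aestronglyMeasurable) hf.abs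
    (fun j => Eventually.of_forall fun x => ?_) (Eventually.of_forall fun x => ?_)
  · rw [norm_mul]
    exact mul_le_of_le_one_right (abs_nonneg _) (hχ.abs_le j x)
  · simpa using (hχ.lim x).const_mul (f x)

/-- Conservation of mass for the limit. -/
lemma KerSys.integral_limit_eq [SFinite ν] (hs : KerSys ν k K S c) (hχ : Cutoffs ν k χ G)
    (hi : Integrable u₀ ν) (he : ∀ n, Evol ν (K n) m B u₀ (u n)) (ht : 0 ≤ t) (hv : Measurable v)
    (hl : ∀ᵐ x ∂ν, Tendsto (fun n => u n x t) atTop (𝓝 (v x))) :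
    ∫ x, v x ∂ν = ∫ x, u₀ x ∂ν := by
  have hvi := hs.integrable_limit hi he ht hv hl
  set D : ℝ := (B ^ (m - 1) / (m - 1) + t) / 2 * ∫ x, u₀ x ∂ν with hD
  have h1 : ∀ j n, |(∫ x, u n x t * χ j x ∂ν) - ∫ x, u₀ x * χ j x ∂ν| ≤ √(G j) * D := by
    intro j n
    have hG := hχ.pos j
    have hg : 0 < √(G j) := Real.sqrt_pos.2 hG
    have := (he n).abs_integral_sub_mul_le (hs.ker n) hi (hχ.meas j) (hχ.abs_le j)
      (hs.integral_le_of_lintegral_le (hχ.meas j) hG.le (hχ.gamma j) n) ht hg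
    have i1 : ∀ f : X → ℝ, Integrable f ν → Integrable (fun x => f x * χ j x) ν := fun f hf =>
      hf.mul_bdd (c := 1) (hχ.meas j).aestronglyMeasurable
        (Eventually.of_forall fun x => hχ.abs_le j x)
    rw [← integral_sub (i1 _ ((he n).integrable (hs.ker n) hi t)) (i1 _ hi)]
    simp_rw [← sub_mul]
    refine this.trans (le_of_eq ?_)
    have h2 : t * G j / √(G j) = t * √(G j) := by
      rw [mul_div_assoc, Real.div_sqrt]
    rw [h2, hD]; ring
  have h2 : ∀ j, |(∫ x, v x * χ j x ∂ν) - ∫ x, u₀ x * χ j x ∂ν| ≤ √(G j) * D := by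
    intro j
    have h3 : Tendsto (fun n => ∫ x, u n x t * χ j x ∂ν) atTop (𝓝 (∫ x, v x * χ j x ∂ν)) := by
      refine tendsto_integral_of_dominated_convergence (fun x => B * χ j x)
        (fun n => (((he n).meas_t t).mul (hχ.meas j)).aestronglyMeasurable)
        ((hχ.integrable j).const_mul B)
        (fun n => Eventually.of_forall fun x => ?_) ?_
      · rw [Real.norm_of_nonneg (mul_nonneg ((he n).nonneg x t) (hχ.nonneg j x))]
        exact mul_le_mul_of_nonneg_right ((he n).le x t) (hχ.nonneg j x)
      · filter_upwards [hl] with x hx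
        exact hx.mul_const _
    exact le_of_tendsto' ((h3.sub_const _).abs) fun n => h1 j n
  have h3 : Tendsto (fun j => |(∫ x, v x * χ j x ∂ν) - ∫ x, u₀ x * χ j x ∂ν|) atTop
      (𝓝 |(∫ x, v x ∂ν) - ∫ x, u₀ x ∂ν|) :=
    ((hχ.tendsto_integral hvi).sub (hχ.tendsto_integral hi)).abs
  have h4 : Tendsto (fun j => √(G j) * D) atTop (𝓝 0) := by
    have := (Real.continuous_sqrt.tendsto 0).comp hχ.tendsto
    rw [Real.sqrt_zero] at this
    simpa using this.mul_const D
  have h5 := le_of_tendsto_of_tendsto' h3 h4 h2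
  exact sub_eq_zero.1 (abs_eq_zero.1 (le_antisymm h5 (abs_nonneg _)))

lemma KerSys.tendsto_integral_limit [SFinite ν] (hs : KerSys ν k K S c) (hχ : Cutoffs ν k χ G)
    (hi : Integrable u₀ ν) (he : ∀ n, Evol ν (K n) m B u₀ (u n)) (ht : 0 ≤ t) (hv : Measurable v)
    (hl : ∀ᵐ x ∂ν, Tendsto (fun n => u n x t) atTop (𝓝 (v x))) :
    Tendsto (fun n => ∫ x, u n x t ∂ν) atTop (𝓝 (∫ x, v x ∂ν)) := by
  rw [hs.integral_limit_eq hχ hi he ht hv hl]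
  exact tendsto_const_nhds.congr fun n => ((he n).integral_eq (hs.ker n) hi ht).symm

/-- Time continuity of the limit at the initial time, against a fixed function. -/
lemma KerSys.abs_integral_limit_sub_le [SFinite ν] (hs : KerSys ν k K S c) (hχ : Cutoffs ν k χ G)
    (hi : Integrable u₀ ν) (he : ∀ n, Evol ν (K n) m B u₀ (u n)) (ht : 0 ≤ t) (hv : Measurable v)
    (hl : ∀ᵐ x ∂ν, Tendsto (fun n => u n x t) atTop (𝓝 (v x)))
    {φ : X → ℝ} (hφ : Measurable φ) {M g : ℝ} (hM : ∀ x, |φ x| ≤ M) (hg : 0 ≤ g)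
    (hG : ∀ᵐ x ∂ν, ∫⁻ y, ENNReal.ofReal (k x y * (φ x - φ y) ^ 2) ∂ν ≤ ENNReal.ofReal g)
    {ε : ℝ} (hε : 0 < ε) :
    |(∫ x, v x * φ x ∂ν) - ∫ x, u₀ x * φ x ∂ν| ≤
      (ε * (B ^ (m - 1) / (m - 1)) + t * g / ε) / 2 * ∫ x, u₀ x ∂ν := by
  have hvi := hs.integrable_limit hi he ht hv hl
  have hui := fun n => (he n).integrable (hs.ker n) hi t
  have i1 : ∀ f : X → ℝ, Integrable f ν → Integrable (fun x => f x * φ x) ν := fun f hf =>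
    hf.mul_bdd (c := M) hφ.aestronglyMeasurable (Eventually.of_forall fun x => hM x)
  have h1 := tendsto_integral_abs_sub hui hvi (fun n x => (he n).nonneg x t) hl
    (hs.tendsto_integral_limit hχ hi he ht hv hl)
  have h2 : Tendsto (fun n => ∫ x, u n x t * φ x ∂ν) atTop (𝓝 (∫ x, v x * φ x ∂ν)) := by
    rw [tendsto_iff_dist_tendsto_zero]
    refine squeeze_zero (fun _ => dist_nonneg) (fun n => ?_) (by simpa using h1.const_mul M)
    rw [Real.dist_eq, ← integral_sub (i1 _ (hui n)) (i1 _ hvi), ← integral_const_mul]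
    refine abs_integral_le_integral_abs.trans (integral_mono ((i1 _ (hui n)).sub (i1 _ hvi)).abs
      (((hui n).sub hvi).abs.const_mul M) fun x => ?_)
    simp only [← sub_mul, abs_mul]
    rw [mul_comm]
    exact mul_le_mul_of_nonneg_right (hM x) (abs_nonneg _)
  refine le_of_tendsto' ((h2.sub_const _).abs) fun n => ?_
  rw [← integral_sub (i1 _ (hui n)) (i1 _ hi)]
  simp_rw [← sub_mul]
  exact (he n).abs_integral_sub_mul_le (hs.ker n) hi hφ hM
    (hs.integral_le_of_lintegral_le hφ hg hG n) ht hε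

/-- Truncated energies of the limit. -/
lemma KerSys.lintegral_truncated_limit_le [SFinite ν] (hs : KerSys ν k K S c)
    (hχ : Cutoffs ν k χ G)
    (hi : Integrable u₀ ν) (he : ∀ n, Evol ν (K n) m B u₀ (u n)) (ht : 0 < t) (hv : Measurable v)
    (hl : ∀ᵐ x ∂ν, Tendsto (fun n => u n x t) atTop (𝓝 (v x))) {l : ℝ} (hl0 : 0 ≤ l) :
    ∫⁻ p, ENNReal.ofReal (k p.1 p.2 * (max (v p.1 ^ m - l) 0 - max (v p.2 ^ m - l) 0) ^ 2)
        ∂(ν.prod ν) ≤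
      ENNReal.ofReal (2 / ((m - 1) * t) * ∫ x, v x * max (v x ^ m - l) 0 ∂ν) := by
  have hm := (he 0).hm
  have hvi := hs.integrable_limit hi he ht.le hv hl
  set f : ℕ → X → ℝ := fun n x => max (u n x t ^ m - l) 0 with hf
  have hfm : ∀ n, Measurable (f n) := fun n =>
    ((((he n).meas_t t).pow_const m).sub_const l).max measurable_const
  have hf0 : ∀ n x, 0 ≤ f n x := fun n x => le_max_right _ _
  have hfB : ∀ n x, f n x ≤ B ^ m := fun n x =>
    max_le (by linarith [(he n).pow_le x t]) (((he n).pow_nonneg x t).trans ((he n).pow_le x t))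
  have hfl : ∀ᵐ x ∂ν, Tendsto (fun n => f n x) atTop (𝓝 (max (v x ^ m - l) 0)) := by
    filter_upwards [hl] with x hx
    exact ((hx.rpow_const (Or.inr (by linarith))).sub_const l).max tendsto_const_nhds
  have h1 : Tendsto (fun n => ∫ x, u n x t * f n x ∂ν) atTop
      (𝓝 (∫ x, v x * max (v x ^ m - l) 0 ∂ν)) := by
    refine tendsto_integral_of_le_of_tendsto (h := fun n x => B ^ m * u n x t)
      (H := fun x => B ^ m * v x)
      (fun n => (((he n).meas_t t).mul (hfm n)).aestronglyMeasurable)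
      (fun n => ((he n).integrable (hs.ker n) hi t).const_mul _) (hvi.const_mul _)
      (fun n x => mul_nonneg ((he n).nonneg x t) (hf0 n x)) (fun n x => ?_) ?_ ?_ ?_
    · rw [mul_comm]
      exact mul_le_mul_of_nonneg_right (hfB n x) ((he n).nonneg x t)
    · filter_upwards [hl, hfl] with x hx1 hx2 using hx1.mul hx2
    · filter_upwards [hl] with x hx using hx.const_mul _
    · simp_rw [integral_const_mul]
      exact (hs.tendsto_integral_limit hχ hi he ht.le hv hl).const_mul _
  have h2 : ∀ n, ∫⁻ p, ENNReal.ofReal (K n p.1 p.2 * (f n p.1 - f n p.2) ^ 2) ∂(ν.prod ν) ≤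
      ENNReal.ofReal (2 / ((m - 1) * t) * ∫ x, u n x t * f n x ∂ν) := by
    intro n
    have h3 := (he n).truncated_energy_le (hs.ker n) hi ht hl0
    have i1 : Integrable (fun p : X × X => K n p.1 p.2 * (f n p.1 - f n p.2) ^ 2) (ν.prod ν) := by
      refine (hs.ker n).integrable_prod_mul (M := (B ^ m) ^ 2) ?_ fun p => ?_
      · exact (((hfm n).comp measurable_fst).sub ((hfm n).comp measurable_snd)).pow_const 2
      · rw [abs_of_nonneg (sq_nonneg _)]
        refine sq_le_sq' ?_ ?_ <;> linarith [hf0 n p.1, hf0 n p.2, hfB n p.1, hfB n p.2]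
    rw [← ofReal_integral_eq_lintegral_ofReal i1 (Eventually.of_forall fun p =>
      mul_nonneg ((hs.ker n).nonneg _ _) (sq_nonneg _))]
    refine ENNReal.ofReal_le_ofReal ?_
    rw [dform] at h3
    simp_rw [← sq] at h3
    rw [show 2 / ((m - 1) * t) = 2 * (1 / ((m - 1) * t)) by ring, mul_assoc]
    linarith
  have hae : ∀ᵐ p ∂(ν.prod ν), Tendsto (fun n => f n p.1) atTop (𝓝 (max (v p.1 ^ m - l) 0)) ∧
      Tendsto (fun n => f n p.2) atTop (𝓝 (max (v p.2 ^ m - l) 0)) :=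
    (Measure.quasiMeasurePreserving_fst.ae hfl).and (Measure.quasiMeasurePreserving_snd.ae hfl)
  calc _ = ∫⁻ p, liminf (fun n => ENNReal.ofReal (K n p.1 p.2 * (f n p.1 - f n p.2) ^ 2)) atTop
        ∂(ν.prod ν) := by
        refine lintegral_congr_ae ?_
        filter_upwards [hae] with p hp
        exact ((ENNReal.tendsto_ofReal ((hs.tendsto p.1 p.2).mul
          ((hp.1.sub hp.2).pow 2))).liminf_eq).symm
    _ ≤ liminf (fun n => ∫⁻ p, ENNReal.ofReal (K n p.1 p.2 * (f n p.1 - f n p.2) ^ 2)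
        ∂(ν.prod ν)) atTop := lintegral_liminf_le fun n => Measurable.ennreal_ofReal
          ((hs.ker n).meas.mul (((hfm n).comp measurable_fst).sub
            ((hfm n).comp measurable_snd) |>.pow_const 2))
    _ ≤ liminf (fun n => ENNReal.ofReal (2 / ((m - 1) * t) * ∫ x, u n x t * f n x ∂ν)) atTop :=
        liminf_le_liminf (Eventually.of_forall h2)
    _ = _ := (ENNReal.tendsto_ofReal (h1.const_mul _)).liminf_eq

end Limit

/-! ### The weak formulation -/

section Weak

variable {X : Type*} [MeasurableSpace X] {ν : Measure X}

/-- Admissible space-time test functions `ψ` with time derivative `ψ'`. -/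
structure TestPair (ν : Measure X) (k : X → X → ℝ) (ψ ψ' : X → ℝ → ℝ) (A : Set X)
    (a T M Γ : ℝ) : Prop where
  meas : Measurable (Function.uncurry ψ)
  meas' : Measurable (Function.uncurry ψ')
  deriv : ∀ x t, HasDerivAt (ψ x) (ψ' x t) t
  cont' : ∀ x, Continuous (ψ' x)
  bound : ∀ x t, |ψ x t| ≤ M
  bound' : ∀ x t, |ψ' x t| ≤ M
  zero : ∀ x t, x ∉ A ∨ t ≤ a ∨ T ≤ t → ψ x t = 0
  zero' : ∀ x t, x ∉ A ∨ t ≤ a ∨ T ≤ t → ψ' x t = 0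
  measA : MeasurableSet A
  finA : ν A ≠ ⊤
  pos : 0 < a
  lt : a < T
  energy : ∀ t, ∫⁻ p, ENNReal.ofReal (k p.1 p.2 * (ψ p.1 t - ψ p.2 t) ^ 2) ∂(ν.prod ν) ≤
    ENNReal.ofReal Γ

variable {k : X → X → ℝ} {ψ ψ' : X → ℝ → ℝ} {A : Set X} {a T M Γ : ℝ}

lemma TestPair.meas_t (h : TestPair ν k ψ ψ' A a T M Γ) (t : ℝ) : Measurable fun x => ψ x t :=
  h.meas.comp (measurable_id.prodMk measurable_const)

lemma TestPair.meas'_t (h : TestPair ν k ψ ψ' A a T M Γ) (t : ℝ) : Measurable fun x => ψ' x t :=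
  h.meas'.comp (measurable_id.prodMk measurable_const)

lemma TestPair.integrable_mul (h : TestPair ν k ψ ψ' A a T M Γ) {f : X → ℝ} (hf : Measurable f)
    {B : ℝ} (hB : ∀ x, |f x| ≤ B) (t : ℝ) : Integrable (fun x => f x * ψ' x t) ν := by
  refine integrable_of_bounded_of_supp (T := A) (M := B * M)
    (hf.mul (h.meas'_t t)).aestronglyMeasurable h.measA h.finA (fun x => ?_) fun x hx => ?_
  · rw [abs_mul]
    exact mul_le_mul (hB x) (h.bound' x t) (abs_nonneg _) ((abs_nonneg _).trans (hB x))
  · rw [h.zero' x t (Or.inl hx), mul_zero]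

lemma setIntegral_Ioi_eq_Ioc {f : ℝ → ℝ} {T : ℝ} (hf : ∀ t, T ≤ t → f t = 0) :
    ∫ t in Ioi 0, f t = ∫ t in Ioc 0 T, f t := by
  refine (setIntegral_eq_of_subset_of_forall_sdiff_eq_zero measurableSet_Ioi
    (fun t ht => ht.1) fun t ht => hf t ?_)
  by_contra h
  exact ht.2 ⟨ht.1, (not_le.1 h).le⟩

lemma Evol.weak_form [SFinite ν] {k' : X → X → ℝ} {S : Set X} {c m B : ℝ} {u₀ : X → ℝ}
    {u : X → ℝ → ℝ} (e : Evol ν k' m B u₀ u) (h : SymKer ν k' S c)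
    (hψ : TestPair ν k ψ ψ' A a T M Γ) :
    ∫ t in Ioc 0 T, ∫ x, u x t * ψ' x t ∂ν =
      ∫ t in Ioc 0 T, dform ν k' (fun x => u x t ^ m) fun x => ψ x t := by
  rcases isEmpty_or_nonempty X with hX | ⟨⟨x₀⟩⟩
  · have : ν = 0 := Measure.eq_zero_of_isEmpty ν
    subst this
    simp [dform]
  have hB : 0 ≤ B := (e.nonneg x₀ 0).trans (e.le x₀ 0)
  have hM : 0 ≤ M := (abs_nonneg _).trans (hψ.bound x₀ 0)
  have hT : 0 ≤ T := (hψ.pos.trans hψ.lt).le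
  have hnm := e.measurable_nlOp h
  have hbd : ∀ x s, |nlOp ν k' m (fun y => u y s) x| ≤ |c| * ν.real S * B ^ m := e.abs_nlOp_le h
  have hbu : ∀ x s, |u x s| ≤ B := fun x s => by rw [abs_of_nonneg (e.nonneg x s)]; exact e.le x s
  set F₁ : X × ℝ → ℝ := fun z => u z.1 z.2 * ψ' z.1 z.2
  set F₂ : X × ℝ → ℝ := fun z => nlOp ν k' m (fun y => u y z.2) z.1 * ψ z.1 z.2
  have m1 : Measurable F₁ := e.meas.mul hψ.meas'
  have m2 : Measurable F₂ := hnm.mul hψ.meas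
  have b1 : ∀ z, |F₁ z| ≤ B * M := fun z => by
    rw [abs_mul]; exact mul_le_mul (hbu _ _) (hψ.bound' _ _) (abs_nonneg _) hB
  have b2 : ∀ z, |F₂ z| ≤ |c| * ν.real S * B ^ m * M := fun z => by
    rw [abs_mul]
    exact mul_le_mul (hbd _ _) (hψ.bound _ _) (abs_nonneg _) ((abs_nonneg _).trans (hbd x₀ 0))
  have hfin : (ν.prod (volume.restrict (Ioc 0 T))) (A ×ˢ univ) ≠ ⊤ := by
    rw [Measure.prod_prod]; exact ENNReal.mul_ne_top hψ.finA (by simp)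
  have i1 : Integrable F₁ (ν.prod (volume.restrict (Ioc 0 T))) :=
    integrable_of_bounded_of_supp (T := A ×ˢ univ) m1.aestronglyMeasurable
      (hψ.measA.prod MeasurableSet.univ) hfin b1 fun z hz => by
        have : z.1 ∉ A := fun h => hz ⟨h, trivial⟩
        simp [F₁, hψ.zero' z.1 z.2 (Or.inl this)]
  have i2 : Integrable F₂ (ν.prod (volume.restrict (Ioc 0 T))) :=
    integrable_of_bounded_of_supp (T := A ×ˢ univ) m2.aestronglyMeasurable
      (hψ.measA.prod MeasurableSet.univ) hfin b2 fun z hz => by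
        have : z.1 ∉ A := fun h => hz ⟨h, trivial⟩
        simp [F₂, hψ.zero z.1 z.2 (Or.inl this)]
  have hpt : ∀ x, ∫ t in Ioc 0 T, F₁ (x, t) = -∫ t in Ioc 0 T, F₂ (x, t) := by
    intro x
    have j1 : IntegrableOn (fun t => F₁ (x, t)) (Ioc 0 T) :=
      Measure.integrableOn_of_bounded (M := B * M) (by simp)
        (m1.comp (measurable_const.prodMk measurable_id)).aestronglyMeasurable
        (Eventually.of_forall fun t => b1 _)
    have j2 : IntegrableOn (fun t => F₂ (x, t)) (Ioc 0 T) :=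
      Measure.integrableOn_of_bounded (M := |c| * ν.real S * B ^ m * M) (by simp)
        (m2.comp (measurable_const.prodMk measurable_id)).aestronglyMeasurable
        (Eventually.of_forall fun t => b2 _)
    have h1 : ∫ t in (0:ℝ)..T, (F₂ (x, t) + F₁ (x, t)) = u x T * ψ x T - u x 0 * ψ x 0 := by
      refine intervalIntegral.integral_eq_sub_of_hasDerivAt_of_le hT
        (f := fun t => u x t * ψ x t) ?_ ?_ ?_
      · exact ((e.cont x).mul (continuous_iff_continuousAt.2 fun t =>
          (hψ.deriv x t).continuousAt)).continuousOn
      · intro t ht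
        exact (e.deriv x t ht.1).mul (hψ.deriv x t)
      · rw [intervalIntegrable_iff_integrableOn_Ioc_of_le hT]
        exact j2.add j1
    rw [intervalIntegral.integral_of_le hT, integral_add j2 j1,
      hψ.zero x T (Or.inr (Or.inr le_rfl)), hψ.zero x 0 (Or.inr (Or.inl hψ.pos.le))] at h1
    linarith
  have e1 : ∫ t in Ioc 0 T, ∫ x, u x t * ψ' x t ∂ν = ∫ x, (∫ t in Ioc 0 T, F₁ (x, t)) ∂ν :=
    (integral_prod_symm _ i1).symm.trans (integral_prod _ i1)
  rw [e1]
  simp_rw [hpt]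
  rw [integral_neg]
  have e2 : ∫ x, (∫ t in Ioc 0 T, F₂ (x, t)) ∂ν = ∫ t in Ioc 0 T, ∫ x, F₂ (x, t) ∂ν :=
    (integral_prod _ i2).symm.trans (integral_prod_symm _ i2)
  rw [e2, ← integral_neg]
  refine integral_congr_ae (Eventually.of_forall fun t => ?_)
  show -(∫ x, nlOp ν k' m (fun y => u y t) x * ψ x t ∂ν) = _
  rw [h.integral_nlOp_mul (e.meas_t t) (hψ.meas_t t) (fun x y => e.abs_pow_sub_le x y t)
    (fun x => hψ.bound x t), neg_neg]

variable {K : ℕ → X → X → ℝ} {S : ℕ → Set X} {c : ℕ → ℝ} {m B : ℝ}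
  {u₀ : X → ℝ} {u : ℕ → X → ℝ → ℝ} {v : X → ℝ → ℝ}

lemma KerSys.integral_sq_le [SFinite ν] (hs : KerSys ν k K S c) (hi : Integrable u₀ ν)
    (he : ∀ n, Evol ν (K n) m B u₀ (u n)) {t : ℝ} (ht : 0 < t) (n : ℕ) :
    MemLp (fun p : X × X => √(K n p.1 p.2) * (u n p.1 t ^ m - u n p.2 t ^ m)) 2 (ν.prod ν) ∧
    ∫ p, (√(K n p.1 p.2) * (u n p.1 t ^ m - u n p.2 t ^ m)) ^ 2 ∂(ν.prod ν) ≤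
      2 * (B ^ m * (∫ x, u₀ x ∂ν)) / ((m - 1) * t) := by
  have hm := (he n).hm
  have hmm : Measurable fun p : X × X => u n p.1 t ^ m - u n p.2 t ^ m :=
    ((((he n).meas_t t).comp measurable_fst).pow_const m).sub
      ((((he n).meas_t t).comp measurable_snd).pow_const m)
  have hsq : ∀ p : X × X, (√(K n p.1 p.2) * (u n p.1 t ^ m - u n p.2 t ^ m)) ^ 2 =
      K n p.1 p.2 * (u n p.1 t ^ m - u n p.2 t ^ m) ^ 2 := fun p => by
    rw [mul_pow, Real.sq_sqrt ((hs.ker n).nonneg _ _)]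
  have i1 : Integrable (fun p : X × X => K n p.1 p.2 * (u n p.1 t ^ m - u n p.2 t ^ m) ^ 2)
      (ν.prod ν) :=
    (hs.ker n).integrable_prod_mul (M := (B ^ m) ^ 2) (hmm.pow_const 2) fun p => by
      rw [abs_of_nonneg (sq_nonneg _)]
      exact sq_le_sq.2 (((he n).abs_pow_sub_le _ _ t).trans (le_abs_self _))
  refine ⟨?_, ?_⟩
  · rw [memLp_two_iff_integrable_sq]
    · exact i1.congr (Eventually.of_forall fun p => (hsq p).symm)
    · exact ((Real.continuous_sqrt.measurable.comp (hs.ker n).meas).mul hmm).aestronglyMeasurable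
  · simp_rw [hsq]
    have h3 := (he n).truncated_energy_le (hs.ker n) hi ht le_rfl
    simp only [sub_zero, max_eq_left ((he n).pow_nonneg _ t), dform, ← sq] at h3
    have h4 : ∫ x, u n x t * u n x t ^ m ∂ν ≤ B ^ m * ∫ x, u₀ x ∂ν := by
      rw [← (he n).integral_eq (hs.ker n) hi ht.le, ← integral_const_mul]
      refine integral_mono_of_nonneg (Eventually.of_forall fun x =>
        mul_nonneg ((he n).nonneg x t) ((he n).pow_nonneg x t))
        (((he n).integrable (hs.ker n) hi t).const_mul _) (Eventually.of_forall fun x => ?_)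
      show u n x t * u n x t ^ m ≤ B ^ m * u n x t
      rw [mul_comm]
      exact mul_le_mul_of_nonneg_right ((he n).pow_le x t) ((he n).nonneg x t)
    have h5 : 0 < (m - 1) * t := mul_pos (by linarith) ht
    calc _ ≤ 2 * (1 / ((m - 1) * t) * ∫ x, u n x t * u n x t ^ m ∂ν) := by linarith
      _ ≤ 2 * (1 / ((m - 1) * t) * (B ^ m * ∫ x, u₀ x ∂ν)) := by gcongr
      _ = _ := by ring

/-- The weak formulation for the limit. -/
lemma KerSys.weak_form [SFinite ν] (hs : KerSys ν k K S c) (hi : Integrable u₀ ν)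
    (he : ∀ n, Evol ν (K n) m B u₀ (u n)) (hv : Measurable (Function.uncurry v))
    (hl : ∀ᵐ t ∂(volume.restrict (Ioi (0:ℝ))),
      ∀ᵐ x ∂ν, Tendsto (fun n => u n x t) atTop (𝓝 (v x t)))
    (hψ : TestPair ν k ψ ψ' A a T M Γ) :
    ∫ t in Ioi 0, ∫ x, v x t * ψ' x t ∂ν =
      ∫ t in Ioi 0, dform ν k (fun x => v x t ^ m) fun x => ψ x t := by
  have hm := (he 0).hm
  rcases isEmpty_or_nonempty X with hX | ⟨⟨x₀⟩⟩
  · have : ν = 0 := Measure.eq_zero_of_isEmpty ν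
    subst this
    simp [dform]
  have hB : 0 ≤ B := ((he 0).nonneg x₀ 0).trans ((he 0).le x₀ 0)
  have hM : 0 ≤ M := (abs_nonneg _).trans (hψ.bound x₀ 0)
  have hI : 0 ≤ ∫ x, u₀ x ∂ν := integral_nonneg (he 0).init_nonneg
  have hΓ : ∀ t, ∫⁻ p, ENNReal.ofReal (k p.1 p.2 * (ψ p.1 t - ψ p.2 t) ^ 2) ∂(ν.prod ν) ≤
      ENNReal.ofReal (max Γ 0) := fun t =>
    (hψ.energy t).trans (ENNReal.ofReal_le_ofReal (le_max_left _ _))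
  have hΓ0 : 0 ≤ max Γ 0 := le_max_right _ _
  set Γ' := max Γ 0
  rw [setIntegral_Ioi_eq_Ioc (T := T) fun t ht => by
      simp [hψ.zero' _ t (Or.inr (Or.inr ht))],
    setIntegral_Ioi_eq_Ioc (T := T) fun t ht => by
      simp [dform, hψ.zero _ t (Or.inr (Or.inr ht))]]
  have hl' : ∀ᵐ t ∂(volume.restrict (Ioc 0 T)),
      ∀ᵐ x ∂ν, Tendsto (fun n => u n x t) atTop (𝓝 (v x t)) :=
    ae_restrict_of_ae_restrict_of_subset (fun t ht => ht.1) hl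
  have hbu : ∀ n x s, |u n x s| ≤ B := fun n x s => by
    rw [abs_of_nonneg ((he n).nonneg x s)]; exact (he n).le x s
  -- the left-hand sides
  have hL : Tendsto (fun n => ∫ t in Ioc 0 T, ∫ x, u n x t * ψ' x t ∂ν) atTop
      (𝓝 (∫ t in Ioc 0 T, ∫ x, v x t * ψ' x t ∂ν)) := by
    have hind : Integrable (A.indicator fun _ => B * M) ν :=
      (integrableOn_const hψ.finA).integrable_indicator hψ.measA
    have hbd : ∀ n x t, ‖u n x t * ψ' x t‖ ≤ A.indicator (fun _ => B * M) x := by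
      intro n x t
      by_cases hx : x ∈ A
      · rw [indicator_of_mem hx, Real.norm_eq_abs, abs_mul]
        exact mul_le_mul (hbu n x t) (hψ.bound' x t) (abs_nonneg _) hB
      · simp [hψ.zero' x t (Or.inl hx), hx]
    refine tendsto_integral_of_dominated_convergence
      (fun _ => ∫ x, A.indicator (fun _ => B * M) x ∂ν) (fun n => ?_) (by simp)
      (fun n => Eventually.of_forall fun t => ?_) ?_
    · exact (((he n).meas.mul hψ.meas').stronglyMeasurable.integral_prod_left
        (f := fun x t => u n x t * ψ' x t)).aestronglyMeasurable
    · exact norm_integral_le_of_norm_le hind (Eventually.of_forall fun x => hbd n x t)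
    · filter_upwards [hl'] with t ht
      refine tendsto_integral_of_dominated_convergence (A.indicator fun _ => B * M)
        (fun n => (((he n).meas_t t).mul (hψ.meas'_t t)).aestronglyMeasurable) hind
        (fun n => Eventually.of_forall fun x => hbd n x t) ?_
      filter_upwards [ht] with x hx using hx.mul_const _
  -- the right-hand sides
  have hg : ∀ t, MemLp (fun p : X × X => √(k p.1 p.2) * (ψ p.1 t - ψ p.2 t)) 2 (ν.prod ν) ∧
      ∫ p, (√(k p.1 p.2) * (ψ p.1 t - ψ p.2 t)) ^ 2 ∂(ν.prod ν) ≤ Γ' := by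
    intro t
    have hsq : ∀ p : X × X, (√(k p.1 p.2) * (ψ p.1 t - ψ p.2 t)) ^ 2 =
        k p.1 p.2 * (ψ p.1 t - ψ p.2 t) ^ 2 := fun p => by
      rw [mul_pow, Real.sq_sqrt (hs.nonneg _ _)]
    have hpm : Measurable fun p : X × X => ψ p.1 t - ψ p.2 t :=
      ((hψ.meas_t t).comp measurable_fst).sub ((hψ.meas_t t).comp measurable_snd)
    have h0 : 0 ≤ᵐ[ν.prod ν] fun p : X × X => k p.1 p.2 * (ψ p.1 t - ψ p.2 t) ^ 2 :=
      Eventually.of_forall fun p => mul_nonneg (hs.nonneg _ _) (sq_nonneg _)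
    have hkm : AEStronglyMeasurable (fun p : X × X => k p.1 p.2 * (ψ p.1 t - ψ p.2 t) ^ 2)
        (ν.prod ν) := (hs.measurable.mul (hpm.pow_const 2)).aestronglyMeasurable
    refine ⟨?_, ?_⟩
    · rw [memLp_two_iff_integrable_sq]
      · simp_rw [hsq]
        refine ⟨hkm, ?_⟩
        rw [hasFiniteIntegral_iff_ofReal h0]
        exact (hΓ t).trans_lt ENNReal.ofReal_lt_top
      · exact ((Real.continuous_sqrt.measurable.comp hs.measurable).mul hpm).aestronglyMeasurable
    · simp_rw [hsq]
      rw [integral_eq_lintegral_of_nonneg_ae h0 hkm]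
      exact ENNReal.toReal_le_of_le_ofReal hΓ0 (hΓ t)
  have hform : ∀ n t, dform ν (K n) (fun x => u n x t ^ m) (fun x => ψ x t) =
      2⁻¹ * ∫ p, (√(K n p.1 p.2) * (u n p.1 t ^ m - u n p.2 t ^ m)) *
        (√(k p.1 p.2) * (ψ p.1 t - ψ p.2 t)) ∂(ν.prod ν) := by
    intro n t
    rw [dform]
    congr 1
    refine integral_congr_ae (Eventually.of_forall fun p => ?_)
    simp only
    linear_combination (-(u n p.1 t ^ m - u n p.2 t ^ m) * (ψ p.1 t - ψ p.2 t)) *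
      hs.sqrt_mul_sqrt_lim n p.1 p.2
  have hR : Tendsto (fun n => ∫ t in Ioc 0 T,
      dform ν (K n) (fun x => u n x t ^ m) fun x => ψ x t) atTop
      (𝓝 (∫ t in Ioc 0 T, dform ν k (fun x => v x t ^ m) fun x => ψ x t)) := by
    set C := 2 * (B ^ m * (∫ x, u₀ x ∂ν)) / ((m - 1) * a) with hC
    have hCa : ∀ t, a ≤ t → 2 * (B ^ m * (∫ x, u₀ x ∂ν)) / ((m - 1) * t) ≤ C := by
      intro t ht
      have := hψ.pos
      have : 0 < m - 1 := by linarith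
      rw [hC]; gcongr
    have hC0 : 0 ≤ C := by
      have := hψ.pos
      have : 0 < m - 1 := by linarith
      positivity
    refine tendsto_integral_of_dominated_convergence (fun _ => (C + Γ') / 4) (fun n => ?_) (by simp)
      (fun n => Eventually.of_forall fun t => ?_) ?_
    · simp only [dform]
      refine AEStronglyMeasurable.const_mul ?_ _
      refine (StronglyMeasurable.integral_prod_left (f := fun (p : X × X) t => K n p.1 p.2 *
        ((u n p.1 t ^ m - u n p.2 t ^ m) * (ψ p.1 t - ψ p.2 t))) ?_).aestronglyMeasurable
      refine Measurable.stronglyMeasurable ?_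
      have q1 : Measurable fun z : (X × X) × ℝ => (z.1.1, z.2) :=
        (measurable_fst.comp measurable_fst).prodMk measurable_snd
      have q2 : Measurable fun z : (X × X) × ℝ => (z.1.2, z.2) :=
        (measurable_snd.comp measurable_fst).prodMk measurable_snd
      exact ((hs.ker n).meas.comp measurable_fst).mul
        (((((he n).meas.comp q1).pow_const m).sub (((he n).meas.comp q2).pow_const m)).mul
          ((hψ.meas.comp q1).sub (hψ.meas.comp q2)))
    · rcases le_total t a with ha | ha
      · simp only [dform, hψ.zero _ t (Or.inr (Or.inl ha)), sub_zero, mul_zero, integral_zero,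
          norm_zero]
        positivity
      · have h1 := hs.integral_sq_le hi he (hψ.pos.trans_le ha) n
        have h2 := hg t
        have i1 := (memLp_two_iff_integrable_sq h1.1.1).1 h1.1
        have i2 := (memLp_two_iff_integrable_sq h2.1.1).1 h2.1
        rw [hform, norm_mul]
        have h3 := norm_integral_le_of_norm_le ((i1.add i2).div_const 2)
          (f := fun p : X × X => (√(K n p.1 p.2) * (u n p.1 t ^ m - u n p.2 t ^ m)) *
            (√(k p.1 p.2) * (ψ p.1 t - ψ p.2 t))) (Eventually.of_forall fun p => by
              rw [Real.norm_eq_abs, abs_le]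
              simp only [Pi.add_apply]
              constructor
              · nlinarith [sq_nonneg ((√(K n p.1 p.2) * (u n p.1 t ^ m - u n p.2 t ^ m)) +
                  (√(k p.1 p.2) * (ψ p.1 t - ψ p.2 t)))]
              · nlinarith [sq_nonneg ((√(K n p.1 p.2) * (u n p.1 t ^ m - u n p.2 t ^ m)) -
                  (√(k p.1 p.2) * (ψ p.1 t - ψ p.2 t)))])
        simp only [Pi.add_apply] at h3
        rw [integral_div, integral_add i1 i2] at h3
        rw [Real.norm_of_nonneg (by norm_num : (0:ℝ) ≤ 2⁻¹)]
        have h4 := h1.2.trans (hCa t ha)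
        linarith [h2.2]
    · filter_upwards [hl', ae_restrict_mem measurableSet_Ioc] with t ht ht0
      have hvt : Measurable fun x => v x t := hv.comp (measurable_id.prodMk measurable_const)
      have hlim : ∀ᵐ p ∂(ν.prod ν), Tendsto (fun n =>
          √(K n p.1 p.2) * (u n p.1 t ^ m - u n p.2 t ^ m)) atTop
          (𝓝 (√(k p.1 p.2) * (v p.1 t ^ m - v p.2 t ^ m))) := by
        filter_upwards [Measure.quasiMeasurePreserving_fst.ae ht,
          Measure.quasiMeasurePreserving_snd.ae ht] with p h1 h2
        exact ((Real.continuous_sqrt.tendsto _).comp (hs.tendsto p.1 p.2)).mul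
          ((h1.rpow_const (Or.inr (by linarith))).sub (h2.rpow_const (Or.inr (by linarith))))
      have hFm : AEStronglyMeasurable (fun p : X × X =>
          √(k p.1 p.2) * (v p.1 t ^ m - v p.2 t ^ m)) (ν.prod ν) :=
        ((Real.continuous_sqrt.measurable.comp hs.measurable).mul
          (((hvt.comp measurable_fst).pow_const m).sub
            ((hvt.comp measurable_snd).pow_const m))).aestronglyMeasurable
      have hf := fun n => hs.integral_sq_le hi he ht0.1 n
      have hF := integrable_of_tendsto_of_integral_le
        (fun n => (memLp_two_iff_integrable_sq (hf n).1.1).1 (hf n).1) (fun n p => sq_nonneg _)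
        (hFm.pow 2) (hlim.mono fun p hp => hp.pow 2) (fun n => (hf n).2)
      have h5 := tendsto_integral_mul_of_sq_le hf
        ⟨(memLp_two_iff_integrable_sq hFm).2 hF.1, hF.2⟩ (hg t).1 hlim
      simp_rw [hform]
      have h6 : dform ν k (fun x => v x t ^ m) (fun x => ψ x t) =
          2⁻¹ * ∫ p, (√(k p.1 p.2) * (v p.1 t ^ m - v p.2 t ^ m)) *
            (√(k p.1 p.2) * (ψ p.1 t - ψ p.2 t)) ∂(ν.prod ν) := by
        rw [dform]
        congr 1
        refine integral_congr_ae (Eventually.of_forall fun p => ?_)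
        linear_combination (-(v p.1 t ^ m - v p.2 t ^ m) * (ψ p.1 t - ψ p.2 t)) *
          Real.mul_self_sqrt (hs.nonneg p.1 p.2)
      rw [h6]
      exact h5.const_mul 2⁻¹
  refine tendsto_nhds_unique hL (hR.congr fun n => ?_)
  exact ((he n).weak_form (hs.ker n) hψ).symm

end Weak

/-! ### Existence of solutions for abstract kernels -/

section Existence

variable {X : Type*} [MeasurableSpace X] {ν : Measure X}
  {k : X → X → ℝ} {K : ℕ → X → X → ℝ} {S : ℕ → Set X} {c : ℕ → ℝ} {m B : ℝ}
  {u₀ : X → ℝ} {χ : ℕ → X → ℝ} {G : ℕ → ℝ}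

lemma KerSys.comp (hs : KerSys ν k K S c) {φ : ℕ → ℕ} (hφ : StrictMono φ) :
    KerSys ν k (fun n => K (φ n)) (fun n => S (φ n)) (fun n => c (φ n)) where
  ker n := hs.ker _
  dich n := hs.dich _
  mono n j h := hs.mono _ _ (hφ.monotone h)
  lim x y := by
    obtain ⟨n, hn⟩ := hs.lim x y
    exact ⟨n, le_antisymm (hs.le _ x y) (hn ▸ hs.mono n (φ n) hφ.le_apply x y)⟩

/-- Properties of a time slice `v` of the constructed solution at time `t`. -/
structure Slice (ν : Measure X) (k : X → X → ℝ) (m B : ℝ) (u₀ v : X → ℝ) (t : ℝ) : Prop where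
  integrable : Integrable v ν
  integral_eq : ∫ x, v x ∂ν = ∫ x, u₀ x ∂ν
  rpow_le : ∀ p : ℝ, 1 ≤ p → ∫ x, v x ^ p ∂ν ≤ ∫ x, u₀ x ^ p ∂ν
  energy : ∀ l : ℝ, 0 ≤ l →
    ∫⁻ p, ENNReal.ofReal (k p.1 p.2 * (max (v p.1 ^ m - l) 0 - max (v p.2 ^ m - l) 0) ^ 2)
        ∂(ν.prod ν) ≤
      ENNReal.ofReal (2 / ((m - 1) * t) * ∫ x, v x * max (v x ^ m - l) 0 ∂ν)
  trace : ∀ φ : X → ℝ, Measurable φ → ∀ M, (∀ x, |φ x| ≤ M) → ∀ g, 0 ≤ g →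
    (∀ᵐ x ∂ν, ∫⁻ y, ENNReal.ofReal (k x y * (φ x - φ y) ^ 2) ∂ν ≤ ENNReal.ofReal g) →
    ∀ ε, 0 < ε → |(∫ x, v x * φ x ∂ν) - ∫ x, u₀ x * φ x ∂ν| ≤
      (ε * (B ^ (m - 1) / (m - 1)) + t * g / ε) / 2 * ∫ x, u₀ x ∂ν

theorem KerSys.exists_solution [SFinite ν] (hs : KerSys ν k K S c) (hχ : Cutoffs ν k χ G)
    (hm : 1 < m) (hB : 0 ≤ B) (hu : Measurable u₀) (hu0 : ∀ x, 0 ≤ u₀ x) (huB : ∀ x, u₀ x ≤ B)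
    (hi : Integrable u₀ ν) :
    ∃ v : X → ℝ → ℝ, Measurable (Function.uncurry v) ∧ (∀ x t, 0 ≤ v x t ∧ v x t ≤ B) ∧
      (∀ᵐ t ∂(volume.restrict (Ioi (0:ℝ))), Slice ν k m B u₀ (fun x => v x t) t) ∧
      ∀ (ψ ψ' : X → ℝ → ℝ) (A : Set X) (a T M Γ : ℝ), TestPair ν k ψ ψ' A a T M Γ →
        ∫ t in Ioi 0, ∫ x, v x t * ψ' x t ∂ν =
          ∫ t in Ioi 0, dform ν k (fun x => v x t ^ m) fun x => ψ x t := by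
  choose u he using fun n => (hs.ker n).exists_evol hm hu hu0 huB hB
  obtain ⟨φ, v, hφ, hv, hvB, hl⟩ := hs.exists_limit hi he hB
  have hs' := hs.comp hφ
  have he' := fun n => he (φ n)
  refine ⟨v, hv, hvB, ?_, fun ψ ψ' A a T M Γ hψ => hs'.weak_form hi he' hv hl hψ⟩
  filter_upwards [hl, ae_restrict_mem measurableSet_Ioi] with t ht ht0
  have hvt : Measurable fun x => v x t := hv.comp (measurable_id.prodMk measurable_const)
  have ht0' : 0 ≤ t := le_of_lt ht0
  exact ⟨hs'.integrable_limit hi he' ht0' hvt ht, hs'.integral_limit_eq hχ hi he' ht0' hvt ht,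
    fun p hp => hs'.integral_rpow_limit_le (p := p) (v := fun x => v x t) hi he' ht0' hvt ht hp,
    fun l hl0 => hs'.lintegral_truncated_limit_le hχ hi he' ht0 hvt ht hl0,
    fun ψ hψ M hM g hg hG ε hε =>
      hs'.abs_integral_limit_sub_le hχ hi he' ht0' hvt ht hψ hM hg hG hε⟩

end Existence

/-! ### Radial integrals -/

section Radial

variable {d : ℕ}

/-- The surface area of the unit sphere. -/
def sphereArea (d : ℕ) : ℝ := d * (volume : Measure (Ed d)).real (Metric.ball 0 1)

lemma sphereArea_nonneg : 0 ≤ sphereArea d := by unfold sphereArea; positivity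

lemma lintegral_norm_eq (hd : 0 < d) {g : ℝ → ℝ} (hg0 : ∀ r, 0 < r → 0 ≤ g r)
    (hg : IntegrableOn (fun y : ℝ => y ^ (d - 1) * g y) (Ioi 0)) :
    ∫⁻ x : Ed d, ENNReal.ofReal (g ‖x‖) =
      ENNReal.ofReal (sphereArea d * ∫ y in Ioi (0:ℝ), y ^ (d - 1) * g y) := by
  have : Nonempty (Fin d) := ⟨⟨0, hd⟩⟩
  have hfin : Module.finrank ℝ (Ed d) = d := by simp
  have h1 : Integrable (fun x : Ed d => g ‖x‖) := by
    rw [integrable_fun_norm_addHaar volume (f := g), hfin]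
    exact hg
  have h2 := integral_fun_norm_addHaar (volume : Measure (Ed d)) g
  rw [hfin] at h2
  have h3 : 0 ≤ᵐ[volume] fun x : Ed d => g ‖x‖ := by
    have : ∀ᵐ x : Ed d, x ≠ 0 := by
      rw [ae_iff]; simp
    filter_upwards [this] with x hx
    exact hg0 _ (norm_pos_iff.2 hx)
  rw [← ofReal_integral_eq_lintegral_ofReal h1 h3, h2]
  simp [sphereArea, mul_assoc]

lemma pow_mul_rpow_sub (hd : 0 < d) {y a : ℝ} (hy : 0 < y) :
    y ^ (d - 1) * y ^ (a - d) = y ^ (a - 1) := by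
  rw [← Real.rpow_natCast, ← Real.rpow_add hy, Nat.cast_pred hd]
  congr 1; ring

lemma lintegral_ball_rpow (hd : 0 < d) {a R : ℝ} (ha : 0 < a) (hR : 0 < R) :
    ∫⁻ x in Metric.ball (0 : Ed d) R, ENNReal.ofReal (‖x‖ ^ (a - d)) =
      ENNReal.ofReal (sphereArea d * (R ^ a / a)) := by
  have h0 : ∀ x : Ed d, (Metric.ball (0 : Ed d) R).indicator
      (fun x => ENNReal.ofReal (‖x‖ ^ (a - d))) x =
      ENNReal.ofReal ((Iio R).indicator (fun r => r ^ (a - d)) ‖x‖) := by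
    intro x
    by_cases hx : ‖x‖ < R <;> simp [indicator, hx]
  have h1 : ∀ y ∈ Ioi (0:ℝ), y ^ (d - 1) * (Iio R).indicator (fun r => r ^ (a - d)) y =
      (Iio R).indicator (fun y => y ^ (a - 1)) y := by
    intro y hy
    by_cases hyR : y < R
    · simp [indicator, hyR, pow_mul_rpow_sub hd hy]
    · simp [indicator, hyR]
  have h2 : Ioi (0:ℝ) ∩ Iio R = Ioo 0 R := rfl
  have h3 : IntegrableOn (fun y : ℝ => y ^ (a - 1)) (Ioo 0 R) := by
    rw [← integrableOn_Ioc_iff_integrableOn_Ioo,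
      ← intervalIntegrable_iff_integrableOn_Ioc_of_le hR.le]
    exact intervalIntegral.intervalIntegrable_rpow' (by linarith)
  rw [← lintegral_indicator measurableSet_ball]
  simp_rw [h0]
  rw [lintegral_norm_eq hd]
  · rw [setIntegral_congr_fun measurableSet_Ioi h1, setIntegral_indicator measurableSet_Iio, h2,
      ← integral_Ioc_eq_integral_Ioo, ← intervalIntegral.integral_of_le hR.le,
      integral_rpow (Or.inl (by linarith))]
    simp [Real.zero_rpow ha.ne']
  · intro r hr
    rw [indicator_apply]
    split_ifs
    exacts [Real.rpow_nonneg hr.le _, le_rfl]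
  · rw [integrableOn_congr_fun h1 measurableSet_Ioi, IntegrableOn,
      integrable_indicator_iff measurableSet_Iio, IntegrableOn, Measure.restrict_restrict
      measurableSet_Iio, inter_comm]
    exact h3

lemma lintegral_compl_ball_rpow (hd : 0 < d) {a R : ℝ} (ha : 0 < a) (hR : 0 < R) :
    ∫⁻ x in (Metric.closedBall (0 : Ed d) R)ᶜ, ENNReal.ofReal (‖x‖ ^ (-a - d)) =
      ENNReal.ofReal (sphereArea d * (R ^ (-a) / a)) := by
  have h0 : ∀ x : Ed d, (Metric.closedBall (0 : Ed d) R)ᶜ.indicator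
      (fun x => ENNReal.ofReal (‖x‖ ^ (-a - d))) x =
      ENNReal.ofReal ((Ioi R).indicator (fun r => r ^ (-a - d)) ‖x‖) := by
    intro x
    by_cases hx : R < ‖x‖
    · simp [indicator, hx]
    · simp [indicator, hx]
  have h1 : ∀ y ∈ Ioi (0:ℝ), y ^ (d - 1) * (Ioi R).indicator (fun r => r ^ (-a - d)) y =
      (Ioi R).indicator (fun y => y ^ (-a - 1)) y := by
    intro y hy
    by_cases hyR : R < y
    · simp [indicator, hyR, pow_mul_rpow_sub hd hy]
    · simp [indicator, hyR]
  have h2 : Ioi (0:ℝ) ∩ Ioi R = Ioi R := by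
    rw [Ioi_inter_Ioi, max_eq_right hR.le]
  have h3 : IntegrableOn (fun y : ℝ => y ^ (-a - 1)) (Ioi R) :=
    integrableOn_Ioi_rpow_of_lt (by linarith) hR
  rw [← lintegral_indicator measurableSet_closedBall.compl]
  simp_rw [h0]
  rw [lintegral_norm_eq hd]
  · rw [setIntegral_congr_fun measurableSet_Ioi h1, setIntegral_indicator measurableSet_Ioi, h2,
      integral_Ioi_rpow_of_lt (by linarith) hR]
    congr 2
    rw [sub_add_cancel, div_neg, neg_div, neg_neg]
  · intro r hr
    rw [indicator_apply]
    split_ifs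
    exacts [Real.rpow_nonneg hr.le _, le_rfl]
  · rw [integrableOn_congr_fun h1 measurableSet_Ioi, IntegrableOn,
      integrable_indicator_iff measurableSet_Ioi, IntegrableOn, Measure.restrict_restrict
      measurableSet_Ioi, inter_comm, h2]
    exact h3

end Radial

/-! ### The carré du champ of a Lipschitz bump -/

section Bump

variable {d : ℕ}

lemma lintegral_bump_le (hd : 0 < d) {s : ℝ} (hs0 : 0 < s) (hs1 : s < 1) {φ : Ed d → ℝ}
    {A R : ℝ} (hR : 0 < R) (hb : ∀ x, |φ x| ≤ A)
    (hl : ∀ x y, |φ x - φ y| ≤ A * ‖x - y‖ / R) (x : Ed d) :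
    ∫⁻ y, ENNReal.ofReal ((φ x - φ y) ^ 2 / ‖x - y‖ ^ ((d:ℝ) + 2 * s)) ≤
      ENNReal.ofReal (A ^ 2 * (sphereArea d * (4 / (2 - 2 * s) + 4 / (2 * s))) *
        R ^ (-(2 * s))) := by
  have hd' : (0:ℝ) < d := Nat.cast_pos.2 hd
  have ha := sphereArea_nonneg (d := d)
  set F : Ed d → ℝ≥0∞ := fun z =>
    (Metric.ball (0 : Ed d) (2 * R)).indicator
      (fun z => ENNReal.ofReal (A ^ 2 / R ^ 2) * ENNReal.ofReal (‖z‖ ^ ((2 - 2 * s) - d))) z +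
    (Metric.closedBall (0 : Ed d) R)ᶜ.indicator
      (fun z => ENNReal.ofReal (4 * A ^ 2) * ENNReal.ofReal (‖z‖ ^ (-(2 * s) - d))) z with hF
  have hpt : ∀ y, ENNReal.ofReal ((φ x - φ y) ^ 2 / ‖x - y‖ ^ ((d:ℝ) + 2 * s)) ≤ F (x - y) := by
    intro y
    by_cases hz0 : x - y = 0
    · rw [sub_eq_zero.1 hz0]; simp
    have hz : 0 < ‖x - y‖ := norm_pos_iff.2 hz0
    by_cases hzR : ‖x - y‖ < 2 * R
    · refine le_trans ?_ le_self_add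
      rw [indicator_of_mem (by simpa using hzR), ← ENNReal.ofReal_mul (by positivity)]
      refine ENNReal.ofReal_le_ofReal ?_
      rw [div_le_iff₀ (by positivity), mul_assoc, ← Real.rpow_add hz]
      have e : (2 - 2 * s - (d:ℝ) + (d + 2 * s)) = (2:ℕ) := by push_cast; ring
      rw [e, Real.rpow_natCast, ← sq_abs]
      calc |φ x - φ y| ^ 2 ≤ (A * ‖x - y‖ / R) ^ 2 := by gcongr; exact hl x y
        _ = _ := by ring
    · refine le_trans ?_ le_add_self
      have hzR' : R < ‖x - y‖ := by push Not at hzR; linarith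
      rw [indicator_of_mem (by simpa using hzR'), ← ENNReal.ofReal_mul (by positivity)]
      refine ENNReal.ofReal_le_ofReal ?_
      rw [div_le_iff₀ (by positivity), mul_assoc, ← Real.rpow_add hz]
      have e : (- (2 * s) - (d:ℝ) + (d + 2 * s)) = 0 := by ring
      rw [e, Real.rpow_zero]
      have h1 := abs_le.1 (hb x)
      have h2 := abs_le.1 (hb y)
      nlinarith
  calc _ ≤ ∫⁻ y, F (x - y) := lintegral_mono hpt
    _ = ∫⁻ z, F z := lintegral_sub_left_eq_self F x
    _ = ENNReal.ofReal (A ^ 2 / R ^ 2) *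
          ENNReal.ofReal (sphereArea d * ((2 * R) ^ (2 - 2 * s) / (2 - 2 * s))) +
        ENNReal.ofReal (4 * A ^ 2) *
          ENNReal.ofReal (sphereArea d * (R ^ (-(2 * s)) / (2 * s))) := by
      rw [hF, lintegral_add_left, lintegral_indicator measurableSet_ball,
        lintegral_indicator measurableSet_closedBall.compl, lintegral_const_mul,
        lintegral_const_mul, lintegral_ball_rpow hd (by linarith) (by linarith),
        lintegral_compl_ball_rpow hd (by linarith) hR]
      · fun_prop
      · fun_prop
      · refine Measurable.indicator ?_ measurableSet_ball
        fun_prop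
    _ ≤ _ := by
      rw [← ENNReal.ofReal_mul (by positivity), ← ENNReal.ofReal_mul (by positivity),
        ← ENNReal.ofReal_add]
      · refine ENNReal.ofReal_le_ofReal ?_
        have h4 : (2:ℝ) ^ (2 - 2 * s) ≤ 4 := by
          calc (2:ℝ) ^ (2 - 2 * s) ≤ 2 ^ (2:ℝ) :=
                Real.rpow_le_rpow_of_exponent_le (by norm_num) (by linarith)
            _ = 4 := by norm_num
        have hR2 : R ^ (2 - 2 * s) = R ^ 2 * R ^ (-(2 * s)) := by
          rw [← Real.rpow_natCast, ← Real.rpow_add hR]; congr 1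
        rw [Real.mul_rpow (by norm_num) hR.le, hR2]
        have hRs : 0 < R ^ (-(2 * s)) := Real.rpow_pos_of_pos hR _
        have h5 : A ^ 2 / R ^ 2 * (sphereArea d *
            (2 ^ (2 - 2 * s) * (R ^ 2 * R ^ (-(2 * s))) / (2 - 2 * s))) =
            A ^ 2 * sphereArea d * R ^ (-(2 * s)) / (2 - 2 * s) * 2 ^ (2 - 2 * s) := by
          field_simp
        have h6 : 0 ≤ A ^ 2 * sphereArea d * R ^ (-(2 * s)) / (2 - 2 * s) := by
          have : 0 < 2 - 2 * s := by linarith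
          positivity
        rw [h5]
        have h7 := mul_le_mul_of_nonneg_left h4 h6
        refine (add_le_add_left h7 _).trans (le_of_eq ?_)
        ring
      · have : 0 < 2 - 2 * s := by linarith
        positivity
      · positivity

lemma lintegral_bump_far_le {s : ℝ} (hs0 : 0 < s) {φ : Ed d → ℝ}
    {A R : ℝ} (hR : 0 < R) (hb : ∀ x, |φ x| ≤ A)
    (hz : ∀ x, R ≤ ‖x‖ → φ x = 0) {x : Ed d} (hx : 2 * R < ‖x‖) :
    ∫⁻ y, ENNReal.ofReal ((φ x - φ y) ^ 2 / ‖x - y‖ ^ ((d:ℝ) + 2 * s)) ≤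
      ENNReal.ofReal (A ^ 2 * (2 ^ ((d:ℝ) + 2 * s) *
        (volume : Measure (Ed d)).real (Metric.ball 0 1)) *
        (R ^ d * ‖x‖ ^ (-((d:ℝ) + 2 * s)))) := by
  have hxp : 0 < ‖x‖ := by linarith
  have : Nontrivial (Ed d) := ⟨x, 0, norm_pos_iff.1 hxp⟩
  have hpt : ∀ y, ENNReal.ofReal ((φ x - φ y) ^ 2 / ‖x - y‖ ^ ((d:ℝ) + 2 * s)) ≤
      (Metric.ball (0 : Ed d) R).indicator
        (fun _ => ENNReal.ofReal (A ^ 2 / (‖x‖ / 2) ^ ((d:ℝ) + 2 * s))) y := by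
    intro y
    rw [hz x (by linarith)]
    by_cases hy : ‖y‖ < R
    · rw [indicator_of_mem (by simpa using hy)]
      have h1 : ‖x‖ / 2 ≤ ‖x - y‖ := by
        have := norm_sub_norm_le x y
        linarith
      refine ENNReal.ofReal_le_ofReal ?_
      have h2 : (0 - φ y) ^ 2 ≤ A ^ 2 := by
        rw [zero_sub, neg_sq, ← sq_abs]
        have := hb y
        gcongr
      have h3 : (‖x‖ / 2) ^ ((d:ℝ) + 2 * s) ≤ ‖x - y‖ ^ ((d:ℝ) + 2 * s) := by
        gcongr
      gcongr
    · rw [hz y (by linarith)]; simp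
  refine (lintegral_mono hpt).trans ?_
  rw [lintegral_indicator measurableSet_ball, lintegral_const, Measure.restrict_apply_univ,
    Measure.addHaar_ball _ _ hR.le, ← ENNReal.ofReal_toReal measure_ball_lt_top.ne,
    ← ENNReal.ofReal_mul (by positivity), ← ENNReal.ofReal_mul (by positivity)]
  refine ENNReal.ofReal_le_ofReal (le_of_eq ?_)
  have hf : Module.finrank ℝ (Ed d) = d := by simp
  rw [hf, Real.div_rpow hxp.le (by norm_num), Real.rpow_neg hxp.le, Measure.real]
  field_simp

/-- The lower bound `ρ ≥ c max(1, |x|)^{-γ}`. -/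
lemma _root_.AdmissibleWeight.lower {ρ : Ed d → ℝ} {γ₀ γ c C : ℝ} (h : AdmissibleWeight d ρ γ₀ γ c C)
    (hd : 0 < d) (hγ₀ : 0 ≤ γ₀) : ∀ᵐ x, c * (max 1 ‖x‖) ^ (-γ) ≤ ρ x := by
  have : Nonempty (Fin d) := ⟨⟨0, hd⟩⟩
  obtain ⟨hc, _, _, _, h1, h2⟩ := h
  have h0 : ∀ᵐ x : Ed d, x ≠ 0 := by
    rw [ae_iff]; simp
  filter_upwards [h0, h1, h2] with x hx h1 h2
  rcases le_or_gt ‖x‖ 1 with hx1 | hx1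
  · refine le_trans ?_ (h1 hx1).1
    rw [max_eq_left hx1, Real.one_rpow]
    have : 1 ≤ ‖x‖ ^ (-γ₀) :=
      Real.one_le_rpow_of_pos_of_le_one_of_nonpos (norm_pos_iff.2 hx) hx1 (by linarith)
    nlinarith
  · rw [max_eq_right hx1.le]; exact (h2 hx1).1

/-- The upper bound `ρ ≤ C |x|^{-γ}`. -/
lemma _root_.AdmissibleWeight.upper {ρ : Ed d → ℝ} {γ₀ γ c C : ℝ} (h : AdmissibleWeight d ρ γ₀ γ c C)
    (hd : 0 < d) (hγ : γ₀ ≤ γ) : ∀ᵐ x, ρ x ≤ C * ‖x‖ ^ (-γ) := by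
  have : Nonempty (Fin d) := ⟨⟨0, hd⟩⟩
  obtain ⟨hc, hcC, _, _, h1, h2⟩ := h
  have h0 : ∀ᵐ x : Ed d, x ≠ 0 := by
    rw [ae_iff]; simp
  filter_upwards [h0, h1, h2] with x hx h1 h2
  rcases le_or_gt ‖x‖ 1 with hx1 | hx1
  · refine (h1 hx1).2.trans ?_
    have : ‖x‖ ^ (-γ₀) ≤ ‖x‖ ^ (-γ) :=
      Real.rpow_le_rpow_of_exponent_ge (norm_pos_iff.2 hx) hx1 (by linarith)
    have hC : 0 < C := hc.trans hcC
    gcongr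
  · exact (h2 hx1).2

lemma exists_bump_bound (hd : 0 < d) {s : ℝ} (hs0 : 0 < s) (hs1 : s < 1) {ρ : Ed d → ℝ}
    {γ₀ γ c C : ℝ} (h : AdmissibleWeight d ρ γ₀ γ c C) (hγ₀ : 0 ≤ γ₀) (hγ0 : 0 ≤ γ)
    (hγs : γ < 2 * s) :
    ∃ D, 0 < D ∧ ∀ (φ : Ed d → ℝ) (A R : ℝ), 0 ≤ A → 1 ≤ R → (∀ x, |φ x| ≤ A) →
      (∀ x y, |φ x - φ y| ≤ A * ‖x - y‖ / R) → (∀ x, R ≤ ‖x‖ → φ x = 0) →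
      ∀ᵐ x, ∫⁻ y, ENNReal.ofReal ((φ x - φ y) ^ 2 / ‖x - y‖ ^ ((d:ℝ) + 2 * s)) ≤
        ENNReal.ofReal (A ^ 2 * D * R ^ (γ - 2 * s) * ρ x) := by
  have hc : 0 < c := h.1
  set D₁ := sphereArea d * (4 / (2 - 2 * s) + 4 / (2 * s)) with hD₁
  set D₂ := 2 ^ ((d:ℝ) + 2 * s) * (volume : Measure (Ed d)).real (Metric.ball 0 1) with hD₂
  have hD₁0 : 0 ≤ D₁ := by
    have := sphereArea_nonneg (d := d)
    have : 0 < 2 - 2 * s := by linarith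
    positivity
  have hD₂0 : 0 ≤ D₂ := by positivity
  refine ⟨(1 + D₁ * 2 ^ γ + D₂) / c, by positivity, fun φ A R hA hR hb hl hz => ?_⟩
  have hR0 : 0 < R := by linarith
  filter_upwards [h.lower hd hγ₀] with x hx
  have hρ : 0 < ρ x := h.2.2.2.1 x
  have hRe : R ^ (-(2 * s)) = R ^ (γ - 2 * s) * R ^ (-γ) := by
    rw [← Real.rpow_add hR0]; congr 1; ring
  have hRp : 0 < R ^ (γ - 2 * s) := Real.rpow_pos_of_pos hR0 _
  rcases le_or_gt ‖x‖ (2 * R) with hxR | hxR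
  · refine (lintegral_bump_le hd hs0 hs1 hR0 hb hl x).trans (ENNReal.ofReal_le_ofReal ?_)
    rw [hRe, ← hD₁]
    have h1 : c * R ^ (-γ) ≤ 2 ^ γ * ρ x := by
      have h2 : (2 * R) ^ (-γ) ≤ (max 1 ‖x‖) ^ (-γ) :=
        Real.rpow_le_rpow_of_nonpos (by positivity) (max_le (by linarith) hxR) (by linarith)
      have h3 : R ^ (-γ) = 2 ^ γ * (2 * R) ^ (-γ) := by
        rw [Real.mul_rpow (by norm_num) hR0.le, ← mul_assoc, ← Real.rpow_add (by norm_num)]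
        simp
      rw [h3, mul_left_comm]
      have h4 : c * (2 * R) ^ (-γ) ≤ ρ x := le_trans (by gcongr) hx
      gcongr
    have h5 : R ^ (-γ) ≤ 2 ^ γ * ρ x / c := by
      rw [le_div_iff₀ hc]; linarith
    calc A ^ 2 * D₁ * (R ^ (γ - 2 * s) * R ^ (-γ))
        ≤ A ^ 2 * D₁ * (R ^ (γ - 2 * s) * (2 ^ γ * ρ x / c)) := by gcongr
      _ = A ^ 2 * ((D₁ * 2 ^ γ) / c) * R ^ (γ - 2 * s) * ρ x := by ring
      _ ≤ _ := by gcongr; linarith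
  · refine (lintegral_bump_far_le hs0 hR0 hb hz hxR).trans (ENNReal.ofReal_le_ofReal ?_)
    have hx0 : 0 < ‖x‖ := by linarith
    have hx1 : max 1 ‖x‖ = ‖x‖ := max_eq_right (by linarith)
    rw [hx1] at hx
    have h1 : R ^ d * ‖x‖ ^ (-((d:ℝ) + 2 * s)) ≤ R ^ (γ - 2 * s) * ‖x‖ ^ (-γ) := by
      have e1 : R ^ d = R ^ (γ - 2 * s) * R ^ ((d:ℝ) + 2 * s - γ) := by
        rw [← Real.rpow_natCast, ← Real.rpow_add hR0]; congr 1; ring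
      have e2 : ‖x‖ ^ (-γ) = ‖x‖ ^ ((d:ℝ) + 2 * s - γ) * ‖x‖ ^ (-((d:ℝ) + 2 * s)) := by
        rw [← Real.rpow_add hx0]; congr 1; ring
      rw [e1, e2, mul_assoc]
      have h2 : R ^ ((d:ℝ) + 2 * s - γ) ≤ ‖x‖ ^ ((d:ℝ) + 2 * s - γ) := by
        have : (0:ℝ) ≤ d := Nat.cast_nonneg d
        exact Real.rpow_le_rpow hR0.le (by linarith) (by linarith)
      gcongr
    have h5 : ‖x‖ ^ (-γ) ≤ ρ x / c := by
      rw [le_div_iff₀ hc]; linarith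
    calc A ^ 2 * D₂ * (R ^ d * ‖x‖ ^ (-((d:ℝ) + 2 * s)))
        ≤ A ^ 2 * D₂ * (R ^ (γ - 2 * s) * (ρ x / c)) := by
          refine mul_le_mul_of_nonneg_left (h1.trans ?_) (by positivity)
          gcongr
      _ = A ^ 2 * (D₂ / c) * R ^ (γ - 2 * s) * ρ x := by ring
      _ ≤ _ := by
          gcongr
          have : 0 ≤ D₁ * 2 ^ γ := by positivity
          linarith

end Bump

/-! ### The weighted measure and the weighted fractional kernel -/

section Kernel

variable {d : ℕ} {s κ : ℝ} {ρ : Ed d → ℝ}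

/-- The measure `ρ dx`. -/
def wmeas (ρ : Ed d → ℝ) : Measure (Ed d) := volume.withDensity fun x => ENNReal.ofReal (ρ x)

instance : SFinite (wmeas ρ) := by unfold wmeas; infer_instance

/-- The kernel of the weighted fractional Laplacian with respect to `ρ dx ⊗ ρ dy`. -/
def wker (d : ℕ) (s κ : ℝ) (ρ : Ed d → ℝ) (x y : Ed d) : ℝ :=
  κ / (ρ x * ρ y * ‖x - y‖ ^ ((d:ℝ) + 2 * s))

/-- The region on which the truncated kernels live. -/
def region (ρ : Ed d → ℝ) (n : ℕ) : Set (Ed d) :=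
  {x | ‖x‖ < n + 1 ∧ ρ x < n + 1 ∧ 1 / ((n:ℝ) + 1) < ρ x}

open Classical in
/-- Truncated kernels. -/
def tker (d : ℕ) (s κ : ℝ) (ρ : Ed d → ℝ) (n : ℕ) (x y : Ed d) : ℝ :=
  if x ∈ region ρ n ∧ y ∈ region ρ n ∧ 1 / ((n:ℝ) + 1) < ‖x - y‖ then wker d s κ ρ x y else 0

lemma measurable_wker (hρ : Measurable ρ) :
    Measurable fun p : Ed d × Ed d => wker d s κ ρ p.1 p.2 := by
  unfold wker
  fun_prop

lemma measurableSet_region (hρ : Measurable ρ) (n : ℕ) : MeasurableSet (region ρ n) := by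
  exact (measurableSet_lt measurable_norm measurable_const).inter
    ((measurableSet_lt hρ measurable_const).inter (measurableSet_lt measurable_const hρ))

lemma one_div_le_of_le {n j : ℕ} (h : n ≤ j) : 1 / ((j:ℝ) + 1) ≤ 1 / ((n:ℝ) + 1) := by
  have : (n:ℝ) ≤ j := Nat.cast_le.2 h
  gcongr

lemma region_mono {n j : ℕ} (h : n ≤ j) : region ρ n ⊆ region ρ j := by
  rintro x ⟨h1, h2, h3⟩
  have : (n:ℝ) ≤ j := Nat.cast_le.2 h
  exact ⟨by linarith, by linarith, (one_div_le_of_le h).trans_lt h3⟩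

lemma wmeas_region_lt_top (n : ℕ) : wmeas ρ (region ρ n) < ⊤ := by
  calc wmeas ρ (region ρ n) ≤ wmeas ρ (Metric.ball 0 (n + 1) ∩ {x | ρ x < n + 1}) := by
        refine measure_mono fun x hx => ⟨by simpa using hx.1, hx.2.1⟩
    _ ≤ ∫⁻ x in Metric.ball 0 (n + 1) ∩ {x | ρ x < n + 1}, ENNReal.ofReal (ρ x) := by
        rw [wmeas]; exact (withDensity_apply' _ _).le
    _ ≤ ∫⁻ x in Metric.ball 0 (n + 1) ∩ {x | ρ x < n + 1}, ENNReal.ofReal (n + 1) := by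
        refine setLIntegral_mono measurable_const fun x hx => ENNReal.ofReal_le_ofReal hx.2.le
    _ < ⊤ := by
        rw [setLIntegral_const]
        refine ENNReal.mul_lt_top ENNReal.ofReal_lt_top ((measure_mono inter_subset_left).trans_lt
          measure_ball_lt_top)

lemma wker_nonneg (hκ : 0 < κ) (hρ : ∀ x, 0 < ρ x) (x y : Ed d) : 0 ≤ wker d s κ ρ x y := by
  have := hρ x
  have := hρ y
  unfold wker; positivity

lemma tker_dich (n : ℕ) (x y : Ed d) :
    tker d s κ ρ n x y = 0 ∨ tker d s κ ρ n x y = wker d s κ ρ x y := by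
  unfold tker
  split_ifs
  · exact Or.inr rfl
  · exact Or.inl rfl

lemma kerSys (hd : 0 < d) (hs0 : 0 < s) (hκ : 0 < κ) (hρm : Measurable ρ) (hρ : ∀ x, 0 < ρ x) :
    KerSys (wmeas ρ) (wker d s κ ρ) (tker d s κ ρ) (region ρ)
      (fun n => κ * ((n:ℝ) + 1) ^ 2 * ((n:ℝ) + 1) ^ ((d:ℝ) + 2 * s)) where
  ker n :=
    { meas := by
        refine Measurable.ite ?_ (measurable_wker hρm) measurable_const
        exact (measurable_fst (measurableSet_region hρm n)).inter
          ((measurable_snd (measurableSet_region hρm n)).inter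
            (measurableSet_lt measurable_const (measurable_fst.sub measurable_snd).norm))
      nonneg := fun x y => by
        rcases tker_dich (s := s) (κ := κ) (ρ := ρ) n x y with h | h <;> rw [h]
        exact wker_nonneg hκ hρ x y
      symm := fun x y => by
        unfold tker wker
        rw [norm_sub_rev x y, mul_comm (ρ x) (ρ y)]
        congr 1
        exact propext ⟨fun h => ⟨h.2.1, h.1, h.2.2⟩, fun h => ⟨h.2.1, h.1, h.2.2⟩⟩
      le := fun x y => by
        unfold tker
        split_ifs with h
        swap; · positivity
        obtain ⟨⟨-, -, h1⟩, ⟨-, -, h2⟩, h3⟩ := h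
        have hn : (0:ℝ) < n + 1 := by positivity
        have hn' : (0:ℝ) < 1 / (n + 1) := by positivity
        have hq : (0:ℝ) < d + 2 * s := by positivity
        unfold wker
        have h4 := (hρ x).le
        have h5 := (hρ y).le
        calc κ / (ρ x * ρ y * ‖x - y‖ ^ ((d:ℝ) + 2 * s)) ≤
            κ / (1 / (n + 1) * (1 / (n + 1)) * (1 / (n + 1)) ^ ((d:ℝ) + 2 * s)) := by gcongr
          _ = _ := by
            rw [Real.div_rpow (by norm_num) hn.le, Real.one_rpow]
            field_simp
      supp := fun x y hx => by
        exact if_neg fun h => hx h.1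
      measS := measurableSet_region hρm n
      finS := (wmeas_region_lt_top n).ne }
  dich := tker_dich
  mono n j h x y := by
    unfold tker
    have h0 := wker_nonneg (d := d) (s := s) hκ hρ x y
    split_ifs with h1 h2
    · exact le_rfl
    · exact absurd ⟨region_mono h h1.1, region_mono h h1.2.1,
        (one_div_le_of_le h).trans_lt h1.2.2⟩ h2
    · exact h0
    · exact le_rfl
  lim x y := by
    by_cases hxy : x = y
    · refine ⟨0, ?_⟩
      have : (d:ℝ) + 2 * s ≠ 0 := by positivity
      rcases tker_dich (s := s) (κ := κ) (ρ := ρ) 0 x y with h | h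
      · rw [h]; simp [wker, hxy, Real.zero_rpow this]
      · exact h
    have hz : 0 < ‖x - y‖ := norm_pos_iff.2 (sub_ne_zero.2 hxy)
    have hev : ∀ a b : ℝ, 0 < b → ∀ᶠ n : ℕ in atTop, a < n + 1 ∧ 1 / ((n:ℝ) + 1) < b := by
      intro a b hb
      have h1 : ∀ᶠ n : ℕ in atTop, a < n := tendsto_natCast_atTop_atTop.eventually_gt_atTop a
      have h2 := tendsto_one_div_add_atTop_nhds_zero_nat (𝕜 := ℝ).eventually_lt_const hb
      filter_upwards [h1, h2] with n h1 h2
      exact ⟨by linarith, h2⟩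
    obtain ⟨n, ⟨⟨h1, h2⟩, h3⟩, ⟨h4, h5⟩, h6, -⟩ := (((hev ‖x‖ _ hz).and (hev (ρ x) _ (hρ x))).and
      ((hev (ρ y) _ (hρ y)).and (hev ‖y‖ _ hz))).exists
    refine ⟨n, ?_⟩
    exact if_pos ⟨⟨h1, h3⟩, ⟨h6, h4, h5⟩, h2⟩

end Kernel

section Weighted

variable {d : ℕ} {s κ : ℝ} {ρ : Ed d → ℝ}

/-! ### Integrals against the weighted measure -/

lemma lintegral_wmeas (hρ : Measurable ρ) (f : Ed d → ℝ≥0∞) :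
    ∫⁻ x, f x ∂wmeas ρ = ∫⁻ x, ENNReal.ofReal (ρ x) * f x := by
  rw [wmeas, lintegral_withDensity_eq_lintegral_mul_non_measurable _ hρ.ennreal_ofReal
    (ae_of_all _ fun _ => ENNReal.ofReal_lt_top)]
  rfl

lemma integral_wmeas (hρm : Measurable ρ) (hρ : ∀ x, 0 < ρ x) (f : Ed d → ℝ) :
    ∫ x, f x ∂wmeas ρ = ∫ x, f x * ρ x := by
  rw [wmeas, integral_withDensity_eq_integral_toReal_smul hρm.ennreal_ofReal
    (ae_of_all _ fun _ => ENNReal.ofReal_lt_top)]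
  refine integral_congr_ae (ae_of_all _ fun x => ?_)
  simp [ENNReal.toReal_ofReal (hρ x).le, mul_comm]

lemma integrable_wmeas_iff (hρm : Measurable ρ) (hρ : ∀ x, 0 < ρ x) (f : Ed d → ℝ) :
    Integrable f (wmeas ρ) ↔ Integrable fun x => f x * ρ x := by
  rw [wmeas, integrable_withDensity_iff_integrable_smul' hρm.ennreal_ofReal
    (ae_of_all _ fun _ => ENNReal.ofReal_lt_top)]
  refine integrable_congr (ae_of_all _ fun x => ?_)
  simp [ENNReal.toReal_ofReal (hρ x).le, mul_comm]

lemma ae_wmeas_iff (hρm : Measurable ρ) (hρ : ∀ x, 0 < ρ x) {P : Ed d → Prop} :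
    (∀ᵐ x ∂wmeas ρ, P x) ↔ ∀ᵐ x, P x := by
  rw [wmeas, ae_withDensity_iff hρm.ennreal_ofReal]
  simp [hρ]

lemma prod_wmeas (hρm : Measurable ρ) :
    (wmeas ρ).prod (wmeas ρ) = (volume : Measure (Ed d × Ed d)).withDensity
      fun p => ENNReal.ofReal (ρ p.1) * ENNReal.ofReal (ρ p.2) := by
  rw [wmeas, prod_withDensity hρm.ennreal_ofReal hρm.ennreal_ofReal]
  rfl

lemma ofReal_mul_wker (hρ : ∀ x, 0 < ρ x) (hκ : 0 < κ) (x y : Ed d) (a : ℝ) :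
    ENNReal.ofReal (ρ y) * ENNReal.ofReal (wker d s κ ρ x y * a) =
      ENNReal.ofReal (κ / ρ x) * ENNReal.ofReal (a / ‖x - y‖ ^ ((d:ℝ) + 2 * s)) := by
  have h1 := hρ x
  have h2 := hρ y
  rw [← ENNReal.ofReal_mul h2.le, ← ENNReal.ofReal_mul (by positivity)]
  congr 1
  unfold wker
  field_simp

lemma lintegral_wker (hρm : Measurable ρ) (hρ : ∀ x, 0 < ρ x) (hκ : 0 < κ) (f : Ed d → ℝ)
    (x : Ed d) :
    ∫⁻ y, ENNReal.ofReal (wker d s κ ρ x y * (f x - f y) ^ 2) ∂wmeas ρ =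
      ENNReal.ofReal (κ / ρ x) *
        ∫⁻ y, ENNReal.ofReal ((f x - f y) ^ 2 / ‖x - y‖ ^ ((d:ℝ) + 2 * s)) := by
  rw [lintegral_wmeas hρm, ← lintegral_const_mul' _ _ ENNReal.ofReal_ne_top]
  exact lintegral_congr fun y => ofReal_mul_wker hρ hκ x y _

lemma lintegral_prod_wker (hρm : Measurable ρ) (hρ : ∀ x, 0 < ρ x) (hκ : 0 < κ) (f : Ed d → ℝ) :
    ∫⁻ p, ENNReal.ofReal (wker d s κ ρ p.1 p.2 * (f p.1 - f p.2) ^ 2)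
        ∂((wmeas ρ).prod (wmeas ρ)) =
      ENNReal.ofReal κ * ∫⁻ p : Ed d × Ed d,
        ENNReal.ofReal ((f p.1 - f p.2) ^ 2 / ‖p.1 - p.2‖ ^ ((d:ℝ) + 2 * s)) := by
  rw [prod_wmeas hρm, lintegral_withDensity_eq_lintegral_mul_non_measurable _ (by fun_prop)
    (ae_of_all _ fun _ => ENNReal.mul_lt_top ENNReal.ofReal_lt_top ENNReal.ofReal_lt_top),
    ← lintegral_const_mul' _ _ ENNReal.ofReal_ne_top]
  refine lintegral_congr fun p => ?_
  rw [Pi.mul_apply, mul_assoc, ofReal_mul_wker hρ hκ _ _ _, ← mul_assoc,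
    ← ENNReal.ofReal_mul (hρ _).le, mul_div_cancel₀ _ (hρ _).ne']

lemma dform_wker (hρm : Measurable ρ) (hρ : ∀ x, 0 < ρ x) (f g : Ed d → ℝ) :
    dform (wmeas ρ) (wker d s κ ρ) f g = gagliardoE d s κ f g := by
  rw [dform, gagliardoE, prod_wmeas hρm, integral_withDensity_eq_integral_toReal_smul
    (by fun_prop) (ae_of_all _ fun _ => ENNReal.mul_lt_top ENNReal.ofReal_lt_top
    ENNReal.ofReal_lt_top), div_eq_inv_mul, mul_assoc, ← integral_const_mul κ]
  congr 1
  refine integral_congr_ae (ae_of_all _ fun p => ?_)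
  have h1 := hρ p.1
  have h2 := hρ p.2
  simp only [ENNReal.toReal_mul, ENNReal.toReal_ofReal h1.le, ENNReal.toReal_ofReal h2.le,
    smul_eq_mul, wker]
  field_simp

lemma lintegral_prod_wker_eq_gagliardoSq (hρm : Measurable ρ) (hρ : ∀ x, 0 < ρ x) (hκ : 0 < κ)
    (f : Ed d → ℝ) :
    ∫⁻ p, ENNReal.ofReal (wker d s κ ρ p.1 p.2 * (f p.1 - f p.2) ^ 2)
        ∂((wmeas ρ).prod (wmeas ρ)) = 2 * gagliardoSq d s κ f := by
  rw [lintegral_prod_wker hρm hρ hκ, gagliardoSq, ← mul_assoc]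
  congr 1
  rw [show (2:ℝ≥0∞) = ENNReal.ofReal 2 by simp, ← ENNReal.ofReal_mul (by norm_num)]
  congr 1; ring

variable {γ₀ γ c C : ℝ}

lemma wmeas_ball_lt_top (h : AdmissibleWeight d ρ γ₀ γ c C) (hd : 0 < d) (hγ : γ₀ ≤ γ)
    (hγd : γ < d) (R : ℝ) : wmeas ρ (Metric.ball 0 R) < ⊤ := by
  have h1 : wmeas ρ (Metric.ball 0 R) ≤ wmeas ρ (Metric.ball 0 (max R 1)) :=
    measure_mono (Metric.ball_subset_ball (le_max_left _ _))
  refine h1.trans_lt ?_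
  have hC : 0 < C := h.1.trans h.2.1
  rw [wmeas, withDensity_apply _ measurableSet_ball]
  calc ∫⁻ x in Metric.ball 0 (max R 1), ENNReal.ofReal (ρ x)
      ≤ ∫⁻ x in Metric.ball (0 : Ed d) (max R 1),
          ENNReal.ofReal C * ENNReal.ofReal (‖x‖ ^ ((d - γ) - d)) := by
        refine lintegral_mono_ae (ae_restrict_of_ae ?_)
        filter_upwards [h.upper hd hγ] with x hx
        rw [← ENNReal.ofReal_mul hC.le]
        refine ENNReal.ofReal_le_ofReal (hx.trans_eq ?_)
        congr 2; ring
    _ < ⊤ := by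
        rw [lintegral_const_mul' _ _ ENNReal.ofReal_ne_top, lintegral_ball_rpow hd (by linarith)
          (by positivity)]
        exact ENNReal.mul_lt_top ENNReal.ofReal_lt_top ENNReal.ofReal_lt_top

/-! ### Cut-off functions -/

lemma exists_bump_gamma (hd : 0 < d) (hs0 : 0 < s) (hs1 : s < 1) (hκ : 0 < κ)
    (h : AdmissibleWeight d ρ γ₀ γ c C) (hγ₀ : 0 ≤ γ₀) (hγ0 : 0 ≤ γ) (hγs : γ < 2 * s) :
    ∃ D, 0 < D ∧ ∀ (φ : Ed d → ℝ) (A R : ℝ), 0 ≤ A → 1 ≤ R → (∀ x, |φ x| ≤ A) →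
      (∀ x y, |φ x - φ y| ≤ A * ‖x - y‖ / R) → (∀ x, R ≤ ‖x‖ → φ x = 0) →
      ∀ᵐ x ∂wmeas ρ, ∫⁻ y, ENNReal.ofReal (wker d s κ ρ x y * (φ x - φ y) ^ 2) ∂wmeas ρ ≤
        ENNReal.ofReal (A ^ 2 * D * R ^ (γ - 2 * s)) := by
  obtain ⟨D, hD, hb⟩ := exists_bump_bound hd hs0 hs1 h hγ₀ hγ0 hγs
  have hρm := h.2.2.1
  have hρ := h.2.2.2.1
  refine ⟨κ * D, by positivity, fun φ A R hA hR h1 h2 h3 => ?_⟩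
  rw [ae_wmeas_iff hρm hρ]
  filter_upwards [hb φ A R hA hR h1 h2 h3] with x hx
  have hρx := hρ x
  rw [lintegral_wker hρm hρ hκ]
  calc _ ≤ ENNReal.ofReal (κ / ρ x) * ENNReal.ofReal (A ^ 2 * D * R ^ (γ - 2 * s) * ρ x) := by
        gcongr
    _ = _ := by
        rw [← ENNReal.ofReal_mul (by positivity)]
        congr 1; field_simp

/-- The tent function of radius `R`. -/
def tent (R : ℝ) (x : Ed d) : ℝ := max 0 (1 - ‖x‖ / R)

lemma tent_nonneg (R : ℝ) (x : Ed d) : 0 ≤ tent R x := le_max_left _ _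

lemma tent_le_one {R : ℝ} (hR : 0 < R) (x : Ed d) : tent R x ≤ 1 :=
  max_le zero_le_one (by have : 0 ≤ ‖x‖ / R := by positivity
                         linarith)

lemma tent_eq_zero {R : ℝ} (hR : 0 < R) {x : Ed d} (hx : R ≤ ‖x‖) : tent R x = 0 :=
  max_eq_left (by have := (one_le_div hR).2 hx
                  linarith)

lemma continuous_tent (R : ℝ) : Continuous (tent (d := d) R) := by
  unfold tent; fun_prop

lemma abs_tent_sub_le {R : ℝ} (hR : 0 < R) (x y : Ed d) :
    |tent R x - tent R y| ≤ ‖x - y‖ / R := by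
  refine (abs_max_sub_max_le_max _ _ _ _).trans ?_
  rw [sub_self, abs_zero, max_eq_right (abs_nonneg _),
    show 1 - ‖x‖ / R - (1 - ‖y‖ / R) = (‖y‖ - ‖x‖) / R by ring, abs_div, abs_of_pos hR,
    norm_sub_rev]
  gcongr
  exact abs_norm_sub_norm_le y x

lemma tendsto_tent (x : Ed d) {R : ℕ → ℝ} (hR : Tendsto R atTop atTop) :
    Tendsto (fun j => tent (R j) x) atTop (𝓝 1) := by
  have h : Tendsto (fun j => max 0 (1 - ‖x‖ / R j)) atTop (𝓝 (max 0 (1 - 0))) :=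
    tendsto_const_nhds.max (tendsto_const_nhds.sub (hR.const_div_atTop _))
  rwa [sub_zero, max_eq_right zero_le_one] at h

lemma exists_cutoffs (hd : 0 < d) (hs0 : 0 < s) (hs1 : s < 1) (hκ : 0 < κ)
    (h : AdmissibleWeight d ρ γ₀ γ c C) (hγ₀ : 0 ≤ γ₀) (hγ₀γ : γ₀ ≤ γ) (hγs : γ < 2 * s)
    (hγd : γ < d) :
    ∃ G, Cutoffs (wmeas ρ) (wker d s κ ρ) (fun j => tent ((j:ℝ) + 1)) G := by
  obtain ⟨D, hD, hb⟩ := exists_bump_gamma hd hs0 hs1 hκ h hγ₀ (hγ₀.trans hγ₀γ) hγs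
  have hR0 : ∀ j : ℕ, (0:ℝ) < j + 1 := fun j => by positivity
  have hR1 : ∀ j : ℕ, (1:ℝ) ≤ j + 1 := fun j => by simp
  have hRt : Tendsto (fun j : ℕ => (j:ℝ) + 1) atTop atTop :=
    tendsto_atTop_add_const_right _ _ tendsto_natCast_atTop_atTop
  refine ⟨fun j => 1 ^ 2 * D * ((j:ℝ) + 1) ^ (γ - 2 * s), ?_⟩
  refine ⟨fun j => (continuous_tent _).measurable, fun j => tent_nonneg _,
    fun j => tent_le_one (hR0 j), fun x => tendsto_tent x hRt, fun j => ?_, fun j => ?_, ?_, ?_⟩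
  · have h1 : IntegrableOn (fun _ => (1:ℝ)) (Metric.ball (0 : Ed d) (j + 1)) (wmeas ρ) :=
      integrableOn_const (wmeas_ball_lt_top h hd hγ₀γ hγd _).ne
    refine (h1.integrable_indicator measurableSet_ball).mono'
      (continuous_tent _).aestronglyMeasurable (ae_of_all _ fun x => ?_)
    rw [Real.norm_of_nonneg (tent_nonneg _ _)]
    by_cases hx : ‖x‖ < j + 1
    · rw [indicator_of_mem (by simpa using hx)]; exact tent_le_one (hR0 j) x
    · rw [tent_eq_zero (hR0 j) (not_lt.1 hx)]; exact indicator_nonneg (fun _ _ => zero_le_one) _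
  · have := hR0 j
    positivity
  · have h1 : Tendsto (fun j : ℕ => ((j:ℝ) + 1) ^ (-(2 * s - γ))) atTop (𝓝 0) :=
      (tendsto_rpow_neg_atTop (by linarith)).comp hRt
    simpa only [mul_zero, neg_sub] using h1.const_mul (1 ^ 2 * D)
  · intro j
    refine hb _ 1 _ zero_le_one (hR1 j) (fun x => ?_) (fun x y => ?_) fun x hx =>
      tent_eq_zero (hR0 j) hx
    · rw [abs_of_nonneg (tent_nonneg _ _)]; exact tent_le_one (hR0 j) x
    · rw [one_mul]; exact abs_tent_sub_le (hR0 j) x y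

end Weighted

section TestFunctions

variable {d : ℕ} {s κ : ℝ} {ρ : Ed d → ℝ} {γ₀ γ c C : ℝ}

lemma wker_symm (x y : Ed d) : wker d s κ ρ x y = wker d s κ ρ y x := by
  unfold wker
  rw [norm_sub_rev, mul_comm (ρ x)]

lemma lintegral_prod_le_of_gamma_le {X : Type*} [MeasurableSpace X] {ν : Measure X} [SFinite ν]
    {k : X → X → ℝ} (hk : Measurable (Function.uncurry k)) (hsymm : ∀ x y, k x y = k y x)
    {φ : X → ℝ} (hφ : Measurable φ) {A : Set X} (hA : MeasurableSet A) (hz : ∀ x, x ∉ A → φ x = 0)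
    {g : ℝ}
    (hg : ∀ᵐ x ∂ν, ∫⁻ y, ENNReal.ofReal (k x y * (φ x - φ y) ^ 2) ∂ν ≤ ENNReal.ofReal g) :
    ∫⁻ p, ENNReal.ofReal (k p.1 p.2 * (φ p.1 - φ p.2) ^ 2) ∂(ν.prod ν) ≤
      2 * (ENNReal.ofReal g * ν A) := by
  set F : X × X → ℝ≥0∞ := fun p => ENNReal.ofReal (k p.1 p.2 * (φ p.1 - φ p.2) ^ 2) with hF
  have hFm : Measurable F := by
    have : Measurable fun p : X × X => k p.1 p.2 := hk
    fun_prop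
  have hFs : ∀ x y, F (x, y) = F (y, x) := fun x y => by
    simp only [hF]; rw [hsymm]; congr 2; ring
  have hA1 : MeasurableSet {p : X × X | p.1 ∈ A} := measurable_fst hA
  have hA2 : MeasurableSet {p : X × X | p.2 ∈ A} := measurable_snd hA
  have h1 : ∫⁻ p, {p : X × X | p.1 ∈ A}.indicator F p ∂(ν.prod ν) ≤ ENNReal.ofReal g * ν A := by
    rw [lintegral_prod _ (hFm.indicator hA1).aemeasurable]
    calc _ ≤ ∫⁻ x, A.indicator (fun _ => ENNReal.ofReal g) x ∂ν := by
          refine lintegral_mono_ae ?_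
          filter_upwards [hg] with x hx
          by_cases hxA : x ∈ A
          · rw [indicator_of_mem hxA]
            refine le_trans (lintegral_mono fun y => ?_) hx
            exact indicator_le_self _ F (x, y)
          · rw [indicator_of_notMem hxA, nonpos_iff_eq_zero]
            refine (lintegral_congr fun y => ?_).trans lintegral_zero
            exact indicator_of_notMem (s := {p : X × X | p.1 ∈ A}) (a := (x, y)) hxA F
      _ = _ := by rw [lintegral_indicator hA, setLIntegral_const]
  have h2 : ∫⁻ p, {p : X × X | p.2 ∈ A}.indicator F p ∂(ν.prod ν) =
      ∫⁻ p, {p : X × X | p.1 ∈ A}.indicator F p ∂(ν.prod ν) := by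
    rw [← lintegral_prod_swap]
    refine lintegral_congr fun p => ?_
    by_cases hp : p.1 ∈ A
    · rw [indicator_of_mem (s := {p : X × X | p.1 ∈ A}) hp,
        indicator_of_mem (s := {p : X × X | p.2 ∈ A}) (a := p.swap) hp]
      exact (hFs _ _).symm
    · rw [indicator_of_notMem (s := {p : X × X | p.1 ∈ A}) hp,
        indicator_of_notMem (s := {p : X × X | p.2 ∈ A}) (a := p.swap) hp]
  calc _ ≤ ∫⁻ p, ({p : X × X | p.1 ∈ A}.indicator F p + {p : X × X | p.2 ∈ A}.indicator F p)
          ∂(ν.prod ν) := by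
        refine lintegral_mono fun p => ?_
        by_cases hp1 : p.1 ∈ A
        · rw [indicator_of_mem (s := {p : X × X | p.1 ∈ A}) hp1]; exact le_self_add
        by_cases hp2 : p.2 ∈ A
        · rw [indicator_of_mem (s := {p : X × X | p.2 ∈ A}) hp2]; exact le_add_self
        · simp [hz _ hp1, hz _ hp2]
    _ ≤ _ := by
        rw [lintegral_add_left (hFm.indicator hA1), h2, two_mul]
        gcongr

lemma exists_testPair (hd : 0 < d) (hs0 : 0 < s) (hs1 : s < 1) (hκ : 0 < κ)
    (h : AdmissibleWeight d ρ γ₀ γ c C) (hγ₀ : 0 ≤ γ₀) (hγ₀γ : γ₀ ≤ γ) (hγs : γ < 2 * s)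
    (hγd : γ < d) {φ : Ed d × ℝ → ℝ} (hφ : IsTestFn d φ) :
    ∃ A a T M Γ, TestPair (wmeas ρ) (wker d s κ ρ) (fun x t => φ (x, t))
      (fun x t => deriv (fun τ => φ (x, τ)) t) A a T M Γ := by
  obtain ⟨hsm, hcs, hsub⟩ := hφ
  obtain ⟨D, hD, hb⟩ := exists_bump_gamma hd hs0 hs1 hκ h hγ₀ (hγ₀.trans hγ₀γ) hγs
  have hdiff : Differentiable ℝ φ := hsm.differentiable (by simp)
  have hφc : Continuous φ := hsm.continuous
  set D' : Ed d × ℝ → ℝ := fun p => fderiv ℝ φ p (0, 1) with hD'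
  have hder : ∀ x t, HasDerivAt (fun τ => φ (x, τ)) (D' (x, t)) t := fun x t =>
    (hdiff (x, t)).hasFDerivAt.comp_hasDerivAt t ((hasDerivAt_const t x).prodMk (hasDerivAt_id t))
  have hder' : (fun (x : Ed d) (t : ℝ) => deriv (fun τ => φ (x, τ)) t) = fun x t => D' (x, t) := by
    funext x t; exact (hder x t).deriv
  have hDc : Continuous D' := (hsm.continuous_fderiv (by simp)).clm_apply continuous_const
  have hfz : ∀ p, p ∉ tsupport φ → D' p = 0 := by
    intro p hp
    have h1 := (notMem_tsupport_iff_eventuallyEq.1 hp).fderiv_eq (𝕜 := ℝ)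
    simp only [hD', h1]
    simp
  obtain ⟨R, hR1, hR⟩ : ∃ R, 1 ≤ R ∧ ∀ p ∈ tsupport φ, ‖p‖ < R := by
    obtain ⟨r, hr⟩ := hcs.isBounded.exists_norm_le
    refine ⟨max (r + 1) 1, le_max_right _ _, fun p hp => ?_⟩
    have := hr p hp
    have := le_max_left (r + 1) 1
    linarith
  obtain ⟨a, ha0, ha⟩ : ∃ a, 0 < a ∧ ∀ p ∈ tsupport φ, a < p.2 := by
    rcases (tsupport φ).eq_empty_or_nonempty with he | hne
    · exact ⟨1, one_pos, fun p hp => by simp [he] at hp⟩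
    · obtain ⟨q, hq, hmin⟩ := hcs.exists_isMinOn hne continuous_snd.continuousOn
      have hq0 : 0 < q.2 := (hsub hq).2
      refine ⟨q.2 / 2, by positivity, fun p hp => ?_⟩
      have : q.2 ≤ p.2 := hmin hp
      linarith
  obtain ⟨M₁, hM₁⟩ := hcs.exists_bound_of_continuous hφc
  have hDcs : HasCompactSupport D' := hcs.mono' fun p hp => by
    by_contra hp'
    exact hp (hfz p hp')
  obtain ⟨M₂, hM₂⟩ := hDcs.exists_bound_of_continuous hDc
  obtain ⟨L, hL⟩ := hsm.lipschitzWith_of_hasCompactSupport hcs (by simp)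
  have hR0 : 0 < R := by linarith
  have hout : ∀ x t, x ∉ Metric.ball (0 : Ed d) R ∨ t ≤ a ∨ max R (a + 1) ≤ t →
      (x, t) ∉ tsupport φ := by
    rintro x t hxt hmem
    have h1 := hR _ hmem
    have h2 := ha _ hmem
    have h3 : ‖x‖ ≤ ‖(x, t)‖ := norm_fst_le (x, t)
    have h4 : ‖t‖ ≤ ‖(x, t)‖ := norm_snd_le (x, t)
    rcases hxt with hx | ht | ht
    · exact hx (by simpa using h3.trans_lt h1)
    · exact absurd ht (not_le.2 h2)
    · have := le_max_left R (a + 1)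
      have := le_abs_self t
      rw [Real.norm_eq_abs] at h4
      linarith
  set A := max M₁ (L * R) with hA
  have hA0 : 0 ≤ A := le_max_of_le_right (by positivity)
  rw [hder']
  refine ⟨Metric.ball 0 R, a, max R (a + 1), max M₁ M₂,
    (2 * (ENNReal.ofReal (A ^ 2 * D * R ^ (γ - 2 * s)) * wmeas ρ (Metric.ball 0 R))).toReal,
    ?_⟩
  have hfin := (wmeas_ball_lt_top h hd hγ₀γ hγd R).ne
  refine ⟨hφc.measurable, hDc.measurable, hder, fun x => by fun_prop,
    fun x t => (hM₁ _).trans (le_max_left _ _), fun x t => (hM₂ _).trans (le_max_right _ _),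
    fun x t hxt => image_eq_zero_of_notMem_tsupport (hout x t hxt),
    fun x t hxt => hfz _ (hout x t hxt), measurableSet_ball, hfin, ha0, ?_, fun t => ?_⟩
  · exact (lt_add_one a).trans_le (le_max_right _ _)
  have hz : ∀ x, x ∉ Metric.ball (0 : Ed d) R → φ (x, t) = 0 := fun x hx =>
    image_eq_zero_of_notMem_tsupport (hout x t (Or.inl hx))
  rw [ENNReal.ofReal_toReal (ENNReal.mul_ne_top (by simp)
    (ENNReal.mul_ne_top ENNReal.ofReal_ne_top hfin))]
  refine lintegral_prod_le_of_gamma_le (φ := fun x => φ (x, t)) (measurable_wker h.2.2.1) wker_symm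
    (by fun_prop) measurableSet_ball hz (hb (fun x => φ (x, t)) A R hA0 hR1
      (fun x => (hM₁ _).trans (le_max_left _ _)) (fun x y => ?_) fun x hx => hz x (by simpa using hx))
  have h1 := hL.dist_le_mul (x, t) (y, t)
  rw [Real.dist_eq, Prod.dist_eq, dist_self, max_eq_left dist_nonneg, dist_eq_norm] at h1
  refine h1.trans ?_
  rw [le_div_iff₀ hR0]
  have h2 : L * R ≤ A := le_max_right _ _
  have h3 : 0 ≤ ‖x - y‖ := norm_nonneg _
  nlinarith

end TestFunctions

/-! ### The initial trace -/

section Trace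

variable {X : Type*} [MeasurableSpace X] {ν : Measure X}
  {k : X → X → ℝ} {m B : ℝ} {u₀ : X → ℝ} {χ : ℕ → X → ℝ} {G : ℕ → ℝ} {v : X → ℝ → ℝ} {T : Set ℝ}

lemma tendsto_integral_of_slices (hT : T ⊆ Ioi 0)
    (h : ∀ t ∈ T, Slice ν k m B u₀ (fun x => v x t) t)
    {φ : X → ℝ} (hφ : Measurable φ) {M : ℝ} (hM : ∀ x, |φ x| ≤ M) {g : ℝ} (hg0 : 0 ≤ g)
    (hg : ∀ᵐ x ∂ν, ∫⁻ y, ENNReal.ofReal (k x y * (φ x - φ y) ^ 2) ∂ν ≤ ENNReal.ofReal g) :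
    Tendsto (fun t => ∫ x, v x t * φ x ∂ν) (𝓝[T] 0) (𝓝 (∫ x, u₀ x * φ x ∂ν)) := by
  rw [tendsto_iff_norm_sub_tendsto_zero]
  have hlim : Tendsto (fun t : ℝ => (√t * (B ^ (m - 1) / (m - 1)) + √t * g) / 2 *
      ∫ x, u₀ x ∂ν) (𝓝[T] 0) (𝓝 0) := by
    have hc : Continuous fun t : ℝ => (√t * (B ^ (m - 1) / (m - 1)) + √t * g) / 2 *
      ∫ x, u₀ x ∂ν := by fun_prop
    have := (hc.tendsto 0).mono_left (nhdsWithin_le_nhds (s := T))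
    simpa using this
  refine squeeze_zero' (Eventually.of_forall fun _ => norm_nonneg _) ?_ hlim
  filter_upwards [self_mem_nhdsWithin] with t ht
  have ht0 : 0 < t := hT ht
  refine ((h t ht).trace φ hφ M hM g hg0 hg √t (Real.sqrt_pos.2 ht0)).trans_eq ?_
  have e : t * g / √t = √t * g := by
    rw [mul_div_right_comm, Real.div_sqrt]
  rw [e]

lemma tendsto_integral_of_slices_of_cutoffs (hχ : Cutoffs ν k χ G) (hT : T ⊆ Ioi 0)
    (h : ∀ t ∈ T, Slice ν k m B u₀ (fun x => v x t) t) (hv : ∀ x t, 0 ≤ v x t)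
    (hu : Integrable u₀ ν) (hu0 : ∀ x, 0 ≤ u₀ x)
    {φ : X → ℝ} (hφ : Measurable φ) {M : ℝ} (hM : ∀ x, |φ x| ≤ M)
    (hg : ∀ j, ∃ g, 0 ≤ g ∧ ∀ᵐ x ∂ν,
      ∫⁻ y, ENNReal.ofReal (k x y * (φ x * χ j x - φ y * χ j y) ^ 2) ∂ν ≤ ENNReal.ofReal g) :
    Tendsto (fun t => ∫ x, v x t * φ x ∂ν) (𝓝[T] 0) (𝓝 (∫ x, u₀ x * φ x ∂ν)) := by
  rcases isEmpty_or_nonempty X with hX | ⟨⟨x₀⟩⟩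
  · simp only [integral_of_isEmpty]
    exact tendsto_const_nhds
  have hM0 : 0 ≤ M := (abs_nonneg _).trans (hM x₀)
  -- the error of truncating an admissible density
  have herr : ∀ w : X → ℝ, Integrable w ν → (∀ x, 0 ≤ w x) → ∀ j,
      |∫ x, w x * φ x ∂ν - ∫ x, w x * (φ x * χ j x) ∂ν| ≤
        M * (∫ x, w x ∂ν - ∫ x, w x * χ j x ∂ν) := by
    intro w hw hw0 j
    have i1 : Integrable (fun x => w x * φ x) ν :=
      hw.mul_bdd (c := M) hφ.aestronglyMeasurable (ae_of_all _ hM)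
    have i2 : Integrable (fun x => w x * χ j x) ν :=
      hw.mul_bdd (c := 1) (hχ.meas j).aestronglyMeasurable (ae_of_all _ (hχ.abs_le j))
    have i3 : Integrable (fun x => w x * (φ x * χ j x)) ν := by
      refine hw.mul_bdd (c := M) (hφ.mul (hχ.meas j)).aestronglyMeasurable (ae_of_all _ fun x => ?_)
      rw [norm_mul]
      calc |φ x| * |χ j x| ≤ M * 1 := by gcongr; exacts [hM x, hχ.abs_le j x]
        _ = M := mul_one M
    rw [← integral_sub i1 i3, ← integral_sub hw i2, ← integral_const_mul]
    refine abs_integral_le_integral_abs.trans (integral_mono (i1.sub i3).abs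
      ((hw.sub i2).const_mul M) fun x => ?_)
    have h1 : w x * φ x - w x * (φ x * χ j x) = w x * (1 - χ j x) * φ x := by ring
    have h2 : 0 ≤ w x * (1 - χ j x) := mul_nonneg (hw0 x) (by linarith [hχ.le_one j x])
    change |w x * φ x - w x * (φ x * χ j x)| ≤ M * (w x - w x * χ j x)
    rw [h1, abs_mul, abs_of_nonneg h2]
    calc w x * (1 - χ j x) * |φ x| ≤ w x * (1 - χ j x) * M := by gcongr; exact hM x
      _ = _ := by ring
  have hdct : Tendsto (fun j => M * (∫ x, u₀ x ∂ν - ∫ x, u₀ x * χ j x ∂ν)) atTop (𝓝 0) := by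
    have h1 : Tendsto (fun j => ∫ x, u₀ x * χ j x ∂ν) atTop (𝓝 (∫ x, u₀ x * 1 ∂ν)) := by
      refine tendsto_integral_of_dominated_convergence u₀
        (fun j => (hu.aestronglyMeasurable.mul (hχ.meas j).aestronglyMeasurable)) hu
        (fun j => ae_of_all _ fun x => ?_) (ae_of_all _ fun x => (hχ.lim x).const_mul _)
      rw [Real.norm_of_nonneg (mul_nonneg (hu0 x) (hχ.nonneg j x))]
      exact mul_le_of_le_one_right (hu0 x) (hχ.le_one j x)
    simp only [mul_one] at h1
    simpa using ((tendsto_const_nhds (x := ∫ x, u₀ x ∂ν)).sub h1).const_mul M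
  rw [Metric.tendsto_nhds]
  intro ε hε
  obtain ⟨j, hj⟩ := (hdct.eventually_lt_const (show 0 < ε / 4 by positivity)).exists
  obtain ⟨g, hg0, hgj⟩ := hg j
  have t1 := tendsto_integral_of_slices (φ := fun x => φ x * χ j x) hT h (hφ.mul (hχ.meas j))
    (M := M * 1) (fun x => by
      rw [abs_mul]; gcongr; exacts [hM x, hχ.abs_le j x]) hg0 hgj
  have t2 := tendsto_integral_of_slices (φ := χ j) hT h (hχ.meas j) (hχ.abs_le j)
    (hχ.pos j).le (hχ.gamma j)
  have t3 : Tendsto (fun t => M * (∫ x, u₀ x ∂ν - ∫ x, v x t * χ j x ∂ν)) (𝓝[T] 0)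
      (𝓝 (M * (∫ x, u₀ x ∂ν - ∫ x, u₀ x * χ j x ∂ν))) :=
    (tendsto_const_nhds.sub t2).const_mul M
  filter_upwards [self_mem_nhdsWithin, Metric.tendsto_nhds.1 t1 (ε / 4) (by positivity),
    t3.eventually_lt_const hj] with t ht h1 h2
  have e1 := herr u₀ hu hu0 j
  have e2 := herr (fun x => v x t) (h t ht).integrable (fun x => hv x t) j
  rw [(h t ht).integral_eq] at e2
  rw [Real.dist_eq] at h1 ⊢
  rw [abs_le] at e1 e2
  rw [abs_lt] at h1 ⊢
  constructor <;> linarith [e1.1, e1.2, e2.1, e2.2, h1.1, h1.2]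

/-- Convergence against bounded Lipschitz functions upgrades to bounded continuous functions, for
densities of constant mass. -/
lemma tendsto_integral_of_lipschitz {Y : Type*} [PseudoEMetricSpace Y] [MeasurableSpace Y]
    [OpensMeasurableSpace Y] {ν : Measure Y} {l : Filter ℝ} [l.IsCountablyGenerated]
    {w : ℝ → Y → ℝ} {w₀ : Y → ℝ} (hw : ∀ t, Measurable (w t)) (hw₀ : Measurable w₀)
    (hw0 : ∀ t x, 0 ≤ w t x) (hw₀0 : ∀ x, 0 ≤ w₀ x) (hi : ∀ t, Integrable (w t) ν)
    (hi₀ : Integrable w₀ ν) (heq : ∀ t, ∫ x, w t x ∂ν = ∫ x, w₀ x ∂ν)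
    (hlip : ∀ f : Y → ℝ, (∃ M, ∀ x, |f x| ≤ M) → (∃ L, LipschitzWith L f) →
      Tendsto (fun t => ∫ x, w t x * f x ∂ν) l (𝓝 (∫ x, w₀ x * f x ∂ν)))
    {φ : Y → ℝ} (hφ : Continuous φ) (hφb : ∃ M, ∀ x, |φ x| ≤ M) :
    Tendsto (fun t => ∫ x, w t x * φ x ∂ν) l (𝓝 (∫ x, w₀ x * φ x ∂ν)) := by
  set I := ∫ x, w₀ x ∂ν with hI
  have hI0 : 0 ≤ I := integral_nonneg hw₀0
  rcases hI0.eq_or_lt with hI0 | hI0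
  · have hz : ∀ f : Y → ℝ, (∀ x, 0 ≤ f x) → Integrable f ν → ∫ x, f x ∂ν = 0 →
        ∫ x, f x * φ x ∂ν = 0 := by
      intro f hf hfi hf0
      refine integral_eq_zero_of_ae ?_
      filter_upwards [(integral_eq_zero_iff_of_nonneg hf hfi).1 hf0] with x hx
      simp [hx]
    rw [hz w₀ hw₀0 hi₀ hI0.symm]
    refine tendsto_const_nhds.congr fun t => (hz (w t) (hw0 t) (hi t) ?_).symm
    rw [heq, ← hI0]
  have hprob : ∀ f : Y → ℝ, Measurable f → (∀ x, 0 ≤ f x) → Integrable f ν → ∫ x, f x ∂ν = I →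
      IsProbabilityMeasure (ν.withDensity fun x => ENNReal.ofReal (f x / I)) := by
    intro f hfm hf hfi hfI
    refine ⟨?_⟩
    rw [withDensity_apply _ MeasurableSet.univ, Measure.restrict_univ,
      ← ofReal_integral_eq_lintegral_ofReal (hfi.div_const I)
        (ae_of_all _ fun x => div_nonneg (hf x) hI0.le), integral_div, hfI, div_self hI0.ne',
      ENNReal.ofReal_one]
  have hintg : ∀ f : Y → ℝ, Measurable f → (∀ x, 0 ≤ f x) → ∀ ψ : Y → ℝ,
      ∫ x, ψ x ∂(ν.withDensity fun x => ENNReal.ofReal (f x / I)) =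
        (∫ x, f x * ψ x ∂ν) / I := by
    intro f hfm hf ψ
    rw [integral_withDensity_eq_integral_toReal_smul (by fun_prop)
      (ae_of_all _ fun _ => ENNReal.ofReal_lt_top), ← integral_div]
    refine integral_congr_ae (ae_of_all _ fun x => ?_)
    simp only [ENNReal.toReal_ofReal (div_nonneg (hf x) hI0.le), smul_eq_mul]
    ring
  let P : ℝ → ProbabilityMeasure Y := fun t => ⟨_, hprob (w t) (hw t) (hw0 t) (hi t) (heq t)⟩
  let P₀ : ProbabilityMeasure Y := ⟨_, hprob w₀ hw₀ hw₀0 hi₀ rfl⟩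
  have hP : Tendsto P l (𝓝 P₀) := by
    rw [tendsto_iff_forall_lipschitz_integral_tendsto]
    rintro f ⟨M, hM⟩ hL
    have hfb : ∃ M, ∀ x, |f x| ≤ M := by
      rcases isEmpty_or_nonempty Y with hY | ⟨⟨y⟩⟩
      · exact ⟨0, fun x => isEmptyElim x⟩
      · refine ⟨M + |f y|, fun x => ?_⟩
        have h1 := hM x y
        rw [Real.dist_eq] at h1
        have h2 := abs_add_le (f x - f y) (f y)
        rw [sub_add_cancel] at h2
        linarith
    have := (hlip f hfb hL).div_const I
    refine (this.congr fun t => (hintg (w t) (hw t) (hw0 t) f).symm).trans_eq ?_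
    exact congrArg 𝓝 (hintg w₀ hw₀ hw₀0 f).symm
  obtain ⟨M, hM⟩ := hφb
  have h1 := (ProbabilityMeasure.tendsto_iff_forall_integral_tendsto.1 hP)
    (BoundedContinuousFunction.ofNormedAddCommGroup φ hφ M hM)
  have h2 : Tendsto (fun t => (∫ x, w t x * φ x ∂ν) / I) l (𝓝 ((∫ x, w₀ x * φ x ∂ν) / I)) := by
    rw [← hintg w₀ hw₀ hw₀0 φ]
    exact h1.congr fun t => hintg (w t) (hw t) (hw0 t) φ
  have h3 := h2.mul_const I
  simpa only [div_mul_cancel₀ _ hI0.ne'] using h3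

end Trace

section TraceEd

variable {d : ℕ} {s κ : ℝ} {ρ : Ed d → ℝ} {γ₀ γ c C : ℝ} {m B : ℝ} {u₀ : Ed d → ℝ}
  {v : Ed d → ℝ → ℝ} {T : Set ℝ}

lemma tendsto_integral_of_slices_of_lipschitz (hd : 0 < d) (hs0 : 0 < s) (hs1 : s < 1) (hκ : 0 < κ)
    (ha : AdmissibleWeight d ρ γ₀ γ c C) (hγ₀ : 0 ≤ γ₀) (hγ₀γ : γ₀ ≤ γ) (hγs : γ < 2 * s)
    (hγd : γ < d) (hT : T ⊆ Ioi 0)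
    (h : ∀ t ∈ T, Slice (wmeas ρ) (wker d s κ ρ) m B u₀ (fun x => v x t) t)
    (hv : ∀ x t, 0 ≤ v x t) (hu : Integrable u₀ (wmeas ρ)) (hu0 : ∀ x, 0 ≤ u₀ x)
    {φ : Ed d → ℝ} (hφb : ∃ M, ∀ x, |φ x| ≤ M) (hφ : ∃ L, LipschitzWith L φ) :
    Tendsto (fun t => ∫ x, v x t * φ x ∂wmeas ρ) (𝓝[T] 0) (𝓝 (∫ x, u₀ x * φ x ∂wmeas ρ)) := by
  obtain ⟨M, hM⟩ := hφb
  obtain ⟨L, hL⟩ := hφ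
  have hM0 : 0 ≤ M := (abs_nonneg _).trans (hM 0)
  obtain ⟨G, hG⟩ := exists_cutoffs hd hs0 hs1 hκ ha hγ₀ hγ₀γ hγs hγd
  obtain ⟨D, hD, hb⟩ := exists_bump_gamma hd hs0 hs1 hκ ha hγ₀ (hγ₀.trans hγ₀γ) hγs
  refine tendsto_integral_of_slices_of_cutoffs hG hT h hv hu hu0 hL.continuous.measurable hM
    fun j => ?_
  have hR0 : (0:ℝ) < j + 1 := by positivity
  refine ⟨_, ?_, hb (fun x => φ x * tent ((j:ℝ) + 1) x) (L * (j + 1) + M) (j + 1) (by positivity)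
    (by simp) (fun x => ?_) (fun x y => ?_) fun x hx => ?_⟩
  · positivity
  · rw [abs_mul]
    have h1 := hG.abs_le j x
    calc |φ x| * |tent ((j:ℝ) + 1) x| ≤ M * 1 := by gcongr; exact hM x
      _ ≤ _ := by have : 0 ≤ (L:ℝ) * (j + 1) := by positivity
                  linarith
  · have h1 := hL.dist_le_mul x y
    rw [Real.dist_eq, dist_eq_norm] at h1
    have h2 := abs_tent_sub_le hR0 x y
    have h3 := hG.abs_le j x
    calc |φ x * tent ((j:ℝ) + 1) x - φ y * tent ((j:ℝ) + 1) y|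
        = |(φ x - φ y) * tent ((j:ℝ) + 1) x + φ y * (tent ((j:ℝ) + 1) x - tent ((j:ℝ) + 1) y)| := by
          congr 1; ring
      _ ≤ |φ x - φ y| * |tent ((j:ℝ) + 1) x| +
          |φ y| * |tent ((j:ℝ) + 1) x - tent ((j:ℝ) + 1) y| := by
          rw [← abs_mul, ← abs_mul]; exact abs_add_le _ _
      _ ≤ (L * ‖x - y‖) * 1 + M * (‖x - y‖ / (j + 1)) := by
          gcongr; exact hM y
      _ = _ := by field_simp
  · rw [tent_eq_zero hR0 hx, mul_zero]

end TraceEd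

/-! ### The fractional Sobolev inequality -/

section Sobolev

variable {d : ℕ} {s : ℝ}

/-- The fractional Sobolev exponent. -/
def sobExp (d : ℕ) (s : ℝ) : ℝ := 2 * d / (d - 2 * s)

/-- A constant in the fractional Sobolev inequality. -/
def sobConst (d : ℕ) (s : ℝ) : ℝ :=
  (volume : Measure (Ed d)).real (Metric.ball 0 1) / 8 *
    (2 ^ (sobExp d s + 1) / (volume : Measure (Ed d)).real (Metric.ball 0 1)) ^ (-(2 * s / d))

lemma unitBall_pos : 0 < (volume : Measure (Ed d)).real (Metric.ball 0 1) :=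
  ENNReal.toReal_pos (Metric.measure_ball_pos _ _ one_pos).ne' measure_ball_lt_top.ne

lemma sobConst_pos : 0 < sobConst d s := by
  have := unitBall_pos (d := d)
  unfold sobConst; positivity

lemma sobolev_pointwise (hs0 : 0 < s) (hd : 2 * s < d) {f : Ed d → ℝ} (hf : Measurable f)
    (hf0 : ∀ x, 0 ≤ f x) {P : ℝ} (hP : 0 < P)
    (hfP : ∫⁻ x, ENNReal.ofReal (f x ^ sobExp d s) = ENNReal.ofReal P) (x : Ed d) :
    ENNReal.ofReal (sobConst d s * P ^ (-(2 * s / d)) * f x ^ sobExp d s) ≤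
      ∫⁻ y, ENNReal.ofReal ((f x - f y) ^ 2 / ‖x - y‖ ^ ((d:ℝ) + 2 * s)) := by
  have hd0 : (0:ℝ) < d := by linarith
  have hdn : 0 < d := Nat.cast_pos.1 hd0
  have hd2 : (0:ℝ) < d - 2 * s := by linarith
  have : Nonempty (Fin d) := ⟨⟨0, hdn⟩⟩
  set b := sobExp d s with hb
  have hb0 : 0 < b := by rw [hb, sobExp]; positivity
  set ω := (volume : Measure (Ed d)).real (Metric.ball 0 1) with hω
  have hω0 : 0 < ω := unitBall_pos
  rcases (hf0 x).eq_or_lt with ha | ha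
  · rw [← ha, Real.zero_rpow hb0.ne']; simp
  set a := f x with hadef
  set Q := P * (2 / a) ^ b with hQ
  have hQ0 : 0 < Q := by positivity
  set r := (2 * Q / ω) ^ ((1:ℝ) / d) with hr
  have hr0 : 0 < r := by positivity
  have hrd : r ^ d * ω = 2 * Q := by
    rw [hr, ← Real.rpow_natCast, ← Real.rpow_mul (by positivity), one_div,
      inv_mul_cancel₀ hd0.ne', Real.rpow_one]
    field_simp
  have hvol : volume (Metric.ball x r) = ENNReal.ofReal (2 * Q) := by
    have hfr : Module.finrank ℝ (Ed d) = d := by simp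
    rw [Measure.addHaar_ball _ _ hr0.le, hfr,
      ← ENNReal.ofReal_toReal (measure_ball_lt_top (μ := volume) (x := (0 : Ed d)) (r := 1)).ne,
      ← ENNReal.ofReal_mul (by positivity)]
    congr 1
  set U := {y | a / 2 < f y} with hU
  have hUm : MeasurableSet U := measurableSet_lt measurable_const hf
  have hUvol : volume U ≤ ENNReal.ofReal Q := by
    have h1 : U ⊆ {y | ENNReal.ofReal ((a / 2) ^ b) ≤ ENNReal.ofReal (f y ^ b)} := by
      intro y hy
      refine ENNReal.ofReal_le_ofReal ?_
      have hy' : a / 2 ≤ f y := le_of_lt hy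
      gcongr
    have h2 : ENNReal.ofReal ((a / 2) ^ b) ≠ 0 := (ENNReal.ofReal_pos.2 (by positivity)).ne'
    refine (measure_mono h1).trans ((meas_ge_le_lintegral_div (by fun_prop) h2
      ENNReal.ofReal_ne_top).trans_eq ?_)
    rw [hfP, ← ENNReal.ofReal_div_of_pos (by positivity), hQ, div_eq_mul_inv,
      ← Real.inv_rpow (by positivity), inv_div]
  set S := Metric.ball x r \ U with hS
  have hSm : MeasurableSet S := measurableSet_ball.diff hUm
  have hSvol : ENNReal.ofReal Q ≤ volume S := by
    refine le_trans ?_ le_measure_sdiff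
    rw [hvol, show 2 * Q = Q + Q by ring, ENNReal.ofReal_add hQ0.le hQ0.le]
    refine ENNReal.le_sub_of_add_le_left ?_ (by gcongr)
    exact (hUvol.trans_lt ENNReal.ofReal_lt_top).ne
  have key : sobConst d s * P ^ (-(2 * s / d)) * a ^ b =
      a ^ 2 / 4 / r ^ ((d:ℝ) + 2 * s) * Q := by
    have e1 : r ^ ((d:ℝ) + 2 * s) = (2 * Q / ω) * (2 * Q / ω) ^ (2 * s / d) := by
      rw [hr, ← Real.rpow_mul (by positivity), ← Real.rpow_one_add' (by positivity)
        (by positivity)]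
      congr 1; field_simp
    have e2 : 2 * Q / ω = 2 ^ (b + 1) / ω * P * a ^ (-b) := by
      rw [hQ, Real.div_rpow (by norm_num) ha.le, Real.rpow_add_one (by norm_num),
        Real.rpow_neg ha.le]
      field_simp
    have e3 : (2 * Q / ω) ^ (2 * s / d) =
        (2 ^ (b + 1) / ω) ^ (2 * s / d) * P ^ (2 * s / d) * a ^ (2 - b) := by
      rw [e2, Real.mul_rpow (by positivity) (by positivity),
        Real.mul_rpow (by positivity) hP.le, ← Real.rpow_mul ha.le]
      congr 2
      rw [hb, sobExp]
      field_simp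
      ring
    have e4 : a ^ b * a ^ (2 - b) = a ^ 2 := by
      rw [← Real.rpow_add ha, ← Real.rpow_natCast]; congr 1; push_cast; ring
    rw [e1, e3, sobConst, ← hω, ← hb, Real.rpow_neg (by positivity), Real.rpow_neg hP.le]
    have h1 : (2 ^ (b + 1) / ω : ℝ) ^ (2 * s / d) ≠ 0 := by positivity
    have h2 : P ^ (2 * s / d) ≠ 0 := by positivity
    have h3 : a ^ (2 - b) ≠ 0 := by positivity
    generalize (2 ^ (b + 1) / ω : ℝ) ^ (2 * s / d) = X at *
    generalize P ^ (2 * s / d) = Y at *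
    rw [← e4]
    field_simp
    norm_num
  rw [key, ENNReal.ofReal_mul (by positivity)]
  calc _ ≤ ENNReal.ofReal (a ^ 2 / 4 / r ^ ((d:ℝ) + 2 * s)) * volume S := by gcongr
    _ = ∫⁻ y in S, ENNReal.ofReal (a ^ 2 / 4 / r ^ ((d:ℝ) + 2 * s)) := by
        rw [setLIntegral_const]
    _ ≤ ∫⁻ y in S, ENNReal.ofReal ((a - f y) ^ 2 / ‖x - y‖ ^ ((d:ℝ) + 2 * s)) := by
        refine setLIntegral_mono (by fun_prop) fun y hy => ENNReal.ofReal_le_ofReal ?_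
        have h1 : ‖x - y‖ < r := by
          have := hy.1
          rwa [Metric.mem_ball', dist_eq_norm] at this
        have h2 : f y ≤ a / 2 := not_lt.1 hy.2
        have h3 : 0 < ‖x - y‖ := by
          refine norm_pos_iff.2 (sub_ne_zero.2 ?_)
          rintro rfl
          linarith
        have h4 : a ^ 2 / 4 ≤ (a - f y) ^ 2 := by nlinarith
        gcongr
    _ ≤ _ := setLIntegral_le_lintegral _ _

lemma sobolev_of_finite (hs0 : 0 < s) (hd : 2 * s < d) {f : Ed d → ℝ} (hf : Measurable f)
    (hf0 : ∀ x, 0 ≤ f x) (hfin : ∫⁻ x, ENNReal.ofReal (f x ^ sobExp d s) ≠ ⊤) :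
    ENNReal.ofReal (sobConst d s) *
        (∫⁻ x, ENNReal.ofReal (f x ^ sobExp d s)) ^ (1 - 2 * s / d) ≤
      ∫⁻ p : Ed d × Ed d,
        ENNReal.ofReal ((f p.1 - f p.2) ^ 2 / ‖p.1 - p.2‖ ^ ((d:ℝ) + 2 * s)) := by
  have hd0 : (0:ℝ) < d := by linarith
  have hθ : 0 < 1 - 2 * s / d := by
    rw [sub_pos, div_lt_one hd0]; exact hd
  set I := ∫⁻ x, ENNReal.ofReal (f x ^ sobExp d s) with hI
  obtain ⟨P, hP0, hP⟩ : ∃ P : ℝ, 0 ≤ P ∧ I = ENNReal.ofReal P :=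
    ⟨I.toReal, ENNReal.toReal_nonneg, (ENNReal.ofReal_toReal hfin).symm⟩
  rcases hP0.eq_or_lt with rfl | hP0
  · rw [hP, ENNReal.ofReal_zero, ENNReal.zero_rpow_of_pos hθ, mul_zero]; exact zero_le
  have hc := sobConst_pos (d := d) (s := s)
  rw [Measure.volume_eq_prod, lintegral_prod _ (by fun_prop)]
  refine le_trans (le_of_eq ?_) (lintegral_mono (sobolev_pointwise hs0 hd hf hf0 hP0 hP))
  have h1 : ∀ x, ENNReal.ofReal (sobConst d s * P ^ (-(2 * s / d)) * f x ^ sobExp d s) =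
      ENNReal.ofReal (sobConst d s * P ^ (-(2 * s / d))) * ENNReal.ofReal (f x ^ sobExp d s) :=
    fun x => ENNReal.ofReal_mul (by positivity)
  simp_rw [h1]
  rw [lintegral_const_mul' _ _ ENNReal.ofReal_ne_top, ← hI, hP, ENNReal.ofReal_rpow_of_pos hP0,
    ← ENNReal.ofReal_mul hc.le, ← ENNReal.ofReal_mul (by positivity), mul_assoc]
  congr 2
  rw [← Real.rpow_add_one hP0.ne']
  congr 1; ring

variable {ρ : Ed d → ℝ} {γ₀ γ c C : ℝ}

lemma tent_mono {R R' : ℝ} (hR : 0 < R) (h : R ≤ R') (x : Ed d) : tent R x ≤ tent R' x := by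
  unfold tent
  gcongr

/-- The Sobolev inequality for bounded functions that are square integrable against the weight. -/
lemma sobolev (hs0 : 0 < s) (hs1 : s < 1) (hd : 2 * s < d) (h : AdmissibleWeight d ρ γ₀ γ c C)
    (hγ₀ : 0 ≤ γ₀) (hγ0 : 0 ≤ γ) (hγs : γ < 2 * s) {f : Ed d → ℝ} (hf : Measurable f)
    (hf0 : ∀ x, 0 ≤ f x) {B : ℝ} (hfB : ∀ x, f x ≤ B)
    (hi : ∫⁻ x, ENNReal.ofReal (f x ^ 2 * ρ x) ≠ ⊤) :
    ENNReal.ofReal (sobConst d s) *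
        (∫⁻ x, ENNReal.ofReal (f x ^ sobExp d s)) ^ (1 - 2 * s / d) ≤
      2 * ∫⁻ p : Ed d × Ed d,
        ENNReal.ofReal ((f p.1 - f p.2) ^ 2 / ‖p.1 - p.2‖ ^ ((d:ℝ) + 2 * s)) := by
  have hd0 : (0:ℝ) < d := by linarith
  have hdn : 0 < d := Nat.cast_pos.1 hd0
  have hd2 : (0:ℝ) < d - 2 * s := by linarith
  set b := sobExp d s with hb
  have hb0 : 0 < b := by rw [hb, sobExp]; positivity
  set E := ∫⁻ p : Ed d × Ed d,
    ENNReal.ofReal ((f p.1 - f p.2) ^ 2 / ‖p.1 - p.2‖ ^ ((d:ℝ) + 2 * s)) with hE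
  set J := ∫⁻ x, ENNReal.ofReal (f x ^ 2 * ρ x) with hJ
  obtain ⟨D, hD, hbump⟩ := exists_bump_bound hdn hs0 hs1 h hγ₀ hγ0 hγs
  have hR0 : ∀ j : ℕ, (0:ℝ) < j + 1 := fun j => by positivity
  have hRt : Tendsto (fun j : ℕ => (j:ℝ) + 1) atTop atTop :=
    tendsto_atTop_add_const_right _ _ tendsto_natCast_atTop_atTop
  have hB0 : 0 ≤ B := (hf0 0).trans (hfB 0)
  set F : ℕ → Ed d → ℝ := fun j x => f x * tent ((j:ℝ) + 1) x with hF
  have hFm : ∀ j, Measurable (F j) := fun j => hf.mul (continuous_tent _).measurable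
  have hF0 : ∀ j x, 0 ≤ F j x := fun j x => mul_nonneg (hf0 x) (tent_nonneg _ _)
  have hfinj : ∀ j, ∫⁻ x, ENNReal.ofReal (F j x ^ b) ≠ ⊤ := by
    intro j
    refine ne_top_of_le_ne_top (b := ∫⁻ x, (Metric.ball (0 : Ed d) (j + 1)).indicator
      (fun _ => ENNReal.ofReal (B ^ b)) x) ?_ (lintegral_mono fun x => ?_)
    · rw [lintegral_indicator measurableSet_ball, setLIntegral_const]
      exact ENNReal.mul_ne_top ENNReal.ofReal_ne_top measure_ball_lt_top.ne
    · by_cases hx : ‖x‖ < j + 1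
      · rw [indicator_of_mem (by simpa using hx)]
        refine ENNReal.ofReal_le_ofReal (Real.rpow_le_rpow (hF0 j x) ?_ hb0.le)
        calc f x * tent ((j:ℝ) + 1) x ≤ B * 1 :=
              mul_le_mul (hfB x) (tent_le_one (hR0 j) x) (tent_nonneg _ _) hB0
          _ = B := mul_one B
      · have : F j x = 0 := by simp only [hF]; rw [tent_eq_zero (hR0 j) (not_lt.1 hx), mul_zero]
        rw [this, Real.zero_rpow hb0.ne']; simp
  have hbound : ∀ j, ENNReal.ofReal (sobConst d s) *
      (∫⁻ x, ENNReal.ofReal (F j x ^ b)) ^ (1 - 2 * s / d) ≤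
      2 * E + ENNReal.ofReal (2 * (1 ^ 2 * D * ((j:ℝ) + 1) ^ (γ - 2 * s))) * J := by
    intro j
    refine (sobolev_of_finite hs0 hd (hFm j) (hF0 j) (hfinj j)).trans ?_
    set χ : Ed d → ℝ := tent ((j:ℝ) + 1) with hχ
    have hχm : Measurable χ := (continuous_tent _).measurable
    have hpt : ∀ p : Ed d × Ed d,
        ENNReal.ofReal ((F j p.1 - F j p.2) ^ 2 / ‖p.1 - p.2‖ ^ ((d:ℝ) + 2 * s)) ≤
        2 * ENNReal.ofReal ((f p.1 - f p.2) ^ 2 / ‖p.1 - p.2‖ ^ ((d:ℝ) + 2 * s)) +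
        ENNReal.ofReal (2 * f p.1 ^ 2) *
          ENNReal.ofReal ((χ p.1 - χ p.2) ^ 2 / ‖p.1 - p.2‖ ^ ((d:ℝ) + 2 * s)) := by
      intro p
      have h0 : ∀ X, (2:ℝ≥0∞) * ENNReal.ofReal X = ENNReal.ofReal (2 * X) := fun X => by
        rw [ENNReal.ofReal_mul (by norm_num)]; simp
      rw [h0, ← ENNReal.ofReal_mul (by positivity), ← ENNReal.ofReal_add (by positivity)
        (by positivity)]
      refine ENNReal.ofReal_le_ofReal ?_
      rw [mul_div_assoc', mul_div_assoc', ← add_div]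
      have h1 : 0 ≤ χ p.2 := tent_nonneg _ _
      have h2 : χ p.2 ≤ 1 := tent_le_one (hR0 j) _
      have h3 : χ p.2 ^ 2 ≤ 1 := by nlinarith
      gcongr
      simp only [hF]
      nlinarith [sq_nonneg (χ p.2 * (f p.1 - f p.2) - f p.1 * (χ p.1 - χ p.2)),
        mul_nonneg (sq_nonneg (f p.1 - f p.2)) (sub_nonneg.2 h3)]
    calc _ ≤ ∫⁻ p : Ed d × Ed d, _ := lintegral_mono hpt
      _ = 2 * E + ∫⁻ x, ENNReal.ofReal (2 * f x ^ 2) *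
          ∫⁻ y, ENNReal.ofReal ((χ x - χ y) ^ 2 / ‖x - y‖ ^ ((d:ℝ) + 2 * s)) := by
        rw [lintegral_add_left (by fun_prop), lintegral_const_mul' _ _ (by simp), ← hE]
        congr 1
        rw [Measure.volume_eq_prod, lintegral_prod _ (by fun_prop)]
        refine lintegral_congr fun x => ?_
        dsimp only
        rw [lintegral_const_mul' _ _ ENNReal.ofReal_ne_top]
      _ ≤ 2 * E + ∫⁻ x, ENNReal.ofReal (2 * (1 ^ 2 * D * ((j:ℝ) + 1) ^ (γ - 2 * s))) *
            ENNReal.ofReal (f x ^ 2 * ρ x) := by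
        gcongr 2 * E + ?_
        refine lintegral_mono_ae ?_
        filter_upwards [hbump χ 1 (j + 1) zero_le_one (by simp)
          (fun x => by rw [abs_of_nonneg (tent_nonneg _ _)]; exact tent_le_one (hR0 j) x)
          (fun x y => by rw [one_mul]; exact abs_tent_sub_le (hR0 j) x y)
          (fun x hx => tent_eq_zero (hR0 j) hx)] with x hx
        refine (mul_le_mul_right hx _).trans (le_of_eq ?_)
        have := hR0 j
        rw [← ENNReal.ofReal_mul (by positivity), ← ENNReal.ofReal_mul (by positivity)]
        congr 1; ring
      _ = _ := by rw [lintegral_const_mul' _ _ ENNReal.ofReal_ne_top]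
  have hlim1 : Tendsto (fun j => ∫⁻ x, ENNReal.ofReal (F j x ^ b)) atTop
      (𝓝 (∫⁻ x, ENNReal.ofReal (f x ^ b))) := by
    refine lintegral_tendsto_of_tendsto_of_monotone (fun j => by fun_prop)
      (ae_of_all _ fun x i j hij => ?_) (ae_of_all _ fun x => ?_)
    · refine ENNReal.ofReal_le_ofReal (Real.rpow_le_rpow (hF0 _ x) ?_ hb0.le)
      refine mul_le_mul_of_nonneg_left (tent_mono (hR0 i) ?_ x) (hf0 x)
      have : (i:ℝ) ≤ j := Nat.cast_le.2 hij
      linarith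
    · have h1 : Tendsto (fun j => F j x) atTop (𝓝 (f x)) := by
        simpa using (tendsto_tent x hRt).const_mul (f x)
      exact ENNReal.tendsto_ofReal (h1.rpow_const (Or.inr hb0.le))
  have hlim2 : Tendsto (fun j : ℕ => 2 * E +
      ENNReal.ofReal (2 * (1 ^ 2 * D * ((j:ℝ) + 1) ^ (γ - 2 * s))) * J) atTop (𝓝 (2 * E)) := by
    have h1 : Tendsto (fun j : ℕ => ((j:ℝ) + 1) ^ (-(2 * s - γ))) atTop (𝓝 0) :=
      (tendsto_rpow_neg_atTop (by linarith)).comp hRt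
    have h2 : Tendsto (fun j : ℕ => 2 * (1 ^ 2 * D * ((j:ℝ) + 1) ^ (γ - 2 * s))) atTop (𝓝 0) := by
      have := (h1.const_mul (1 ^ 2 * D)).const_mul 2
      simpa only [mul_zero, neg_sub] using this
    have h3 := ENNReal.tendsto_ofReal h2
    rw [ENNReal.ofReal_zero] at h3
    have h4 := (ENNReal.Tendsto.mul_const h3 (Or.inr hi)).const_add (2 * E)
    rwa [zero_mul, add_zero] at h4
  refine le_of_tendsto_of_tendsto' ?_ hlim2 hbound
  exact ENNReal.Tendsto.const_mul (((ENNReal.continuous_rpow_const).tendsto _).comp hlim1)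
    (Or.inr ENNReal.ofReal_ne_top)

end Sobolev

/-! ### From `L^p` to `L^∞` -/

section LevelSets

variable {d : ℕ} {s κ : ℝ} {ρ : Ed d → ℝ} {γ₀ γ c C : ℝ}

/-- The integral of a power of the weight over a set is controlled by the weighted measure of
the set. -/
lemma lintegral_weight_rpow_le (hd : 0 < d) (h : AdmissibleWeight d ρ γ₀ γ c C)
    (hγ₀γ : γ₀ ≤ γ) (hγ0 : 0 ≤ γ) (hγd : γ < d) {q : ℝ} (hq : 1 ≤ q) (hqd : γ * q < d)
    {A : Set (Ed d)} (hA : MeasurableSet A) {a : ℝ} (ha : 0 < a)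
    (hνA : wmeas ρ A = ENNReal.ofReal a) :
    ∫⁻ x in A, ENNReal.ofReal (ρ x ^ q) ≤
      ENNReal.ofReal ((C ^ q * sphereArea d / (d - γ * q) + C ^ (q - 1)) *
        a ^ ((d - γ * q) / (d - γ))) := by
  have hup := h.upper hd hγ₀γ
  obtain ⟨hc, hcC, hρm, hρ, -, -⟩ := h
  have hC : 0 < C := hc.trans hcC
  have hdγ : 0 < d - γ := by linarith
  have hdq : 0 < d - γ * q := by linarith
  have hsa := sphereArea_nonneg (d := d)
  set r := a ^ (1 / ((d:ℝ) - γ)) with hr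
  have hr0 : 0 < r := by positivity
  have hra : a = r ^ ((d:ℝ) - γ) := by
    rw [hr, ← Real.rpow_mul ha.le, one_div_mul_cancel hdγ.ne', Real.rpow_one]
  have har : a ^ (((d:ℝ) - γ * q) / (d - γ)) = r ^ ((d:ℝ) - γ * q) := by
    rw [hr, ← Real.rpow_mul ha.le]; congr 1; ring
  have hnear : ∫⁻ x in A ∩ Metric.ball 0 r, ENNReal.ofReal (ρ x ^ q) ≤
      ENNReal.ofReal (C ^ q * sphereArea d / (d - γ * q) * r ^ ((d:ℝ) - γ * q)) := by
    calc _ ≤ ∫⁻ x in Metric.ball 0 r, ENNReal.ofReal (ρ x ^ q) :=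
          lintegral_mono_set inter_subset_right
      _ ≤ ∫⁻ x in Metric.ball (0 : Ed d) r, ENNReal.ofReal (C ^ q) *
            ENNReal.ofReal (‖x‖ ^ (((d:ℝ) - γ * q) - d)) := by
          refine lintegral_mono_ae (ae_restrict_of_ae ?_)
          filter_upwards [hup] with x hx
          rw [← ENNReal.ofReal_mul (by positivity)]
          refine ENNReal.ofReal_le_ofReal
            ((Real.rpow_le_rpow (hρ x).le hx (by linarith)).trans_eq ?_)
          rw [Real.mul_rpow hC.le (by positivity), ← Real.rpow_mul (norm_nonneg x)]
          congr 2; ring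
      _ = _ := by
          rw [lintegral_const_mul' _ _ ENNReal.ofReal_ne_top, lintegral_ball_rpow hd hdq hr0,
            ← ENNReal.ofReal_mul (by positivity)]
          congr 1; ring
  have hfar : ∫⁻ x in A \ Metric.ball 0 r, ENNReal.ofReal (ρ x ^ q) ≤
      ENNReal.ofReal (C ^ (q - 1) * r ^ ((d:ℝ) - γ * q)) := by
    calc _ ≤ ∫⁻ x in A \ Metric.ball 0 r,
            ENNReal.ofReal ((C * r ^ (-γ)) ^ (q - 1)) * ENNReal.ofReal (ρ x) := by
          refine lintegral_mono_ae ?_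
          refine (ae_restrict_iff' (hA.diff measurableSet_ball)).2 ?_
          filter_upwards [hup] with x hx hxA
          have hxr : r ≤ ‖x‖ := by simpa using hxA.2
          have h1 : ρ x ≤ C * r ^ (-γ) := by
            refine hx.trans (mul_le_mul_of_nonneg_left ?_ hC.le)
            exact Real.rpow_le_rpow_of_nonpos hr0 hxr (by linarith)
          rw [← ENNReal.ofReal_mul (by positivity)]
          refine ENNReal.ofReal_le_ofReal ?_
          calc ρ x ^ q = ρ x ^ (q - 1) * ρ x := by
                rw [← Real.rpow_add_one (hρ x).ne']; congr 1; ring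
            _ ≤ _ := by
                have := hρ x
                gcongr
      _ ≤ ∫⁻ x in A, ENNReal.ofReal ((C * r ^ (-γ)) ^ (q - 1)) * ENNReal.ofReal (ρ x) :=
          lintegral_mono_set sdiff_subset
      _ = _ := by
          rw [lintegral_const_mul' _ _ ENNReal.ofReal_ne_top, ← withDensity_apply _ hA]
          change _ * wmeas ρ A = _
          rw [hνA, ← ENNReal.ofReal_mul (by positivity), hra,
            Real.mul_rpow hC.le (by positivity), ← Real.rpow_mul hr0.le, mul_assoc,
            ← Real.rpow_add hr0]
          congr 3; ring
  rw [← lintegral_inter_add_sdiff _ A measurableSet_ball (B := Metric.ball 0 r)]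
  refine (add_le_add hnear hfar).trans (le_of_eq ?_)
  rw [← ENNReal.ofReal_add (by positivity) (by positivity), har]
  congr 1; ring

/-- A constant in the level set estimate. -/
def levelConst (d : ℕ) (s γ C κ : ℝ) : ℝ :=
  2 / (κ * sobConst d s) *
    (C ^ (2 * d / (d + 2 * s)) * sphereArea d / (d - γ * (2 * d / (d + 2 * s))) +
      C ^ (2 * d / (d + 2 * s) - 1)) ^ ((d + 2 * s) / d)

lemma mul_holder_lt (hs0 : 0 < s) (hd : 2 * s < d) (hγs : γ < 2 * s) :
    γ * (2 * d / (d + 2 * s)) < d := by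
  have : (0:ℝ) < d := by linarith
  rw [mul_div_assoc', div_lt_iff₀ (by linarith)]
  nlinarith

lemma levelConst_pos (hs0 : 0 < s) (hd : 2 * s < d) (hγs : γ < 2 * s) (hC : 0 < C)
    (hκ : 0 < κ) : 0 < levelConst d s γ C κ := by
  have h1 := sobConst_pos (d := d) (s := s)
  have h2 := sub_pos.2 (mul_holder_lt hs0 hd hγs)
  have h3 := sphereArea_nonneg (d := d)
  unfold levelConst
  positivity

lemma integral_le_of_energy (hs0 : 0 < s) (hs1 : s < 1) (hd : 2 * s < d) (hκ : 0 < κ)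
    (h : AdmissibleWeight d ρ γ₀ γ c C) (hγ₀ : 0 ≤ γ₀) (hγ₀γ : γ₀ ≤ γ) (hγs : γ < 2 * s)
    {f : Ed d → ℝ} (hf : Measurable f) (hf0 : ∀ x, 0 ≤ f x) {B : ℝ} (hfB : ∀ x, f x ≤ B)
    (hfi : Integrable f (wmeas ρ)) {M : ℝ} (hM : 0 ≤ M)
    (he : ∫⁻ p, ENNReal.ofReal (wker d s κ ρ p.1 p.2 * (f p.1 - f p.2) ^ 2)
      ∂((wmeas ρ).prod (wmeas ρ)) ≤ ENNReal.ofReal (M * ∫ x, f x ∂wmeas ρ))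
    (hA : wmeas ρ {x | 0 < f x} ≠ ⊤) :
    ∫ x, f x ∂wmeas ρ ≤ levelConst d s γ C κ * M *
      (wmeas ρ).real {x | 0 < f x} ^ (1 + (2 * s - γ) / (d - γ)) := by
  have hγ0 : 0 ≤ γ := hγ₀.trans hγ₀γ
  have hd0 : (0:ℝ) < d := by linarith
  have hdn : 0 < d := Nat.cast_pos.1 hd0
  have hC : 0 < C := h.1.trans h.2.1
  have hρm := h.2.2.1
  have hρ := h.2.2.2.1
  have hL := levelConst_pos hs0 hd hγs hC hκ
  have hsob := sobConst_pos (d := d) (s := s)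
  set I := ∫ x, f x ∂wmeas ρ with hI
  set A := {x | 0 < f x} with hAdef
  have hAm : MeasurableSet A := measurableSet_lt measurable_const hf
  set a := (wmeas ρ).real A with ha
  have hνA : wmeas ρ A = ENNReal.ofReal a := (ENNReal.ofReal_toReal hA).symm
  have hI0 : 0 ≤ I := integral_nonneg hf0
  rcases hI0.eq_or_lt with hI0 | hI0
  · rw [← hI0]
    have : 0 ≤ a := measureReal_nonneg
    positivity
  have ha0 : 0 < a := by
    refine lt_of_le_of_ne measureReal_nonneg fun h0 => hI0.ne' ?_
    rw [← h0, ENNReal.ofReal_zero] at hνA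
    refine integral_eq_zero_of_ae ?_
    have : ∀ᵐ x ∂wmeas ρ, x ∉ A := measure_eq_zero_iff_ae_notMem.1 hνA
    filter_upwards [this] with x hx
    exact le_antisymm (not_lt.1 hx) (hf0 x)
  set b := sobExp d s with hb
  set q : ℝ := 2 * d / (d + 2 * s) with hq
  have hb' : 1 / b = (1 - 2 * s / d) / 2 := by
    have : (d:ℝ) - 2 * s ≠ 0 := by linarith
    rw [hb, sobExp]; field_simp
  have hq' : 1 / q = (1 + 2 * s / d) / 2 := by
    have : (d:ℝ) + 2 * s ≠ 0 := by linarith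
    rw [hq]; field_simp
  have hb0 : 0 < b := by
    have : (0:ℝ) < d - 2 * s := by linarith
    rw [hb, sobExp]; positivity
  have hq0 : 0 < q := by positivity
  have hq1 : 1 ≤ q := by rw [hq, one_le_div (by positivity)]; linarith
  have hbq : b.HolderConjugate q := by
    refine Real.holderConjugate_iff.2 ⟨?_, ?_⟩
    · rw [hb, sobExp, one_lt_div (by linarith)]; linarith
    · rw [← one_div, ← one_div, hb', hq']; ring
  set D := C ^ q * sphereArea d / (d - γ * q) + C ^ (q - 1) with hD
  have hD0 : 0 < D := by
    have h2 := sub_pos.2 (mul_holder_lt hs0 hd hγs)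
    have h3 := sphereArea_nonneg (d := d)
    positivity
  have hw := lintegral_weight_rpow_le hdn h hγ₀γ hγ0 (by linarith) hq1
    (mul_holder_lt hs0 hd hγs) hAm ha0 hνA
  rw [← hD] at hw
  set E := ∫⁻ p : Ed d × Ed d,
    ENNReal.ofReal ((f p.1 - f p.2) ^ 2 / ‖p.1 - p.2‖ ^ ((d:ℝ) + 2 * s)) with hE
  set P := ∫⁻ x, ENNReal.ofReal (f x ^ b) with hP
  have hIe : ENNReal.ofReal I = ∫⁻ x in A, ENNReal.ofReal (f x) * ENNReal.ofReal (ρ x) := by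
    rw [hI, ofReal_integral_eq_lintegral_ofReal hfi (ae_of_all _ hf0), lintegral_wmeas hρm,
      ← lintegral_indicator hAm]
    refine lintegral_congr fun x => ?_
    by_cases hx : x ∈ A
    · rw [indicator_of_mem hx, mul_comm]
    · have : f x = 0 := le_antisymm (not_lt.1 hx) (hf0 x)
      rw [indicator_of_notMem hx, this, ENNReal.ofReal_zero, mul_zero]
  have hHolder : ENNReal.ofReal I ≤ P ^ (1 / b) *
      ENNReal.ofReal (D * a ^ (((d:ℝ) - γ * q) / (d - γ))) ^ (1 / q) := by
    rw [hIe]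
    refine (ENNReal.lintegral_mul_le_Lp_mul_Lq _ hbq hf.ennreal_ofReal.aemeasurable
      hρm.ennreal_ofReal.aemeasurable).trans ?_
    gcongr
    · refine (setLIntegral_le_lintegral _ _).trans (le_of_eq (lintegral_congr fun x => ?_))
      rw [ENNReal.ofReal_rpow_of_nonneg (hf0 x) hb0.le]
    · refine le_trans (le_of_eq (lintegral_congr fun x => ?_)) hw
      rw [ENNReal.ofReal_rpow_of_nonneg (hρ x).le hq0.le]
  have hB : 0 ≤ B := (hf0 0).trans (hfB 0)
  have hf2 : ∫⁻ x, ENNReal.ofReal (f x ^ 2 * ρ x) ≠ ⊤ := by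
    refine ne_top_of_le_ne_top (ENNReal.ofReal_ne_top (r := B * I)) ?_
    rw [ENNReal.ofReal_mul hB, hI, ofReal_integral_eq_lintegral_ofReal hfi (ae_of_all _ hf0),
      lintegral_wmeas hρm, ← lintegral_const_mul' _ _ ENNReal.ofReal_ne_top]
    refine lintegral_mono fun x => ?_
    rw [← ENNReal.ofReal_mul (hρ x).le, ← ENNReal.ofReal_mul hB]
    refine ENNReal.ofReal_le_ofReal ?_
    have h1 := mul_le_mul_of_nonneg_right (hfB x) (mul_nonneg (hf0 x) (hρ x).le)
    nlinarith
  have hS := sobolev hs0 hs1 hd h hγ₀ hγ0 hγs hf hf0 hfB hf2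
  rw [← hb, ← hP, ← hE] at hS
  rw [lintegral_prod_wker hρm hρ hκ, ← hE] at he
  have hEfin : E ≠ ⊤ := by
    rintro h0
    rw [h0, ENNReal.mul_top (ENNReal.ofReal_pos.2 hκ).ne'] at he
    exact ENNReal.ofReal_ne_top (top_le_iff.1 he)
  obtain ⟨e, he0, hee⟩ : ∃ e : ℝ, 0 ≤ e ∧ E = ENNReal.ofReal e :=
    ⟨E.toReal, ENNReal.toReal_nonneg, (ENNReal.ofReal_toReal hEfin).symm⟩
  have hθ : 0 < 1 - 2 * s / d := by rw [sub_pos, div_lt_one hd0]; exact hd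
  have hPfin : P ≠ ⊤ := by
    rintro h0
    rw [h0, ENNReal.top_rpow_of_pos hθ, ENNReal.mul_top (ENNReal.ofReal_pos.2 hsob).ne'] at hS
    exact ENNReal.mul_ne_top (by simp) hEfin (top_le_iff.1 hS)
  obtain ⟨r, hr0, hr⟩ : ∃ r : ℝ, 0 ≤ r ∧ P = ENNReal.ofReal r :=
    ⟨P.toReal, ENNReal.toReal_nonneg, (ENNReal.ofReal_toReal hPfin).symm⟩
  have he2 : κ * e ≤ M * I := by
    rw [hee, ← ENNReal.ofReal_mul hκ.le] at he
    exact (ENNReal.ofReal_le_ofReal_iff (by positivity)).1 he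
  have hS2 : sobConst d s * r ^ (1 - 2 * s / d) ≤ 2 * e := by
    rw [hr, hee, ENNReal.ofReal_rpow_of_nonneg hr0 hθ.le, ← ENNReal.ofReal_mul hsob.le,
      show (2:ℝ≥0∞) = ENNReal.ofReal 2 by simp, ← ENNReal.ofReal_mul (by norm_num)] at hS
    exact (ENNReal.ofReal_le_ofReal_iff (by positivity)).1 hS
  have hH2 : I ≤ r ^ (1 / b) * (D * a ^ (((d:ℝ) - γ * q) / (d - γ))) ^ (1 / q) := by
    rw [hr, ENNReal.ofReal_rpow_of_nonneg hr0 (by positivity),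
      ENNReal.ofReal_rpow_of_nonneg (by positivity) (by positivity),
      ← ENNReal.ofReal_mul (by positivity)] at hHolder
    exact (ENNReal.ofReal_le_ofReal_iff (by positivity)).1 hHolder
  have hsq : I ^ 2 ≤ r ^ (1 - 2 * s / d) *
      (D ^ (((d:ℝ) + 2 * s) / d) * a ^ (1 + (2 * s - γ) / (d - γ))) := by
    refine (pow_le_pow_left₀ hI0.le hH2 2).trans_eq ?_
    have hdγ : (d:ℝ) - γ ≠ 0 := by linarith
    have hds : (d:ℝ) + 2 * s ≠ 0 := by linarith
    rw [Real.mul_rpow hD0.le (by positivity), mul_pow, mul_pow, ← Real.rpow_natCast,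
      ← Real.rpow_natCast, ← Real.rpow_natCast, ← Real.rpow_mul hr0, ← Real.rpow_mul hD0.le,
      ← Real.rpow_mul ha0.le, ← Real.rpow_mul ha0.le, hb', hq']
    congr 2
    · push_cast; ring
    · congr 1; push_cast; field_simp
    · rw [hq]; congr 1; push_cast; field_simp; ring
  have hfin : I * (κ * sobConst d s * I) ≤ I * (2 * M *
      (D ^ (((d:ℝ) + 2 * s) / d) * a ^ (1 + (2 * s - γ) / (d - γ)))) := by
    have hX : 0 < D ^ (((d:ℝ) + 2 * s) / d) * a ^ (1 + (2 * s - γ) / (d - γ)) := by positivity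
    generalize D ^ (((d:ℝ) + 2 * s) / d) * a ^ (1 + (2 * s - γ) / (d - γ)) = X at *
    calc I * (κ * sobConst d s * I) = κ * sobConst d s * I ^ 2 := by ring
      _ ≤ κ * sobConst d s * (r ^ (1 - 2 * s / d) * X) := by gcongr
      _ = κ * (sobConst d s * r ^ (1 - 2 * s / d)) * X := by ring
      _ ≤ κ * (2 * e) * X := by gcongr
      _ = 2 * (κ * e) * X := by ring
      _ ≤ 2 * (M * I) * X := by gcongr
      _ = _ := by ring
  have hfin2 := le_of_mul_le_mul_left hfin hI0
  rw [levelConst, ← hq, ← hD]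
  have : 0 < κ * sobConst d s := by positivity
  calc I ≤ 2 * M * (D ^ (((d:ℝ) + 2 * s) / d) * a ^ (1 + (2 * s - γ) / (d - γ))) /
        (κ * sobConst d s) := by
        rw [le_div_iff₀ this]; linarith
    _ = _ := by ring

end LevelSets

section Stampacchia

variable {Y : Type*} [MeasurableSpace Y] {ν : Measure Y}

lemma sub_mul_measureReal_le {w : Y → ℝ} {h h' : ℝ} (hh : h < h')
    (hi : Integrable (fun x => max (w x - h) 0) ν) :
    (h' - h) * ν.real {x | 0 < max (w x - h') 0} ≤ ∫ x, max (w x - h) 0 ∂ν := by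
  refine le_trans ?_ (mul_meas_ge_le_integral_of_nonneg
    (ae_of_all _ fun x => le_max_right _ _) hi (h' - h))
  have hfin : ν {x | h' - h ≤ max (w x - h) 0} ≠ ⊤ :=
    (hi.measure_ge_lt_top (sub_pos.2 hh)).ne
  refine mul_le_mul_of_nonneg_left (measureReal_mono (fun x hx => ?_) hfin) (sub_pos.2 hh).le
  have hx' : 0 < w x - h' := by
    simpa using hx
  change h' - h ≤ max (w x - h) 0
  exact le_max_of_le_left (by linarith)

/-- Stampacchia's iteration. -/
lemma ae_le_of_level_bound {w : Y → ℝ} {h₀ L σ : ℝ} (hL : 0 ≤ L)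
    (hσ : 0 < σ) (hi : ∀ h, h₀ ≤ h → Integrable (fun x => max (w x - h) 0) ν)
    (hfin : ∀ h, h₀ ≤ h → ν {x | 0 < max (w x - h) 0} ≠ ⊤)
    (hlev : ∀ h, h₀ ≤ h → ∫ x, max (w x - h) 0 ∂ν ≤
      L * ν.real {x | 0 < max (w x - h) 0} ^ (1 + σ)) :
    ∀ᵐ x ∂ν, w x ≤
      h₀ + L * ν.real {x | 0 < max (w x - h₀) 0} ^ σ * 2 ^ (1 + 1 / σ) := by
  set A : ℝ → Set Y := fun h => {x | 0 < max (w x - h) 0} with hA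
  set a₀ := ν.real (A h₀) with ha₀
  have ha₀0 : 0 ≤ a₀ := measureReal_nonneg
  set H := L * a₀ ^ σ * 2 ^ (1 + 1 / σ) with hH
  have hH0 : 0 ≤ H := by positivity
  rcases hH0.eq_or_lt with hH0 | hHpos
  · rw [← hH0, add_zero]
    have h1 : L * a₀ ^ (1 + σ) = 0 := by
      have h2 : L * a₀ ^ σ = 0 := by
        rcases mul_eq_zero.1 hH0.symm with h | h
        · exact h
        · exact absurd h (by positivity)
      rw [Real.rpow_add' ha₀0 (by positivity), Real.rpow_one, mul_left_comm, h2, mul_zero]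
    have h3 : ∫ x, max (w x - h₀) 0 ∂ν = 0 :=
      le_antisymm ((hlev h₀ le_rfl).trans h1.le) (integral_nonneg fun x => le_max_right _ _)
    rw [integral_eq_zero_iff_of_nonneg (f := fun x => max (w x - h₀) 0)
      (fun x => le_max_right _ _) (hi h₀ le_rfl)] at h3
    filter_upwards [h3] with x hx
    have := le_max_left (w x - h₀) 0
    rw [hx] at this
    simpa using this
  have hL0 : 0 < L := hL.lt_of_ne (by rintro rfl; simp [hH] at hHpos)
  have ha0 : 0 < a₀ := ha₀0.lt_of_ne (by
    intro h
    rw [hH, ← h, Real.zero_rpow hσ.ne'] at hHpos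
    simp at hHpos)
  set l : ℕ → ℝ := fun j => h₀ + H * (1 - (1 / 2) ^ j) with hl
  have hlh : ∀ j, h₀ ≤ l j := fun j => by
    have : ((1:ℝ) / 2) ^ j ≤ 1 := pow_le_one₀ (by norm_num) (by norm_num)
    simp only [hl]
    nlinarith
  have hdecay : ∀ j : ℕ, ν.real (A (l j)) ≤ a₀ * ((2:ℝ) ^ (-(1 / σ))) ^ j := by
    intro j
    induction j with
    | zero => simp [hl, ha₀]
    | succ j ih =>
      have hstep : l j < l (j + 1) := by
        simp only [hl, pow_succ]
        have : (0:ℝ) < (1 / 2) ^ j := by positivity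
        nlinarith
      have h1 := (sub_mul_measureReal_le hstep (hi _ (hlh j))).trans (hlev _ (hlh j))
      have hdiff : l (j + 1) - l j = H * (1 / 2) ^ (j + 1) := by
        simp only [hl, pow_succ]; ring
      rw [hdiff] at h1
      have hz : (0:ℝ) < 2 ^ (-(1 / σ)) := by positivity
      set z : ℝ := 2 ^ (-(1 / σ)) with hzdef
      have hzσ : z ^ σ = 1 / 2 := by
        rw [hzdef, ← Real.rpow_mul (by norm_num), neg_mul, one_div_mul_cancel hσ.ne',
          Real.rpow_neg_one]; norm_num
      have h2 : L * ν.real (A (l j)) ^ (1 + σ) ≤ L * (a₀ * z ^ j) ^ (1 + σ) := by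
        gcongr
      have h3 : L * (a₀ * z ^ j) ^ (1 + σ) = H * (1 / 2) ^ (j + 1) * (a₀ * z ^ (j + 1)) := by
        have h4 : (z ^ j) ^ σ = (1 / 2) ^ j := by
          rw [← Real.rpow_natCast, ← Real.rpow_mul hz.le, mul_comm, Real.rpow_mul hz.le, hzσ,
            Real.rpow_natCast]
        have h5 : (2:ℝ) ^ (1 + 1 / σ) * z = 2 := by
          rw [hzdef, ← Real.rpow_add (by norm_num)]; simp
        rw [Real.rpow_add (by positivity), Real.rpow_one, Real.mul_rpow ha0.le (by positivity),
          h4, hH]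
        calc L * (a₀ * z ^ j * (a₀ ^ σ * (1 / 2) ^ j))
            = L * a₀ ^ σ * a₀ * z ^ j * (1 / 2) ^ j * (1 / 2) * 2 := by ring
          _ = L * a₀ ^ σ * a₀ * z ^ j * (1 / 2) ^ j * (1 / 2) * (2 ^ (1 + 1 / σ) * z) := by
              rw [h5]
          _ = _ := by ring
      exact le_of_mul_le_mul_left ((h1.trans h2).trans h3.le) (by positivity)
  have hz1 : (2:ℝ) ^ (-(1 / σ)) < 1 :=
    Real.rpow_lt_one_of_one_lt_of_neg (by norm_num) (neg_lt_zero.2 (by positivity))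
  have hlim : Tendsto (fun j : ℕ => a₀ * ((2:ℝ) ^ (-(1 / σ))) ^ j) atTop (𝓝 0) := by
    simpa using (tendsto_pow_atTop_nhds_zero_of_lt_one (by positivity) hz1).const_mul a₀
  have hHge : h₀ ≤ h₀ + H := by linarith
  have hzero : ν.real (A (h₀ + H)) = 0 := by
    refine le_antisymm (ge_of_tendsto' hlim fun j => le_trans ?_ (hdecay j)) measureReal_nonneg
    refine measureReal_mono (fun x hx => ?_) (hfin _ (hlh j))
    have hx' : 0 < w x - (h₀ + H) := by
      have : 0 < max (w x - (h₀ + H)) 0 := hx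
      simpa using this
    change 0 < max (w x - l j) 0
    refine lt_max_of_lt_left ?_
    have : (0:ℝ) ≤ (1 / 2) ^ j := by positivity
    simp only [hl]
    nlinarith
  have hnull : ν (A (h₀ + H)) = 0 := (measureReal_eq_zero_iff (hfin _ hHge)).1 hzero
  filter_upwards [measure_eq_zero_iff_ae_notMem.1 hnull] with x hx
  by_contra! hcon
  refine hx ?_
  change 0 < max (w x - (h₀ + H)) 0
  exact lt_max_of_lt_left (by linarith)

end Stampacchia

section SupBound

lemma le_of_rpow_bound {m p σ t K M N : ℝ} (hm : 1 < m) (hp : 1 ≤ p) (hσ : 0 < σ) (ht : 0 < t)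
    (hK : 0 < K) (hM : 0 < M) (hN : 0 ≤ N)
    (h : M ^ m ≤ (M / 2) ^ m + K / 2 / t * M * ((M / 2) ^ (-p) * N ^ p) ^ σ) :
    M ≤ 2 * max 1 K ^ (1 / (m - 1)) * t ^ (-(1 / (m - 1 + σ * p))) *
      N ^ (σ * p / (m - 1 + σ * p)) := by
  have hm1 : 0 < m - 1 := by linarith
  have hσp : 0 < σ * p := by positivity
  set D := m - 1 + σ * p with hD
  have hD0 : 0 < D := by positivity
  have hDm : m - 1 ≤ D := by linarith
  have h1 : (M / 2) ^ m ≤ M ^ m / 2 := by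
    rw [Real.div_rpow hM.le (by norm_num)]
    gcongr
    simpa using Real.rpow_le_rpow_of_exponent_le (x := 2) (by norm_num) hm.le
  have h2 : M ^ m ≤ K / t * M * ((M / 2) ^ (-p) * N ^ p) ^ σ := by
    have : K / t * M * ((M / 2) ^ (-p) * N ^ p) ^ σ =
      2 * (K / 2 / t * M * ((M / 2) ^ (-p) * N ^ p) ^ σ) := by ring
    linarith
  have h3 : ((M / 2) ^ (-p) * N ^ p) ^ σ = M ^ (-(σ * p)) * (2 * N) ^ (σ * p) := by
    rw [Real.mul_rpow (by positivity) (by positivity), ← Real.rpow_mul (by positivity),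
      ← Real.rpow_mul hN, Real.div_rpow hM.le (by norm_num), Real.mul_rpow (by norm_num) hN,
      show -p * σ = -(σ * p) by ring, mul_comm p σ, Real.rpow_neg (by norm_num : (0:ℝ) ≤ 2)]
    field_simp
  have h4 : M ^ D ≤ K / t * (2 * N) ^ (σ * p) := by
    rw [h3] at h2
    have h5 : M ^ D = M ^ m * (M ^ (-(σ * p)) * M)⁻¹ := by
      rw [← Real.rpow_add_one hM.ne', ← Real.rpow_neg hM.le, ← Real.rpow_add hM]
      congr 1; rw [hD]; ring
    rw [h5, ← div_eq_mul_inv, div_le_iff₀ (by positivity)]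
    linarith
  have h6 : M ≤ (K / t * (2 * N) ^ (σ * p)) ^ (1 / D) := by
    have := Real.rpow_le_rpow (by positivity) h4 (one_div_nonneg.2 hD0.le)
    rwa [← Real.rpow_mul hM.le, mul_one_div_cancel hD0.ne', Real.rpow_one] at this
  refine h6.trans ?_
  rw [Real.mul_rpow (by positivity) (by positivity), ← Real.rpow_mul (by positivity),
    Real.mul_rpow (by norm_num) hN, Real.div_rpow hK.le ht.le, Real.rpow_neg ht.le,
    mul_one_div (σ * p) D]
  have h7 : K ^ (1 / D) ≤ max 1 K ^ (1 / (m - 1)) :=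
    (Real.rpow_le_rpow hK.le (le_max_right 1 K) (by positivity)).trans
      (Real.rpow_le_rpow_of_exponent_le (le_max_left 1 K) (by gcongr))
  have h8 : (2:ℝ) ^ (σ * p / D) ≤ 2 := by
    have : σ * p / D ≤ 1 := by rw [div_le_one hD0]; linarith
    simpa using Real.rpow_le_rpow_of_exponent_le (x := 2) (by norm_num) this
  calc K ^ (1 / D) / t ^ (1 / D) * (2 ^ (σ * p / D) * N ^ (σ * p / D))
      = 2 ^ (σ * p / D) * K ^ (1 / D) * (t ^ (1 / D))⁻¹ * N ^ (σ * p / D) := by ring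
    _ ≤ _ := by gcongr

variable {d : ℕ} {s κ : ℝ} {ρ : Ed d → ℝ} {γ₀ γ c C : ℝ} {m B t p : ℝ} {u₀ v : Ed d → ℝ}

lemma Slice.ae_rpow_le (hs0 : 0 < s) (hs1 : s < 1) (hd : 2 * s < d) (hκ : 0 < κ)
    (h : AdmissibleWeight d ρ γ₀ γ c C) (hγ₀ : 0 ≤ γ₀) (hγ₀γ : γ₀ ≤ γ) (hγs : γ < 2 * s)
    (hm : 1 < m) (hv : Measurable v) (hv0 : ∀ x, 0 ≤ v x) (hvB : ∀ x, v x ≤ B) (ht : 0 < t)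
    (hS : Slice (wmeas ρ) (wker d s κ ρ) m B u₀ v t) (hp : 1 ≤ p) {M : ℝ} (hM : 0 < M)
    (hvM : ∀ᵐ x ∂wmeas ρ, v x ≤ M) :
    ∀ᵐ x ∂wmeas ρ, v x ^ m ≤ (M / 2) ^ m + levelConst d s γ C κ * (2 / ((m - 1) * t) * M) *
      ((M / 2) ^ (-p) * ∫ x, u₀ x ^ p ∂wmeas ρ) ^ ((2 * s - γ) / (d - γ)) *
      2 ^ (1 + 1 / ((2 * s - γ) / (d - γ))) := by
  have hd0 : (0:ℝ) < d := by linarith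
  have hC : 0 < C := h.1.trans h.2.1
  have hm1 : 0 < m - 1 := by linarith
  have hL := levelConst_pos hs0 hd hγs hC hκ
  have hB0 : 0 ≤ B := (hv0 0).trans (hvB 0)
  have hσ : 0 < (2 * s - γ) / (d - γ) := div_pos (by linarith) (by linarith)
  have hpow : ∀ q : ℝ, 1 ≤ q → Integrable (fun x => v x ^ q) (wmeas ρ) := by
    intro q hq
    refine (hS.integrable.const_mul (B ^ (q - 1))).mono' (hv.pow_const q).aestronglyMeasurable
      (ae_of_all _ fun x => ?_)
    rw [Real.norm_of_nonneg (Real.rpow_nonneg (hv0 x) q)]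
    rcases (hv0 x).eq_or_lt with h0 | h0
    · rw [← h0, Real.zero_rpow (by linarith), mul_zero]
    · rw [show q = (q - 1) + 1 by ring, Real.rpow_add_one h0.ne']
      have := hvB x
      simp only [add_sub_cancel_right]
      gcongr
  have hfm : ∀ l, Measurable fun x => max (v x ^ m - l) 0 := fun l => by fun_prop
  have hf0 : ∀ l x, 0 ≤ max (v x ^ m - l) 0 := fun l x => le_max_right _ _
  have hfle : ∀ l, 0 ≤ l → ∀ x, max (v x ^ m - l) 0 ≤ v x ^ m := fun l hl x =>
    max_le (by linarith) (Real.rpow_nonneg (hv0 x) m)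
  have hfi : ∀ l, 0 ≤ l → Integrable (fun x => max (v x ^ m - l) 0) (wmeas ρ) := fun l hl =>
    (hpow m hm.le).mono' (hfm l).aestronglyMeasurable (ae_of_all _ fun x => by
      rw [Real.norm_of_nonneg (hf0 l x)]; exact hfle l hl x)
  have hsub : ∀ l, (M / 2) ^ m ≤ l → {x | 0 < max (v x ^ m - l) 0} ⊆
      {x | (M / 2) ^ p ≤ v x ^ p} := by
    intro l hl x hx
    have hx' : 0 < v x ^ m - l := by
      have : 0 < max (v x ^ m - l) 0 := hx
      simpa using this
    have h1 : M / 2 < v x :=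
      (Real.rpow_lt_rpow_iff (by positivity) (hv0 x) (by linarith)).1
        (show (M / 2) ^ m < v x ^ m by linarith)
    exact Real.rpow_le_rpow (by positivity) h1.le (by linarith)
  have hfin0 : wmeas ρ {x | (M / 2) ^ p ≤ v x ^ p} ≠ ⊤ :=
    ((hpow p hp).measure_ge_lt_top (by positivity)).ne
  have hmp : (0:ℝ) ≤ (M / 2) ^ m := by positivity
  have hlev := ae_le_of_level_bound (ν := wmeas ρ) (w := fun x => v x ^ m) (h₀ := (M / 2) ^ m)
    (L := levelConst d s γ C κ * (2 / ((m - 1) * t) * M)) (by positivity) hσ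
    (fun l hl => hfi l (hmp.trans hl))
    (fun l hl => ne_top_of_le_ne_top hfin0 (measure_mono (hsub l hl)))
    (fun l hl => by
      have hl0 := hmp.trans hl
      refine integral_le_of_energy hs0 hs1 hd hκ h hγ₀ hγ₀γ hγs (hfm l) (hf0 l) (B := B ^ m)
        (fun x => (hfle l hl0 x).trans (Real.rpow_le_rpow (hv0 x) (hvB x) (by linarith)))
        (hfi l hl0) (by positivity) ((hS.energy l hl0).trans (ENNReal.ofReal_le_ofReal ?_))
        (ne_top_of_le_ne_top hfin0 (measure_mono (hsub l hl)))
      rw [mul_assoc, ← integral_const_mul M]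
      refine mul_le_mul_of_nonneg_left (integral_mono_of_nonneg
        (ae_of_all _ fun x => mul_nonneg (hv0 x) (hf0 l x)) ((hfi l hl0).const_mul M) ?_)
        (by positivity)
      filter_upwards [hvM] with x hx
      exact mul_le_mul_of_nonneg_right hx (hf0 l x))
  have ha : (wmeas ρ).real {x | 0 < max (v x ^ m - (M / 2) ^ m) 0} ≤
      (M / 2) ^ (-p) * ∫ x, u₀ x ^ p ∂wmeas ρ := by
    refine (measureReal_mono (hsub _ le_rfl) hfin0).trans ?_
    have h1 := (mul_meas_ge_le_integral_of_nonneg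
      (ae_of_all _ fun x => Real.rpow_nonneg (hv0 x) p) (hpow p hp) ((M / 2) ^ p)).trans
      (hS.rpow_le p hp)
    rw [Real.rpow_neg (by positivity), inv_mul_eq_div, le_div_iff₀ (by positivity), mul_comm]
    exact h1
  filter_upwards [hlev] with x hx
  refine hx.trans ?_
  gcongr

/-- A constant in the smoothing effect. -/
def smoothConst (d : ℕ) (s m γ C κ : ℝ) : ℝ :=
  2 * max 1 (4 * levelConst d s γ C κ / (m - 1) * 2 ^ (1 + 1 / ((2 * s - γ) / (d - γ)))) ^
    (1 / (m - 1))

lemma smoothConst_pos : 0 < smoothConst d s m γ C κ := by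
  unfold smoothConst; positivity

lemma Slice.ae_le (hs0 : 0 < s) (hs1 : s < 1) (hd : 2 * s < d) (hκ : 0 < κ)
    (h : AdmissibleWeight d ρ γ₀ γ c C) (hγ₀ : 0 ≤ γ₀) (hγ₀γ : γ₀ ≤ γ) (hγs : γ < 2 * s)
    (hm : 1 < m) (hv : Measurable v) (hv0 : ∀ x, 0 ≤ v x) (hvB : ∀ x, v x ≤ B) (ht : 0 < t)
    (hS : Slice (wmeas ρ) (wker d s κ ρ) m B u₀ v t) (hp : 1 ≤ p) {N : ℝ} (hN : 0 ≤ N)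
    (hu₀N : ∫ x, u₀ x ^ p ∂wmeas ρ = N ^ p) :
    ∀ᵐ x ∂wmeas ρ, v x ≤ smoothConst d s m γ C κ *
      t ^ (-((d - γ) / ((m - 1) * (d - γ) + (2 * s - γ) * p))) *
      N ^ ((2 * s - γ) * p / ((m - 1) * (d - γ) + (2 * s - γ) * p)) := by
  have hd0 : (0:ℝ) < d := by linarith
  have hC : 0 < C := h.1.trans h.2.1
  have hm1 : 0 < m - 1 := by linarith
  have hL := levelConst_pos hs0 hd hγs hC hκ
  have hdγ : 0 < d - γ := by linarith
  have hσ : 0 < (2 * s - γ) / (d - γ) := div_pos (by linarith) hdγ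
  have hσ' : 0 < 2 * s - γ := by linarith
  set σ := (2 * s - γ) / (d - γ) with hσd
  have e1 : (d - γ) / ((m - 1) * (d - γ) + (2 * s - γ) * p) = 1 / (m - 1 + σ * p) := by
    have : m - 1 + σ * p ≠ 0 := by positivity
    rw [hσd] at *
    field_simp
  have e2 : (2 * s - γ) * p / ((m - 1) * (d - γ) + (2 * s - γ) * p) =
      σ * p / (m - 1 + σ * p) := by
    rw [hσd] at *
    field_simp
  rw [e1, e2]
  set S := essSup (fun x => ENNReal.ofReal (v x)) (wmeas ρ) with hSd
  have hSB : S ≤ ENNReal.ofReal B :=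
    essSup_le_of_ae_le _ (ae_of_all _ fun x => ENNReal.ofReal_le_ofReal (hvB x))
  have hStop : S ≠ ⊤ := ne_top_of_le_ne_top ENNReal.ofReal_ne_top hSB
  have hvS : ∀ᵐ x ∂wmeas ρ, v x ≤ S.toReal := by
    filter_upwards [ENNReal.ae_le_essSup fun x => ENNReal.ofReal (v x)] with x hx
    exact (ENNReal.ofReal_le_iff_le_toReal hStop).1 hx
  have hgoal : S.toReal ≤ smoothConst d s m γ C κ * t ^ (-(1 / (m - 1 + σ * p))) *
      N ^ (σ * p / (m - 1 + σ * p)) := by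
    rcases (ENNReal.toReal_nonneg (a := S)).eq_or_lt with h0 | hM
    · rw [← h0]
      have := smoothConst_pos (d := d) (s := s) (m := m) (γ := γ) (C := C) (κ := κ)
      positivity
    refine le_of_rpow_bound (K := 4 * levelConst d s γ C κ / (m - 1) * 2 ^ (1 + 1 / σ)) hm hp hσ ht (by positivity) hM hN ?_
    have h1 := hS.ae_rpow_le hs0 hs1 hd hκ h hγ₀ hγ₀γ hγs hm hv hv0 hvB ht hp hM hvS
    rw [hu₀N, ← hσd] at h1
    set Y := (S.toReal / 2) ^ m + levelConst d s γ C κ * (2 / ((m - 1) * t) * S.toReal) *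
      ((S.toReal / 2) ^ (-p) * N ^ p) ^ σ * 2 ^ (1 + 1 / σ) with hY
    have hY0 : 0 ≤ Y := by positivity
    have hm0 : 0 < m := by linarith
    have h2 : S ≤ ENNReal.ofReal (Y ^ (1 / m)) := by
      refine essSup_le_of_ae_le _ ?_
      filter_upwards [h1] with x hx
      refine ENNReal.ofReal_le_ofReal ?_
      have := Real.rpow_le_rpow (Real.rpow_nonneg (hv0 x) m) hx (one_div_nonneg.2 hm0.le)
      rwa [← Real.rpow_mul (hv0 x), mul_one_div_cancel hm0.ne', Real.rpow_one] at this
    have h3 : S.toReal ≤ Y ^ (1 / m) := ENNReal.toReal_le_of_le_ofReal (by positivity) h2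
    have h4 : S.toReal ^ m ≤ Y := by
      have := Real.rpow_le_rpow hM.le h3 hm0.le
      rwa [← Real.rpow_mul hY0, one_div_mul_cancel hm0.ne', Real.rpow_one] at this
    refine h4.trans_eq ?_
    rw [hY]
    congr 1
    generalize (2:ℝ) ^ (1 + 1 / σ) = Z
    generalize ((S.toReal / 2) ^ (-p) * N ^ p) ^ σ = W
    field_simp
    ring
  filter_upwards [hvS] with x hx
  exact hx.trans hgoal

end SupBound

section Assembly

variable {d : ℕ} {s κ : ℝ} {ρ : Ed d → ℝ} {γ₀ γ c C : ℝ} {m B : ℝ} {u₀ : Ed d → ℝ}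
  {v : Ed d → ℝ → ℝ}

lemma Slice.gagliardoSq_le (hρm : Measurable ρ) (hρ : ∀ x, 0 < ρ x) (hκ : 0 < κ) (hm : 1 < m)
    {t : ℝ} (ht : 0 < t) {w : Ed d → ℝ} (hw : ∀ x, 0 ≤ w x) (hwB : ∀ x, w x ≤ B)
    (h : Slice (wmeas ρ) (wker d s κ ρ) m B u₀ w t) :
    gagliardoSq d s κ (fun x => w x ^ m) ≤
      ENNReal.ofReal (2 / ((m - 1) * t) * (B ^ m * ∫ x, u₀ x ∂wmeas ρ)) := by
  have hm1 : 0 < m - 1 := by linarith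
  have he := h.energy 0 le_rfl
  have hpos : ∀ x, max (w x ^ m - 0) 0 = w x ^ m := fun x => by
    rw [sub_zero, max_eq_left (Real.rpow_nonneg (hw x) m)]
  simp only [hpos] at he
  rw [lintegral_prod_wker_eq_gagliardoSq hρm hρ hκ (fun x => w x ^ m)] at he
  have h2 : gagliardoSq d s κ (fun x => w x ^ m) ≤ 2 * gagliardoSq d s κ (fun x => w x ^ m) :=
    le_mul_of_one_le_left' (by norm_num)
  refine h2.trans (he.trans (ENNReal.ofReal_le_ofReal ?_))
  rw [← h.integral_eq, ← integral_const_mul (B ^ m)]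
  refine mul_le_mul_of_nonneg_left (integral_mono_of_nonneg
    (ae_of_all _ fun x => mul_nonneg (hw x) (Real.rpow_nonneg (hw x) m))
    (h.integrable.const_mul _) (ae_of_all _ fun x => ?_)) (by positivity)
  have h1 : w x ^ m ≤ B ^ m := Real.rpow_le_rpow (hw x) (hwB x) (by linarith)
  have := mul_le_mul_of_nonneg_left h1 (hw x)
  linarith

lemma weakSolCore_of_slices (hρm : Measurable ρ) (hρ : ∀ x, 0 < ρ x) (hκ : 0 < κ) (hm : 1 < m)
    (hv : Measurable (Function.uncurry v)) (hv0 : ∀ x t, 0 ≤ v x t) (hvB : ∀ x t, v x t ≤ B)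
    (hS : ∀ᵐ t ∂(volume.restrict (Ioi (0:ℝ))),
      Slice (wmeas ρ) (wker d s κ ρ) m B u₀ (fun x => v x t) t)
    (hweak : ∀ φ : Ed d × ℝ → ℝ, IsTestFn d φ →
      ∫ t in Ioi (0:ℝ), ∫ x, v x t * deriv (fun τ => φ (x, τ)) t ∂wmeas ρ =
        ∫ t in Ioi (0:ℝ), dform (wmeas ρ) (wker d s κ ρ) (fun x => v x t ^ m)
          fun x => φ (x, t)) :
    WeakSolCore d s m κ ρ v where
  measurable := hv
  nonneg := hv0
  massBound := by
    refine ⟨∫ x, u₀ x ∂wmeas ρ, ?_⟩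
    filter_upwards [hS] with t ht
    exact ⟨(integrable_wmeas_iff hρm hρ _).1 ht.integrable,
      ((integral_wmeas hρm hρ _).symm.trans ht.integral_eq).le⟩
  essBdd τ _ := ⟨B, ae_of_all _ fun p _ => hvB p.1 p.2⟩
  energyFinite := by
    filter_upwards [hS, ae_restrict_mem measurableSet_Ioi] with t ht ht0
    exact (ht.gagliardoSq_le hρm hρ hκ hm ht0 (hv0 · t) (hvB · t)).trans_lt ENNReal.ofReal_lt_top
  energyLocInt t₁ t₂ h₁ h₂ := by
    have hm1 : 0 < m - 1 := by linarith
    have hsub : Ioc t₁ t₂ ⊆ Ioi 0 := fun t ht => h₁.trans ht.1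
    have hS' : ∀ᵐ t ∂(volume.restrict (Ioc t₁ t₂)), gagliardoSq d s κ (fun x => v x t ^ m) ≤
        ENNReal.ofReal (2 / ((m - 1) * t₁) * (B ^ m * ∫ x, u₀ x ∂wmeas ρ)) := by
      filter_upwards [ae_restrict_of_ae_restrict_of_subset hsub hS,
        ae_restrict_mem measurableSet_Ioc] with t ht htm
      refine (ht.gagliardoSq_le hρm hρ hκ hm (hsub htm) (hv0 · t) (hvB · t)).trans
        (ENNReal.ofReal_le_ofReal (mul_le_mul_of_nonneg_right ?_ ?_))
      · have := htm.1.le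
        gcongr
      · rw [← ht.integral_eq]
        exact mul_nonneg (Real.rpow_nonneg ((hv0 0 t).trans (hvB 0 t)) m)
          (integral_nonneg (hv0 · t))
    refine ne_top_of_le_ne_top ?_ (lintegral_mono_ae hS')
    rw [setLIntegral_const]
    exact ENNReal.mul_ne_top ENNReal.ofReal_ne_top (by simp)
  weakForm φ hφ := by
    have h1 := hweak φ hφ
    simp only [dform_wker hρm hρ, integral_wmeas hρm hρ] at h1
    rw [h1]
    ring

lemma hasInitialTrace_of_slices (hd : 0 < d) (hs0 : 0 < s) (hs1 : s < 1) (hκ : 0 < κ)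
    (ha : AdmissibleWeight d ρ γ₀ γ c C) (hγ₀ : 0 ≤ γ₀) (hγ₀γ : γ₀ ≤ γ) (hγs : γ < 2 * s)
    (hγd : γ < d) (hv : Measurable (Function.uncurry v)) (hv0 : ∀ x t, 0 ≤ v x t)
    (hum : Measurable u₀) (hu0 : ∀ x, 0 ≤ u₀ x) (hu : Integrable u₀ (wmeas ρ))
    (hS : ∀ᵐ t ∂(volume.restrict (Ioi (0:ℝ))),
      Slice (wmeas ρ) (wker d s κ ρ) m B u₀ (fun x => v x t) t) :
    HasInitialTrace d ρ v (volume.withDensity fun x => ENNReal.ofReal (u₀ x * ρ x)) := by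
  classical
  have hρm := ha.2.2.1
  have hρ := ha.2.2.2.1
  rw [ae_restrict_iff' measurableSet_Ioi, ae_iff] at hS
  refine ⟨_, hS, fun φ hφ hφb => ?_⟩
  set N := {t : ℝ | ¬(t ∈ Ioi 0 →
    Slice (wmeas ρ) (wker d s κ ρ) m B u₀ (fun x => v x t) t)} with hN
  set T : Set ℝ := Ioi 0 \ N with hT
  have hTS : ∀ t ∈ T, Slice (wmeas ρ) (wker d s κ ρ) m B u₀ (fun x => v x t) t :=
    fun t ht => not_not.1 ht.2 ht.1
  set w : ℝ → Ed d → ℝ := fun t x => if t ∈ T then v x t else u₀ x with hw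
  have hwT : ∀ t ∈ T, w t = fun x => v x t := fun t ht => by simp [hw, ht]
  have hwT' : ∀ t, t ∉ T → w t = u₀ := fun t ht => by simp [hw, ht]
  have hwv : ∀ f : Ed d → ℝ, (fun t => ∫ x, v x t * f x ∂wmeas ρ) =ᶠ[𝓝[T] 0]
      fun t => ∫ x, w t x * f x ∂wmeas ρ := fun f => by
    filter_upwards [self_mem_nhdsWithin] with t ht
    rw [hwT t ht]
  have key := tendsto_integral_of_lipschitz (ν := wmeas ρ) (l := 𝓝[T] 0) (w := w) (w₀ := u₀)
    (fun t => by
      by_cases ht : t ∈ T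
      · rw [hwT t ht]; exact hv.comp (measurable_id.prodMk measurable_const)
      · rw [hwT' t ht]; exact hum) hum
    (fun t x => by
      by_cases ht : t ∈ T
      · rw [hwT t ht]; exact hv0 x t
      · rw [hwT' t ht]; exact hu0 x) hu0
    (fun t => by
      by_cases ht : t ∈ T
      · rw [hwT t ht]; exact (hTS t ht).integrable
      · rw [hwT' t ht]; exact hu) hu
    (fun t => by
      by_cases ht : t ∈ T
      · rw [hwT t ht]; exact (hTS t ht).integral_eq
      · rw [hwT' t ht])
    (fun f hfb hf => (tendsto_congr' (hwv f)).1
      (tendsto_integral_of_slices_of_lipschitz hd hs0 hs1 hκ ha hγ₀ hγ₀γ hγs hγd sdiff_subset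
        hTS hv0 hu hu0 hfb hf)) hφ hφb
  have h1 : ∫ x, φ x ∂(volume.withDensity fun x => ENNReal.ofReal (u₀ x * ρ x)) =
      ∫ x, u₀ x * φ x ∂wmeas ρ := by
    rw [integral_wmeas hρm hρ, integral_withDensity_eq_integral_toReal_smul (by fun_prop)
      (ae_of_all _ fun _ => ENNReal.ofReal_lt_top)]
    refine integral_congr_ae (ae_of_all _ fun x => ?_)
    simp only [ENNReal.toReal_ofReal (mul_nonneg (hu0 x) (hρ x).le), smul_eq_mul]
    ring
  rw [h1]
  refine (key.congr' (hwv φ).symm).congr fun t => ?_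
  rw [integral_wmeas hρm hρ]
  refine integral_congr_ae (ae_of_all _ fun x => ?_)
  ring

lemma integral_rpow_eq_wnorm (hρm : Measurable ρ) (hum : Measurable u₀)
    (hu0 : ∀ x, 0 ≤ u₀ x) (huB : ∀ x, u₀ x ≤ B) (hu : Integrable u₀ (wmeas ρ)) {p : ℝ}
    (hp : 1 ≤ p) : ∫ x, u₀ x ^ p ∂wmeas ρ = (wnorm d p ρ u₀).toReal ^ p := by
  have hi : Integrable (fun x => u₀ x ^ p) (wmeas ρ) := by
    refine (hu.const_mul (B ^ (p - 1))).mono' (hum.pow_const p).aestronglyMeasurable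
      (ae_of_all _ fun x => ?_)
    rw [Real.norm_of_nonneg (Real.rpow_nonneg (hu0 x) p)]
    rcases (hu0 x).eq_or_lt with h0 | h0
    · rw [← h0, Real.zero_rpow (by linarith), mul_zero]
    · rw [show p = (p - 1) + 1 by ring, Real.rpow_add_one h0.ne']
      have := huB x
      simp only [add_sub_cancel_right]
      gcongr
  have hI0 : 0 ≤ ∫ x, u₀ x ^ p ∂wmeas ρ := integral_nonneg fun x => Real.rpow_nonneg (hu0 x) p
  have h1 : ∫⁻ x, ENNReal.ofReal (|u₀ x| ^ p * ρ x) =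
      ENNReal.ofReal (∫ x, u₀ x ^ p ∂wmeas ρ) := by
    rw [ofReal_integral_eq_lintegral_ofReal hi (ae_of_all _ fun x => Real.rpow_nonneg (hu0 x) p),
      lintegral_wmeas hρm]
    refine lintegral_congr fun x => ?_
    rw [abs_of_nonneg (hu0 x), ENNReal.ofReal_mul (Real.rpow_nonneg (hu0 x) p), mul_comm]
  rw [wnorm, h1, ENNReal.ofReal_rpow_of_nonneg hI0 (by positivity),
    ENNReal.toReal_ofReal (by positivity), ← Real.rpow_mul hI0,
    one_div_mul_cancel (by linarith), Real.rpow_one]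

/-- The smoothing effect for measurable, everywhere bounded initial data. -/
theorem exists_weakSolution (hs0 : 0 < s) (hs1 : s < 1) (hd : 2 * s < d) (hκ : 0 < κ)
    (hm : 1 < m) (ha : AdmissibleWeight d ρ γ₀ γ c C) (hγ₀ : 0 ≤ γ₀) (hγ₀γ : γ₀ ≤ γ)
    (hγs : γ < 2 * s) (hum : Measurable u₀) (hu0 : ∀ x, 0 ≤ u₀ x) (huB : ∀ x, u₀ x ≤ B)
    (hu : Integrable u₀ (wmeas ρ)) {p : ℝ} (hp : 1 ≤ p) :
    ∃ u : Ed d → ℝ → ℝ,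
      IsWeakSolution d s m κ ρ (volume.withDensity fun x => ENNReal.ofReal (u₀ x * ρ x)) u ∧
      ∀ᵐ t ∂(volume.restrict (Ioi (0:ℝ))), ∀ᵐ x ∂(volume : Measure (Ed d)),
        u x t ≤ smoothConst d s m γ C κ *
          t ^ (-((d - γ) / ((m - 1) * (d - γ) + (2 * s - γ) * p))) *
          (wnorm d p ρ u₀).toReal ^
            ((2 * s - γ) * p / ((m - 1) * (d - γ) + (2 * s - γ) * p)) := by
  have hdn : 0 < d := Nat.cast_pos.1 (show (0:ℝ) < d by linarith)
  have hγd : γ < d := hγs.trans hd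
  have hρm := ha.2.2.1
  have hρ := ha.2.2.2.1
  have hB : 0 ≤ B := (hu0 0).trans (huB 0)
  obtain ⟨G, hG⟩ := exists_cutoffs hdn hs0 hs1 hκ ha hγ₀ hγ₀γ hγs hγd
  obtain ⟨v, hv, hvB, hS, hweak⟩ :=
    (kerSys hdn hs0 hκ hρm hρ).exists_solution hG hm hB hum hu0 huB hu
  refine ⟨v, ⟨weakSolCore_of_slices hρm hρ hκ hm hv (fun x t => (hvB x t).1)
    (fun x t => (hvB x t).2) hS fun φ hφ => ?_, hasInitialTrace_of_slices hdn hs0 hs1 hκ ha hγ₀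
    hγ₀γ hγs hγd hv (fun x t => (hvB x t).1) hum hu0 hu hS⟩, ?_⟩
  · obtain ⟨A, a, T, M, Γ, hT⟩ := exists_testPair hdn hs0 hs1 hκ ha hγ₀ hγ₀γ hγs hγd hφ
    exact hweak _ _ A a T M Γ hT
  · filter_upwards [hS, ae_restrict_mem measurableSet_Ioi] with t ht ht0
    exact (ae_wmeas_iff hρm hρ).1 (ht.ae_le hs0 hs1 hd hκ ha hγ₀ hγ₀γ hγs hm
      (hv.comp (measurable_id.prodMk measurable_const)) (fun x => (hvB x t).1)
      (fun x => (hvB x t).2) ht0 hp ENNReal.toReal_nonneg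
      (integral_rpow_eq_wnorm hρm hum hu0 huB hu hp))

end Assembly

end FracPME

/-- **Smoothing effect.** There exists `K > 0`, depending only on `m, γ, s, d`
and the constant `C` of the weight bounds (and on `κ`), such that for every
`p₀ ∈ [1,∞)` and every nonnegative `u₀ ∈ L¹_ρ(ℝ^d) ∩ L^∞(ℝ^d)` there is a
weak solution `u` with initial datum `u₀(x)ρ(x)dx` satisfying
`ess sup_x u(x,t) ≤ K t^{-α₀} ‖u₀‖_{p₀,ρ}^{β₀}` for a.e. `t > 0`, where
`α₀ = (d-γ)/((m-1)(d-γ)+(2s-γ)p₀)` and `β₀ = (2s-γ)p₀/((m-1)(d-γ)+(2s-γ)p₀)`. -/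
theorem smoothing_effect
    (d : ℕ) (s m γ C κ : ℝ)
    (hs0 : 0 < s) (hs1 : s < 1) (hd : 2 * s < (d : ℝ)) (hm : 1 < m) (hκ : 0 < κ)
    (hγ0 : 0 ≤ γ) (hγs : γ < 2 * s) (hγd : γ ≤ (d : ℝ) - 2 * s) (hC : 0 < C) :
    ∃ K : ℝ, 0 < K ∧
      ∀ (p₀ γ₀ c : ℝ) (ρ : Ed d → ℝ), 1 ≤ p₀ → 0 ≤ γ₀ → γ₀ ≤ γ →
        AdmissibleWeight d ρ γ₀ γ c C →
        ∀ u₀ : Ed d → ℝ, (∀ x, 0 ≤ u₀ x) →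
          Integrable (fun x : Ed d => u₀ x * ρ x) →
          (∃ B : ℝ, ∀ᵐ x ∂(volume : Measure (Ed d)), u₀ x ≤ B) →
          ∃ u : Ed d → ℝ → ℝ,
            IsWeakSolution d s m κ ρ
              (volume.withDensity fun x => ENNReal.ofReal (u₀ x * ρ x)) u ∧
            ∀ᵐ t ∂(volume.restrict (Ioi (0 : ℝ))), ∀ᵐ x ∂(volume : Measure (Ed d)),
              u x t ≤ K *
                t ^ (-(((d : ℝ) - γ) / ((m - 1) * ((d : ℝ) - γ) + (2 * s - γ) * p₀))) *
                ((wnorm d p₀ ρ u₀).toReal) ^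
                  ((2 * s - γ) * p₀ / ((m - 1) * ((d : ℝ) - γ) + (2 * s - γ) * p₀)) := by
  refine ⟨FracPME.smoothConst d s m γ C κ, FracPME.smoothConst_pos, ?_⟩
  intro p₀ γ₀ c ρ hp hγ₀ hγ₀γ ha u₀ hu0 hu hB
  obtain ⟨B, hB⟩ := hB
  have hρm := ha.2.2.1
  have hρ := ha.2.2.2.1
  have hum : AEMeasurable u₀ := by
    refine (hu.aemeasurable.div hρm.aemeasurable).congr (ae_of_all _ fun x => ?_)
    have := (hρ x).ne'
    simp [this]
  set w : Ed d → ℝ := fun x => max 0 (min (max B 0) (hum.mk u₀ x)) with hw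
  have hwm : Measurable w := measurable_const.max (measurable_const.min hum.measurable_mk)
  have hw0 : ∀ x, 0 ≤ w x := fun x => le_max_left _ _
  have hwB : ∀ x, w x ≤ max B 0 := fun x => max_le (le_max_right _ _) (min_le_left _ _)
  have huw : u₀ =ᵐ[volume] w := by
    filter_upwards [hum.ae_eq_mk, hB] with x hx hxB
    rw [hw]
    simp only
    rw [← hx, min_eq_right (hxB.trans (le_max_left _ _)), max_eq_right (hu0 x)]
  have hwi : Integrable w (FracPME.wmeas ρ) := by
    refine (FracPME.integrable_wmeas_iff hρm hρ w).2 (hu.congr ?_)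
    filter_upwards [huw] with x hx
    rw [hx]
  have hmeas : (volume.withDensity fun x => ENNReal.ofReal (u₀ x * ρ x)) =
      volume.withDensity fun x => ENNReal.ofReal (w x * ρ x) := by
    refine withDensity_congr_ae ?_
    filter_upwards [huw] with x hx
    rw [hx]
  have hnorm : wnorm d p₀ ρ u₀ = wnorm d p₀ ρ w := by
    rw [wnorm, wnorm]
    congr 1
    refine lintegral_congr_ae ?_
    filter_upwards [huw] with x hx
    rw [hx]
  rw [hmeas, hnorm]
  exact FracPME.exists_weakSolution hs0 hs1 hd hκ hm ha hγ₀ hγ₀γ hγs hwm hw0 hwB hwi hp
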